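/- Unlimited-communication limit: For every bipartite quantum state ρ^{AB} on finite-dimensional systems, in the limit R → ∞ the 1-way distillable local purity with bounded communication reduces to the unbounded-communication rate: κ_→(ρ^{AB}, ∞) = κ(ρ^A) + κ(ρ^B) + lim_{n→∞} (1/n) max_Λ I(X;B^n)_{(Λ⊗I)ρ^{⊗n}}, where the maximization is over all rank-1 POVMs Λ : H_{A^n} → H_X on Alice's system; i.e., P_→(ρ^{AB}, ∞) equals the one-way distillable common randomness D_→(ρ^{AB}). -/

import Mathlib

noncomputable section
namespace LPD

open Matrix Kronecker BigOperators Filter Finset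
open scoped ComplexOrder

/-- The positive semidefinite square root of a positive semidefinite matrix
(the definition of the older Mathlib, since removed there). -/
def _root_.Matrix.PosSemidef.sqrt {n 𝕜 : Type*} [Fintype n] [RCLike 𝕜] [DecidableEq n]
    {A : Matrix n n 𝕜} (hA : A.PosSemidef) : Matrix n n 𝕜 :=
  hA.1.eigenvectorUnitary.1 * diagonal ((↑) ∘ Real.sqrt ∘ hA.1.eigenvalues) *
    (star hA.1.eigenvectorUnitary : Matrix n n 𝕜)

/-- The trace norm `‖ω‖₁ = Tr √(ωᴴ ω)` of a matrix. -/
def traceNorm {ι : Type*} [Fintype ι] [DecidableEq ι] (ω : Matrix ι ι ℂ) : ℝ :=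
  ((Matrix.posSemidef_conjTranspose_mul_self ω).sqrt).trace.re

/-- A density operator: positive semidefinite with trace one. -/
def IsDensity {ι : Type*} [Fintype ι] (ρ : Matrix ι ι ℂ) : Prop :=
  ρ.PosSemidef ∧ ρ.trace = 1

/-- The von Neumann entropy `H(ρ) = -Tr(ρ log ρ)`, expressed via eigenvalues
(with the convention `0 log 0 = 0`, and junk value `0` on non-Hermitian input). -/
def entropy {ι : Type*} [Fintype ι] [DecidableEq ι] (ρ : Matrix ι ι ℂ) : ℝ :=
  letI := Classical.dec ρ.IsHermitian
  if h : ρ.IsHermitian then -∑ i, h.eigenvalues i * Real.log (h.eigenvalues i) else 0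

/-- Partial trace over the first (left) tensor factor. -/
def ptraceLeft {α β : Type*} [Fintype α] (ρ : Matrix (α × β) (α × β) ℂ) : Matrix β β ℂ :=
  fun b b' => ∑ a, ρ (a, b) (a, b')

/-- Partial trace over the second (right) tensor factor. -/
def ptraceRight {α β : Type*} [Fintype β] (ρ : Matrix (α × β) (α × β) ℂ) : Matrix α α ℂ :=
  fun a a' => ∑ b, ρ (a, b) (a', b)

/-- Quantum mutual information `I(A;B) = H(A) + H(B) - H(AB)` of a bipartite state. -/
def mutualInfo {α β : Type*} [Fintype α] [DecidableEq α] [Fintype β] [DecidableEq β]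
    (ρ : Matrix (α × β) (α × β) ℂ) : ℝ :=
  entropy (ptraceRight ρ) + entropy (ptraceLeft ρ) - entropy ρ

/-- Conditional entropy `H(B|A) = H(AB) - H(A)` (second system conditioned on the first). -/
def condEntropySnd {α β : Type*} [Fintype α] [DecidableEq α] [Fintype β] [DecidableEq β]
    (ρ : Matrix (α × β) (α × β) ℂ) : ℝ :=
  entropy ρ - entropy (ptraceRight ρ)

/-- Conditional entropy `H(A|B) = H(AB) - H(B)` (first system conditioned on the second). -/
def condEntropyFst {α β : Type*} [Fintype α] [DecidableEq α] [Fintype β] [DecidableEq β]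
    (ρ : Matrix (α × β) (α × β) ℂ) : ℝ :=
  entropy ρ - entropy (ptraceLeft ρ)

/-- `n`-fold tensor power of a matrix. -/
def tpow {ι : Type*} (ρ : Matrix ι ι ℂ) (n : ℕ) : Matrix (Fin n → ι) (Fin n → ι) ℂ :=
  fun x y => ∏ k, ρ (x k) (y k)

/-- `n`-fold tensor power of a bipartite state, with the `A` and `B` factors collected. -/
def tpowAB {α β : Type*} (ρ : Matrix (α × β) (α × β) ℂ) (n : ℕ) :
    Matrix ((Fin n → α) × (Fin n → β)) ((Fin n → α) × (Fin n → β)) ℂ :=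
  Matrix.reindex (Equiv.arrowProdEquivProdArrow (Fin n) (fun _ => α) (fun _ => β))
    (Equiv.arrowProdEquivProdArrow (Fin n) (fun _ => α) (fun _ => β)) (tpow ρ n)

/-- A POVM on the system `ι` with outcome set `κ`. -/
structure POVM (ι κ : Type*) [Fintype ι] [DecidableEq ι] [Fintype κ] where
  elem : κ → Matrix ι ι ℂ
  pos : ∀ y, (elem y).PosSemidef
  sum_eq : ∑ y, elem y = 1

/-- Apply a POVM to the first factor of a bipartite state, recording the outcome in a
classical register: `ρ^{AΓ} ↦ Σ_y |y⟩⟨y| ⊗ Tr_A((Λ_y ⊗ 1)ρ)`. -/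
def measureLeft {ι κ γ : Type*} [Fintype ι] [DecidableEq ι] [Fintype κ] [DecidableEq κ]
    (Λ : POVM ι κ) (ρ : Matrix (ι × γ) (ι × γ) ℂ) : Matrix (κ × γ) (κ × γ) ℂ :=
  fun p q => if p.1 = q.1 then ∑ a, ∑ a', (Λ.elem p.1) a a' * ρ (a', p.2) (a, q.2) else 0

/-- The canonical purification of a density operator `ρ` on `ι`, a pure state on `ι × ι`
(junk value `0` for non-positive-semidefinite input). -/
def canonicalPurification {ι : Type*} [Fintype ι] [DecidableEq ι] (ρ : Matrix ι ι ℂ) :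
    Matrix (ι × ι) (ι × ι) ℂ :=
  letI := Classical.dec ρ.PosSemidef
  if h : ρ.PosSemidef then
    vecMulVec (fun p => h.sqrt p.1 p.2) (star fun p => h.sqrt p.1 p.2)
  else 0

/-- The purity `κ(ρ) = log d - H(ρ)`. -/
def kappa {ι : Type*} [Fintype ι] [DecidableEq ι] (ρ : Matrix ι ι ℂ) : ℝ :=
  Real.log (Fintype.card ι) - entropy ρ

/-- The pure state `|0⟩⟨0|` on a `d`-dimensional system. -/
def pureZero (d : ℕ) : Matrix (Fin d) (Fin d) ℂ :=
  fun i j => if i.val = 0 ∧ j.val = 0 then 1 else 0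

/-! ### Index bookkeeping equivalences -/

/-- `(a × b) × c ≃ (a × c) × b`. -/
def swapE (a b c : Type*) : (a × b) × c ≃ (a × c) × b where
  toFun x := ((x.1.1, x.2), x.1.2)
  invFun x := ((x.1.1, x.2), x.1.2)
  left_inv _ := rfl
  right_inv _ := rfl

/-- Pull the `Y` register to the front: `((a × y) × g) × b ≃ y × ((a × g) × b)`. -/
def pullY (a y g b : Type*) : ((a × y) × g) × b ≃ y × ((a × g) × b) where
  toFun x := (x.1.1.2, ((x.1.1.1, x.1.2), x.2))
  invFun x := (((x.2.1.1, x.1), x.2.1.2), x.2.2)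
  left_inv _ := rfl
  right_inv _ := rfl

/-- Rearrange for Bob's unitary: `((a × y) × g) × b ≃ (b × y) × (a × g)`. -/
def pullBY (a y g b : Type*) : ((a × y) × g) × b ≃ (b × y) × (a × g) where
  toFun x := ((x.2, x.1.1.2), (x.1.1.1, x.1.2))
  invFun x := (((x.2.1, x.1.2), x.2.2), x.1.1)
  left_inv _ := rfl
  right_inv _ := rfl

/-- Collect `Y` and `B` together: `((a × y) × g) × b ≃ (y × b) × (a × g)`. -/
def pullYB (a y g b : Type*) : ((a × y) × g) × b ≃ (y × b) × (a × g) where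
  toFun x := ((x.1.1.2, x.2), (x.1.1.1, x.1.2))
  invFun x := (((x.2.1, x.1.1), x.2.2), x.1.2)
  left_inv _ := rfl
  right_inv _ := rfl

/-- Sort output registers: `(bp × bg) × (ap × ag) ≃ (ap × bp) × (ag × bg)`. -/
def sortOut (bp bg ap ag : Type*) : (bp × bg) × (ap × ag) ≃ (ap × bp) × (ag × bg) where
  toFun x := ((x.2.1, x.1.1), (x.2.2, x.1.2))
  invFun x := ((x.1.2, x.2.2), (x.1.1, x.2.1))
  left_inv _ := rfl
  right_inv _ := rfl

/-- `y × (x × w) ≃ (y × w) × x`. -/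
def exYW (y x w : Type*) : y × (x × w) ≃ (y × w) × x where
  toFun a := ((a.1, a.2.2), a.2.1)
  invFun a := (a.1.1, (a.2, a.1.2))
  left_inv _ := rfl
  right_inv _ := rfl

/-- `y × (x × w) ≃ (y × x) × w`. -/
def exYX (y x w : Type*) : y × (x × w) ≃ (y × x) × w where
  toFun a := ((a.1, a.2.1), a.2.2)
  invFun a := (a.1.1, (a.1.2, a.2))
  left_inv _ := rfl
  right_inv _ := rfl

/-- `y × (x × (b × e)) ≃ (y × b) × (x × e)`. -/
def exYB (y x b e : Type*) : y × (x × (b × e)) ≃ (y × b) × (x × e) where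
  toFun a := ((a.1, a.2.2.1), (a.2.1, a.2.2.2))
  invFun a := (a.1.1, (a.2.1, (a.1.2, a.2.2)))
  left_inv _ := rfl
  right_inv _ := rfl

/-! ### The state `σ^{YBE}` obtained by measuring Alice's share of a purification -/

/-- The canonical purification of a bipartite state `ρ^{AB}`, with indices arranged as
`A × (B × E)` where `E = A × B`. -/
def purifyAssoc {α β : Type*} [Fintype α] [DecidableEq α] [Fintype β] [DecidableEq β]
    (ρ : Matrix (α × β) (α × β) ℂ) :
    Matrix (α × (β × (α × β))) (α × (β × (α × β))) ℂ :=
  Matrix.reindex (Equiv.prodAssoc α β (α × β)) (Equiv.prodAssoc α β (α × β))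
    (canonicalPurification ρ)

/-- `σ^{YBE} = (Λ ⊗ 1^{BE})(Ψ^{ABE})` for the canonical purification `Ψ` of `ρ^{AB}`. -/
def sigmaOf {α β κ : Type*} [Fintype α] [DecidableEq α] [Fintype β] [DecidableEq β]
    [Fintype κ] [DecidableEq κ] (ρ : Matrix (α × β) (α × β) ℂ) (Λ : POVM α κ) :
    Matrix (κ × (β × (α × β))) (κ × (β × (α × β))) ℂ :=
  measureLeft Λ (purifyAssoc ρ)

/-- `I(Y;B)` evaluated on a state of the form `σ^{Y(BE)}`: trace out `E`, then take the
mutual information. -/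
def IYB {κ β ε : Type*} [Fintype κ] [DecidableEq κ] [Fintype β] [DecidableEq β] [Fintype ε]
    (σ : Matrix (κ × (β × ε)) (κ × (β × ε)) ℂ) : ℝ :=
  mutualInfo (ptraceRight (Matrix.reindex (Equiv.prodAssoc κ β ε).symm
    (Equiv.prodAssoc κ β ε).symm σ))

/-- `I(Y;BE)` evaluated on a state of the form `σ^{Y(BE)}`. -/
def IYBE {κ β ε : Type*} [Fintype κ] [DecidableEq κ] [Fintype β] [DecidableEq β] [Fintype ε]
    [DecidableEq ε] (σ : Matrix (κ × (β × ε)) (κ × (β × ε)) ℂ) : ℝ :=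
  mutualInfo σ

/-- `P^{(1)}_→(ρ^{AB}, R) = max_Λ { I(Y;B)_σ : I(Y;BE)_σ ≤ R }`, the maximum over all
POVMs on Alice's system. -/
def P1 {α β : Type*} [Fintype α] [DecidableEq α] [Fintype β] [DecidableEq β]
    (ρ : Matrix (α × β) (α × β) ℂ) (R : ℝ) : ℝ :=
  sSup { v : ℝ | ∃ (m : ℕ) (Λ : POVM α (Fin m)),
    IYBE (sigmaOf ρ Λ) ≤ R ∧ v = IYB (sigmaOf ρ Λ) }

/-! ### Local purity distillation protocols -/

/-- An `(n, ·, ·, ·)` local purity distillation protocol: Alice's unitary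
`U_A : H_{A^n} ⊗ H_C → H_{A_p} ⊗ H_Y ⊗ H_{A_g}`, a dephasing channel on `Y`
(applied below), and Bob's unitary `U_B : H_{B^n} ⊗ H_Y → H_{B_p} ⊗ H_{B_g}`. -/
structure Protocol (α β : Type*) [Fintype α] [DecidableEq α] [Fintype β] [DecidableEq β]
    (n : ℕ) where
  dC : ℕ
  dAp : ℕ
  dY : ℕ
  dAg : ℕ
  dBp : ℕ
  dBg : ℕ
  dC_pos : 0 < dC
  dAp_pos : 0 < dAp
  dY_pos : 0 < dY
  dAg_pos : 0 < dAg
  dBp_pos : 0 < dBp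
  dBg_pos : 0 < dBg
  UA : Matrix ((Fin dAp × Fin dY) × Fin dAg) ((Fin n → α) × Fin dC) ℂ
  UA_unitary : UAᴴ * UA = 1 ∧ UA * UAᴴ = 1
  UB : Matrix (Fin dBp × Fin dBg) ((Fin n → β) × Fin dY) ℂ
  UB_unitary : UBᴴ * UB = 1 ∧ UB * UBᴴ = 1

variable {α β : Type*} [Fintype α] [DecidableEq α] [Fintype β] [DecidableEq β]

/-- The input state `(ρ^{AB})^{⊗n} ⊗ |0⟩⟨0|^C`, arranged as `(A^n × C) × B^n`. -/
def inputState (ρ : Matrix (α × β) (α × β) ℂ) {n : ℕ} (Pr : Protocol α β n) :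
    Matrix (((Fin n → α) × Fin Pr.dC) × (Fin n → β))
      (((Fin n → α) × Fin Pr.dC) × (Fin n → β)) ℂ :=
  Matrix.reindex (swapE (Fin n → α) (Fin n → β) (Fin Pr.dC))
    (swapE (Fin n → α) (Fin n → β) (Fin Pr.dC)) (tpowAB ρ n ⊗ₖ pureZero Pr.dC)

/-- The state `U_A((ρ^{AB})^{⊗n} ⊗ |0⟩⟨0|^C)` (before dephasing), on
`((A_p × Y) × A_g) × B^n`. -/
def stateAfterUA (ρ : Matrix (α × β) (α × β) ℂ) {n : ℕ} (Pr : Protocol α β n) :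
    Matrix (((Fin Pr.dAp × Fin Pr.dY) × Fin Pr.dAg) × (Fin n → β))
      (((Fin Pr.dAp × Fin Pr.dY) × Fin Pr.dAg) × (Fin n → β)) ℂ :=
  (Pr.UA ⊗ₖ (1 : Matrix (Fin n → β) (Fin n → β) ℂ)) * inputState ρ Pr *
    (Pr.UA ⊗ₖ (1 : Matrix (Fin n → β) (Fin n → β) ℂ))ᴴ

/-- Dephase the first tensor factor in a fixed basis. -/
def dephaseFst {κ γ : Type*} [DecidableEq κ] (ρ : Matrix (κ × γ) (κ × γ) ℂ) :
    Matrix (κ × γ) (κ × γ) ℂ :=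
  fun p q => if p.1 = q.1 then ρ p q else 0

/-- The state after Alice's unitary and the dephasing channel on `Y`. -/
def stateAfterDephasing (ρ : Matrix (α × β) (α × β) ℂ) {n : ℕ} (Pr : Protocol α β n) :
    Matrix (((Fin Pr.dAp × Fin Pr.dY) × Fin Pr.dAg) × (Fin n → β))
      (((Fin Pr.dAp × Fin Pr.dY) × Fin Pr.dAg) × (Fin n → β)) ℂ :=
  Matrix.reindex (pullY (Fin Pr.dAp) (Fin Pr.dY) (Fin Pr.dAg) (Fin n → β)).symm
    (pullY (Fin Pr.dAp) (Fin Pr.dY) (Fin Pr.dAg) (Fin n → β)).symm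
    (dephaseFst (Matrix.reindex (pullY (Fin Pr.dAp) (Fin Pr.dY) (Fin Pr.dAg) (Fin n → β))
      (pullY (Fin Pr.dAp) (Fin Pr.dY) (Fin Pr.dAg) (Fin n → β)) (stateAfterUA ρ Pr)))

/-- The final state `Υ`, after Bob's unitary, on `(B_p × B_g) × (A_p × A_g)`. -/
def stateAfterUB (ρ : Matrix (α × β) (α × β) ℂ) {n : ℕ} (Pr : Protocol α β n) :
    Matrix ((Fin Pr.dBp × Fin Pr.dBg) × (Fin Pr.dAp × Fin Pr.dAg))
      ((Fin Pr.dBp × Fin Pr.dBg) × (Fin Pr.dAp × Fin Pr.dAg)) ℂ :=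
  (Pr.UB ⊗ₖ (1 : Matrix (Fin Pr.dAp × Fin Pr.dAg) (Fin Pr.dAp × Fin Pr.dAg) ℂ)) *
    Matrix.reindex (pullBY (Fin Pr.dAp) (Fin Pr.dY) (Fin Pr.dAg) (Fin n → β))
      (pullBY (Fin Pr.dAp) (Fin Pr.dY) (Fin Pr.dAg) (Fin n → β)) (stateAfterDephasing ρ Pr) *
    (Pr.UB ⊗ₖ (1 : Matrix (Fin Pr.dAp × Fin Pr.dAg) (Fin Pr.dAp × Fin Pr.dAg) ℂ))ᴴ

/-- The reduced output state `Υ^{A_p B_p}`. -/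
def outputReduced (ρ : Matrix (α × β) (α × β) ℂ) {n : ℕ} (Pr : Protocol α β n) :
    Matrix (Fin Pr.dAp × Fin Pr.dBp) (Fin Pr.dAp × Fin Pr.dBp) ℂ :=
  ptraceRight (Matrix.reindex
    (sortOut (Fin Pr.dBp) (Fin Pr.dBg) (Fin Pr.dAp) (Fin Pr.dAg))
    (sortOut (Fin Pr.dBp) (Fin Pr.dBg) (Fin Pr.dAp) (Fin Pr.dAg)) (stateAfterUB ρ Pr))

/-- The error of a protocol: trace distance of `Υ^{A_p B_p}` from `|0⟩⟨0| ⊗ |0⟩⟨0|`. -/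
def protocolError (ρ : Matrix (α × β) (α × β) ℂ) {n : ℕ} (Pr : Protocol α β n) : ℝ :=
  traceNorm (outputReduced ρ Pr - pureZero Pr.dAp ⊗ₖ pureZero Pr.dBp)

/-- The classical communication rate `(1/n) log d_Y` of a protocol. -/
def commRate {n : ℕ} (Pr : Protocol α β n) : ℝ := Real.log Pr.dY / n

/-- The purity rate `(1/n)(log d_{A_p}d_{B_p} - log d_C)` of a protocol. -/
def purityRate {n : ℕ} (Pr : Protocol α β n) : ℝ :=
  (Real.log (Pr.dAp * Pr.dBp) - Real.log Pr.dC) / n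

/-- Achievability of a rate pair `(P, R)`: for all `ε, δ > 0` and all sufficiently large `n`
there is an `(n, R+δ, P-δ, ε)` protocol. -/
def Achievable (ρ : Matrix (α × β) (α × β) ℂ) (P R : ℝ) : Prop :=
  ∀ ε > (0 : ℝ), ∀ δ > (0 : ℝ), ∃ N : ℕ, ∀ n ≥ N, ∃ Pr : Protocol α β n,
    commRate Pr ≤ R + δ ∧ P - δ ≤ purityRate Pr ∧ protocolError ρ Pr ≤ ε

/-- The 1-way distillable local purity `κ_→(ρ^{AB}, R)`. -/
def kappaArrow (ρ : Matrix (α × β) (α × β) ℂ) (R : ℝ) : ℝ :=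
  sSup { P : ℝ | Achievable ρ P R }

/-- `I(Y;B^n)` on the pre-dephasing state `U_A((ρ^{AB})^{⊗n} ⊗ |0⟩⟨0|^C)`. -/
def preDephIYB (ρ : Matrix (α × β) (α × β) ℂ) {n : ℕ} (Pr : Protocol α β n) : ℝ :=
  mutualInfo (ptraceRight (Matrix.reindex
    (pullYB (Fin Pr.dAp) (Fin Pr.dY) (Fin Pr.dAg) (Fin n → β))
    (pullYB (Fin Pr.dAp) (Fin Pr.dY) (Fin Pr.dAg) (Fin n → β)) (stateAfterUA ρ Pr)))

/-- The pre-dephasing state together with the purifying environment `E^n`: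
`(U_A ⊗ 1^{B^nE^n})((Ψ^{ABE})^{⊗n} ⊗ |0⟩⟨0|^C)`, where `Ψ` is the canonical purification. -/
def preDephWithEnv (ρ : Matrix (α × β) (α × β) ℂ) {n : ℕ} (Pr : Protocol α β n) :
    Matrix (((Fin Pr.dAp × Fin Pr.dY) × Fin Pr.dAg) × (Fin n → β × (α × β)))
      (((Fin Pr.dAp × Fin Pr.dY) × Fin Pr.dAg) × (Fin n → β × (α × β))) ℂ :=
  (Pr.UA ⊗ₖ (1 : Matrix (Fin n → β × (α × β)) (Fin n → β × (α × β)) ℂ)) *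
    Matrix.reindex (swapE (Fin n → α) (Fin n → β × (α × β)) (Fin Pr.dC))
      (swapE (Fin n → α) (Fin n → β × (α × β)) (Fin Pr.dC))
      (tpowAB (purifyAssoc ρ) n ⊗ₖ pureZero Pr.dC) *
    (Pr.UA ⊗ₖ (1 : Matrix (Fin n → β × (α × β)) (Fin n → β × (α × β)) ℂ))ᴴ

/-- `I(Y;B^nE^n)` on the pre-dephasing state, including the purifying environment. -/
def preDephIYBE (ρ : Matrix (α × β) (α × β) ℂ) {n : ℕ} (Pr : Protocol α β n) : ℝ :=
  mutualInfo (ptraceRight (Matrix.reindex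
    (pullYB (Fin Pr.dAp) (Fin Pr.dY) (Fin Pr.dAg) (Fin n → β × (α × β)))
    (pullYB (Fin Pr.dAp) (Fin Pr.dY) (Fin Pr.dAg) (Fin n → β × (α × β)))
    (preDephWithEnv ρ Pr)))

/-- `H(Y)` on the pre-dephasing state. -/
def preDephHY (ρ : Matrix (α × β) (α × β) ℂ) {n : ℕ} (Pr : Protocol α β n) : ℝ :=
  entropy (ptraceRight (Matrix.reindex
    (pullY (Fin Pr.dAp) (Fin Pr.dY) (Fin Pr.dAg) (Fin n → β))
    (pullY (Fin Pr.dAp) (Fin Pr.dY) (Fin Pr.dAg) (Fin n → β)) (stateAfterUA ρ Pr)))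

/-! ### Single-party purity concentration -/

/-- An `(n, ·, ·)` purity concentration protocol: a unitary
`U : H_{A^n} → H_{A_p} ⊗ H_{A_g}`. -/
structure ConcProtocol (α : Type*) [Fintype α] [DecidableEq α] (n : ℕ) where
  dAp : ℕ
  dAg : ℕ
  dAp_pos : 0 < dAp
  dAg_pos : 0 < dAg
  U : Matrix (Fin dAp × Fin dAg) (Fin n → α) ℂ
  U_unitary : Uᴴ * U = 1 ∧ U * Uᴴ = 1

/-- The reduced state `Υ^{A_p}` of `U ρ^{⊗n} U†`. -/
def concOutput {α : Type*} [Fintype α] [DecidableEq α] (ρ : Matrix α α ℂ) {n : ℕ}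
    (Pr : ConcProtocol α n) : Matrix (Fin Pr.dAp) (Fin Pr.dAp) ℂ :=
  ptraceRight (Pr.U * tpow ρ n * Pr.Uᴴ)

/-- Achievability of a purity-concentration rate `P`. -/
def ConcAchievable {α : Type*} [Fintype α] [DecidableEq α] (ρ : Matrix α α ℂ) (P : ℝ) :
    Prop :=
  ∀ ε > (0 : ℝ), ∀ δ > (0 : ℝ), ∃ N : ℕ, ∀ n ≥ N, ∃ Pr : ConcProtocol α n,
    P - δ ≤ Real.log Pr.dAp / n ∧ traceNorm (concOutput ρ Pr - pureZero Pr.dAp) ≤ ε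

/-- The purity `κ(ρ)`: the supremum of all achievable concentration rates. -/
def kappaConc {α : Type*} [Fintype α] [DecidableEq α] (ρ : Matrix α α ℂ) : ℝ :=
  sSup { P : ℝ | ConcAchievable ρ P }

/-! ### Measurement compression -/

/-- The averaged compressed-measurement map
`σ ↦ (1/|L|) Σ_l Σ_m Tr(Λ̃^{(l)}_m σ) |f(m,l)⟩⟨f(m,l)|`, applied to the first factor. -/
def mcMap {A Ω γ' : Type*} [Fintype A] [DecidableEq A] [Fintype Ω] [DecidableEq Ω]
    (L M : ℕ) (Λt : Fin L → POVM A (Fin M)) (f : Fin M → Fin L → Ω)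
    (ρ : Matrix (A × γ') (A × γ') ℂ) : Matrix (Ω × γ') (Ω × γ') ℂ :=
  fun p q => (L : ℂ)⁻¹ * ∑ l, ∑ m, (if f m l = p.1 ∧ f m l = q.1 then 1 else 0) *
    ∑ a, ∑ a', ((Λt l).elem m) a a' * ρ (a', p.2) (a, q.2)

/-! ### Classical-quantum states and classical channels -/

/-- The classical-quantum state `Σ_x p(x) |x⟩⟨x| ⊗ ρ_x`. -/
def cqState {𝒳 B : Type*} [DecidableEq 𝒳] (p : 𝒳 → ℝ) (ρx : 𝒳 → Matrix B B ℂ) :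
    Matrix (𝒳 × B) (𝒳 × B) ℂ :=
  fun P Q => if P.1 = Q.1 then (p P.1 : ℂ) * ρx P.1 P.2 Q.2 else 0

/-- The state on `Y × (X × W)` obtained from a purification vector `ψ` of a cq state
(with classical system `X` and the rest `W`) by applying a classical channel `q(y|x)`
to the classical system: `Σ_{x,y} q(y|x) |y⟩⟨y| ⊗ |x⟩⟨x|-block of p(x)·(BE state given x)`. -/
def chanState {𝒳 W 𝒴 : Type*} [DecidableEq 𝒳] [DecidableEq 𝒴]
    (ψ : 𝒳 × W → ℂ) (q : 𝒳 → 𝒴 → ℝ) :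
    Matrix (𝒴 × (𝒳 × W)) (𝒴 × (𝒳 × W)) ℂ :=
  fun P Q => if P.1 = Q.1 ∧ P.2.1 = Q.2.1
    then (q P.2.1 P.1 : ℂ) * ψ P.2 * star (ψ Q.2) else 0

/-- The `n`-fold tensor power of a purification vector of a cq state, with the
classical, `B` and `E` registers collected. -/
def vecPowBE {𝒳 B E : Type*} (ψ : 𝒳 × (B × E) → ℂ) (n : ℕ) :
    (Fin n → 𝒳) × ((Fin n → B) × (Fin n → E)) → ℂ :=
  fun xw => ∏ k, ψ (xw.1 k, (xw.2.1 k, xw.2.2 k))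

variable {𝒴' 𝒳 B E : Type*} [Fintype 𝒴'] [DecidableEq 𝒴'] [Fintype 𝒳] [DecidableEq 𝒳]
  [Fintype B] [DecidableEq B] [Fintype E] [DecidableEq E]

/-- `I(Y;B)` on a state of the form `τ^{Y(X(BE))}`. -/
def miYB (τ : Matrix (𝒴' × (𝒳 × (B × E))) (𝒴' × (𝒳 × (B × E))) ℂ) : ℝ :=
  mutualInfo (ptraceRight (Matrix.reindex (exYB 𝒴' 𝒳 B E) (exYB 𝒴' 𝒳 B E) τ))

/-- `I(Y;BE)` on a state of the form `τ^{Y(X(BE))}`. -/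
def miYBE (τ : Matrix (𝒴' × (𝒳 × (B × E))) (𝒴' × (𝒳 × (B × E))) ℂ) : ℝ :=
  mutualInfo (ptraceRight (Matrix.reindex (exYW 𝒴' 𝒳 (B × E)) (exYW 𝒴' 𝒳 (B × E)) τ))

/-- `I(Y;X)` on a state of the form `τ^{Y(X(BE))}`. -/
def miYX (τ : Matrix (𝒴' × (𝒳 × (B × E))) (𝒴' × (𝒳 × (B × E))) ℂ) : ℝ :=
  mutualInfo (ptraceRight (Matrix.reindex (exYX 𝒴' 𝒳 (B × E)) (exYX 𝒴' 𝒳 (B × E)) τ))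

/-- A classical channel: entrywise nonnegative with rows summing to one. -/
def IsChannel {X Y : Type*} [Fintype Y] (q : X → Y → ℝ) : Prop :=
  (∀ x y, 0 ≤ q x y) ∧ ∀ x, ∑ y, q x y = 1

/-- `P_n(R) = max_{Y|X^n} { (1/n) I(Y;B^n) : (1/n) I(Y;B^nE^n) ≤ R }` for a cq state
with purification vector `ψ`. -/
def Pn (ψ : 𝒳 × (B × E) → ℂ) (n : ℕ) (R : ℝ) : ℝ :=
  sSup { v : ℝ | ∃ (m : ℕ) (q : (Fin n → 𝒳) → Fin m → ℝ), IsChannel q ∧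
    (1 / n : ℝ) * miYBE (chanState (vecPowBE ψ n) q) ≤ R ∧
    v = (1 / n : ℝ) * miYB (chanState (vecPowBE ψ n) q) }

/-- `D_n(R) = max_{Y|X^n} { (1/n) I(Y;B^n) : (1/n)(I(Y;X^n) - I(Y;B^n)) ≤ R }` for a cq
state with purification vector `ψ`. -/
def Dn (ψ : 𝒳 × (B × E) → ℂ) (n : ℕ) (R : ℝ) : ℝ :=
  sSup { v : ℝ | ∃ (m : ℕ) (q : (Fin n → 𝒳) → Fin m → ℝ), IsChannel q ∧
    (1 / n : ℝ) * (miYX (chanState (vecPowBE ψ n) q)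
      - miYB (chanState (vecPowBE ψ n) q)) ≤ R ∧
    v = (1 / n : ℝ) * miYB (chanState (vecPowBE ψ n) q) }

/-! ### Quantum channels -/

/-- A completely positive trace-preserving map between matrix algebras. -/
structure CPTP (ι κ : Type*) [Fintype ι] [DecidableEq ι] [Fintype κ] [DecidableEq κ] where
  map : Matrix ι ι ℂ →ₗ[ℂ] Matrix κ κ ℂ
  trace_preserving : ∀ ρ, (map ρ).trace = ρ.trace
  completely_positive : ∀ (n : ℕ) (ρ : Matrix (ι × Fin n) (ι × Fin n) ℂ), ρ.PosSemidef →
    (Matrix.of fun p q : κ × Fin n =>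
      map (Matrix.of fun i i' => ρ (i, p.2) (i', q.2)) p.1 q.1).PosSemidef

section
open Matrix Kronecker BigOperators Filter Finset
open scoped ComplexOrder

/-- Unitary diagonalization data. -/
def Dg {ι : Type*} [Fintype ι] [DecidableEq ι] (M U : Matrix ι ι ℂ) (d : ι → ℝ) : Prop :=
  Uᴴ * U = 1 ∧ U * Uᴴ = 1 ∧ M = U * diagonal (fun i => (d i : ℂ)) * Uᴴ

lemma dg_exists {ι : Type*} [Fintype ι] [DecidableEq ι] {M : Matrix ι ι ℂ} (h : M.IsHermitian) :
    ∃ U, Dg M U h.eigenvalues := by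
  refine ⟨h.eigenvectorUnitary.1, ?_, ?_, ?_⟩
  · have := h.eigenvectorUnitary.2
    exact (Matrix.mem_unitaryGroup_iff'.1 this)
  · have := h.eigenvectorUnitary.2
    exact (Matrix.mem_unitaryGroup_iff.1 this)
  · conv_lhs => rw [h.spectral_theorem]
    rfl

lemma Dg.herm {ι : Type*} [Fintype ι] [DecidableEq ι] {M U : Matrix ι ι ℂ} {d : ι → ℝ}
    (h : Dg M U d) : M.IsHermitian := by
  obtain ⟨_, _, h3⟩ := h
  rw [h3, Matrix.IsHermitian, conjTranspose_mul, conjTranspose_mul, conjTranspose_conjTranspose,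
    diagonal_conjTranspose, Matrix.mul_assoc]
  congr 3
  ext i; simp

lemma Dg.sum_eigs {ι : Type*} [Fintype ι] [DecidableEq ι] {M U : Matrix ι ι ℂ} {d : ι → ℝ}
    (h : Dg M U d) (hM : M.IsHermitian) (f : ℝ → ℝ) :
    ∑ i, f (hM.eigenvalues i) = ∑ i, f (d i) := by
  have h1 := hM.roots_charpoly_eq_eigenvalues
  have h2 : M.charpoly.roots = Multiset.map (fun i => (d i : ℂ)) Finset.univ.val := by
    obtain ⟨h1, _, h3⟩ := h
    rw [h3, Matrix.charpoly_mul_comm, ← Matrix.mul_assoc, h1, Matrix.one_mul,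
      Matrix.charpoly_diagonal, Polynomial.roots_prod]
    · simp
    · exact Finset.prod_ne_zero_iff.2 fun i _ => Polynomial.X_sub_C_ne_zero _
  rw [h2] at h1
  have h3 := congrArg (fun s => (Multiset.map (fun z : ℂ => f z.re) s).sum) h1
  simp only [Multiset.map_map, Function.comp_def] at h3
  simpa using h3.symm

lemma Dg.entropy {ι : Type*} [Fintype ι] [DecidableEq ι] {M U : Matrix ι ι ℂ} {d : ι → ℝ}
    (h : Dg M U d) : entropy M = ∑ i, Real.negMulLog (d i) := by
  rw [LPD.entropy, dif_pos h.herm, ← h.sum_eigs h.herm, ← Finset.sum_neg_distrib]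
  exact Finset.sum_congr rfl fun i _ => by simp [Real.negMulLog]

lemma Dg.traceNorm {ι : Type*} [Fintype ι] [DecidableEq ι] {M U : Matrix ι ι ℂ} {d : ι → ℝ}
    (h : Dg M U d) : traceNorm M = ∑ i, |d i| := by
  have h2 : Dg (Mᴴ * M) U (fun i => d i ^ 2) := by
    refine ⟨h.1, h.2.1, ?_⟩
    rw [h.herm.eq]
    obtain ⟨h1, _, h3⟩ := h
    rw [h3]
    calc U * diagonal (fun i => (d i : ℂ)) * Uᴴ * (U * diagonal (fun i => (d i : ℂ)) * Uᴴ)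
        = U * diagonal (fun i => (d i : ℂ)) * (Uᴴ * U) * diagonal (fun i => (d i : ℂ)) * Uᴴ := by
          simp only [Matrix.mul_assoc]
      _ = _ := by
          rw [h1, Matrix.mul_one, Matrix.mul_assoc U, diagonal_mul_diagonal]
          congr 3; ext i; push_cast; ring
  have h3 := h2.sum_eigs (posSemidef_conjTranspose_mul_self M).1 Real.sqrt
  simp only [Real.sqrt_sq_eq_abs] at h3
  rw [← h3, LPD.traceNorm, Matrix.PosSemidef.sqrt, Matrix.trace_mul_comm, ← Matrix.mul_assoc]
  have := (Matrix.mem_unitaryGroup_iff'.1 (posSemidef_conjTranspose_mul_self M).1.eigenvectorUnitary.2)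
  rw [this, Matrix.one_mul, Matrix.trace_diagonal]
  simp

lemma Dg.diag_eq {ι : Type*} [Fintype ι] [DecidableEq ι] {M U : Matrix ι ι ℂ} {d : ι → ℝ}
    (h : Dg M U d) : Uᴴ * M * U = diagonal (fun i => (d i : ℂ)) := by
  obtain ⟨h1, _, h3⟩ := h
  rw [h3]
  calc Uᴴ * (U * diagonal (fun i => (d i : ℂ)) * Uᴴ) * U
      = (Uᴴ * U) * diagonal (fun i => (d i : ℂ)) * (Uᴴ * U) := by simp only [Matrix.mul_assoc]
    _ = _ := by rw [h1]; simp

lemma Dg.of_diag {ι : Type*} [Fintype ι] [DecidableEq ι] {M U : Matrix ι ι ℂ} {d : ι → ℝ}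
    (h1 : Uᴴ * U = 1) (h2 : U * Uᴴ = 1)
    (h : Uᴴ * M * U = diagonal (fun i => (d i : ℂ))) : Dg M U d := by
  refine ⟨h1, h2, ?_⟩
  rw [← h]
  calc M = (U * Uᴴ) * M * (U * Uᴴ) := by rw [h2]; simp
    _ = _ := by simp only [Matrix.mul_assoc]

lemma Dg.trace_eq {ι : Type*} [Fintype ι] [DecidableEq ι] {M U : Matrix ι ι ℂ} {d : ι → ℝ}
    (h : Dg M U d) : M.trace = ((∑ i, d i : ℝ) : ℂ) := by
  obtain ⟨h1, _, h3⟩ := h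
  rw [h3, Matrix.trace_mul_comm, ← Matrix.mul_assoc, h1, Matrix.one_mul, Matrix.trace_diagonal]
  simp

lemma Dg.nonneg {ι : Type*} [Fintype ι] [DecidableEq ι] {M U : Matrix ι ι ℂ} {d : ι → ℝ}
    (h : Dg M U d) (hM : M.PosSemidef) (i : ι) : 0 ≤ d i := by
  have h1 := hM.conjTranspose_mul_mul_same U
  rw [h.diag_eq] at h1
  have := h1.diag_nonneg (i := i)
  simpa using this

lemma psd_dg {ι : Type*} [Fintype ι] [DecidableEq ι] {M : Matrix ι ι ℂ} (h : M.PosSemidef) :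
    ∃ U d, Dg M U d ∧ ∀ i, 0 ≤ d i := by
  obtain ⟨U, hU⟩ := dg_exists h.1
  exact ⟨U, _, hU, hU.nonneg h⟩

lemma Dg.apply {ι : Type*} [Fintype ι] [DecidableEq ι] {M U : Matrix ι ι ℂ} {d : ι → ℝ}
    (h : Dg M U d) (i j : ι) : M i j = ∑ k, U i k * (d k : ℂ) * star (U j k) := by
  rw [h.2.2, Matrix.mul_apply]
  simp [Matrix.mul_diagonal]

/-- real trace -/
def rtr {ι : Type*} [Fintype ι] (M : Matrix ι ι ℂ) : ℝ := M.trace.re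

/-- unnormalised conditional entropy contribution -/
def gent {ι : Type*} [Fintype ι] [DecidableEq ι] (M : Matrix ι ι ℂ) : ℝ :=
  entropy M - Real.negMulLog (rtr M)

lemma Dg.rtr_eq {ι : Type*} [Fintype ι] [DecidableEq ι] {M U : Matrix ι ι ℂ} {d : ι → ℝ}
    (h : Dg M U d) : rtr M = ∑ i, d i := by
  rw [rtr, h.trace_eq]; simp

/-- reduced operator after measuring effect `E` on the first factor -/
def red {A B : Type*} [Fintype A] (E : Matrix A A ℂ) (ρ : Matrix (A × B) (A × B) ℂ) :
    Matrix B B ℂ := fun b b' => ∑ a, ∑ a', E a a' * ρ (a', b) (a, b')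

/-- rank-one projector -/
def rk {A : Type*} (w : A → ℂ) : Matrix A A ℂ := vecMulVec w (star w)

lemma red_rk_psd {A B : Type*} [Fintype A] [Fintype B] [DecidableEq B]
    {ρ : Matrix (A × B) (A × B) ℂ} (hρ : ρ.PosSemidef) (w : A → ℂ) : (red (rk w) ρ).PosSemidef := by
  have := hρ.conjTranspose_mul_mul_same
    (Matrix.of fun (p : A × B) (b : B) => if p.2 = b then w p.1 else 0)
  convert this using 1
  ext b b'
  simp only [red, rk, vecMulVec_apply, Matrix.mul_apply, Fintype.sum_prod_type, conjTranspose_apply,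
    Matrix.of_apply, Pi.star_apply, apply_ite star, star_zero, ite_mul, zero_mul, mul_ite, mul_zero,
    Finset.sum_ite_eq', Finset.mem_univ, if_true]
  refine Finset.sum_congr rfl fun a _ => ?_
  simp only [Finset.sum_mul]
  refine Finset.sum_congr rfl fun a' _ => ?_
  ring

lemma red_sum {A B X : Type*} [Fintype A] [Fintype X] (E : X → Matrix A A ℂ)
    (ρ : Matrix (A × B) (A × B) ℂ) : ∑ x, red (E x) ρ = red (∑ x, E x) ρ := by
  ext b b'
  simp only [red, Matrix.sum_apply, Finset.sum_mul]
  rw [Finset.sum_comm]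
  refine Finset.sum_congr rfl fun a _ => ?_
  rw [Finset.sum_comm]

lemma red_one {A B : Type*} [Fintype A] [DecidableEq A] (ρ : Matrix (A × B) (A × B) ℂ) :
    red 1 ρ = ptraceLeft ρ := by
  ext b b'
  simp [red, ptraceLeft, Matrix.one_apply]

lemma trace_red {A B : Type*} [Fintype A] [Fintype B] (E : Matrix A A ℂ)
    (ρ : Matrix (A × B) (A × B) ℂ) : (red E ρ).trace = (E * ptraceRight ρ).trace := by
  simp only [Matrix.trace, Matrix.diag_apply, red, Matrix.mul_apply, ptraceRight, Finset.mul_sum]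
  rw [Finset.sum_comm]
  refine Finset.sum_congr rfl fun a _ => ?_
  rw [Finset.sum_comm]

/-- block diagonal entropy -/
lemma dg_block {X B : Type*} [Fintype X] [DecidableEq X] [Fintype B] [DecidableEq B]
    (M U : X → Matrix B B ℂ) (d : X → B → ℝ) (h : ∀ x, Dg (M x) (U x) (d x)) :
    Dg (Matrix.of fun p q : X × B => if p.1 = q.1 then M p.1 p.2 q.2 else 0)
      (Matrix.of fun p q : X × B => if p.1 = q.1 then U p.1 p.2 q.2 else 0)
      (fun p => d p.1 p.2) := by
  refine ⟨?_, ?_, ?_⟩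
  · ext ⟨x, b⟩ ⟨x', b'⟩
    have := congrFun (congrFun (h x).1 b) b'
    simp only [Matrix.mul_apply, conjTranspose_apply] at this
    simp only [Matrix.mul_apply, conjTranspose_apply, Matrix.of_apply, Fintype.sum_prod_type,
      apply_ite star, star_zero, ite_mul, mul_ite, zero_mul, mul_zero, Matrix.one_apply, Prod.mk.injEq]
    rw [Finset.sum_eq_single x]
    · by_cases hx : x = x'
      · subst hx; simpa [Matrix.one_apply] using this
      · simp [hx]
    · intro y _ hy; simp [hy]
    · simp
  · ext ⟨x, b⟩ ⟨x', b'⟩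
    have := congrFun (congrFun (h x).2.1 b) b'
    simp only [Matrix.mul_apply, conjTranspose_apply] at this
    simp only [Matrix.mul_apply, conjTranspose_apply, Matrix.of_apply, Fintype.sum_prod_type,
      apply_ite star, star_zero, ite_mul, mul_ite, zero_mul, mul_zero, Matrix.one_apply, Prod.mk.injEq]
    rw [Finset.sum_eq_single x]
    · by_cases hx : x = x'
      · subst hx; simpa [Matrix.one_apply] using this
      · simp [hx, Ne.symm hx]
    · intro y _ hy; simp [Ne.symm hy]
    · simp
  · ext ⟨x, b⟩ ⟨x', b'⟩
    rw [Matrix.mul_apply]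
    simp only [conjTranspose_apply, Matrix.of_apply, Matrix.mul_diagonal,
      Fintype.sum_prod_type, apply_ite star, star_zero, ite_mul, mul_ite, zero_mul, mul_zero]
    rw [Finset.sum_eq_single x]
    · by_cases hx : x = x'
      · subst hx; simp [(h x).apply]
      · simp [hx, Ne.symm hx]
    · intro y _ hy; simp [Ne.symm hy]
    · simp

lemma mutualInfo_measure {A B X : Type*} [Fintype A] [DecidableEq A] [Fintype B] [DecidableEq B]
    [Fintype X] [DecidableEq X] {ρ : Matrix (A × B) (A × B) ℂ} (hρ : ρ.PosSemidef)
    (Λ : POVM A X) (w : X → A → ℂ) (hw : ∀ x, Λ.elem x = vecMulVec (w x) (star (w x))) :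
    mutualInfo (measureLeft Λ ρ) = entropy (ptraceLeft ρ) - ∑ x, gent (red (rk (w x)) ρ) := by
  have hp := fun x => red_rk_psd hρ (w x)
  choose U d hd using fun x => psd_dg (hp x)
  have e1 : measureLeft Λ ρ = (Matrix.of fun p q : X × B => if p.1 = q.1 then
      (red (rk (w p.1)) ρ) p.2 q.2 else 0) := by
    ext p q
    simp [measureLeft, red, hw, rk]
  have e2 : ptraceRight (measureLeft Λ ρ) = diagonal (fun x => ((rtr (red (rk (w x)) ρ) : ℝ) : ℂ)) := by
    rw [e1]
    ext x x'
    simp only [ptraceRight, Matrix.of_apply, diagonal_apply]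
    split_ifs with h
    · rw [(hd x).1.rtr_eq, ← (hd x).1.trace_eq]; rfl
    · simp
  have e3 : ptraceLeft (measureLeft Λ ρ) = ptraceLeft ρ := by
    rw [← red_one ρ, ← Λ.sum_eq, ← red_sum, e1]
    ext b b'
    simp [ptraceLeft, Matrix.sum_apply, hw, rk]
  have e4 : entropy (ptraceRight (measureLeft Λ ρ)) = ∑ x, Real.negMulLog (rtr (red (rk (w x)) ρ)) := by
    rw [e2]
    exact Dg.entropy (U := 1) ⟨by simp, by simp, by simp⟩
  have e5 : entropy (measureLeft Λ ρ) = ∑ x, entropy (red (rk (w x)) ρ) := by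
    rw [e1, (dg_block _ U d (fun x => (hd x).1)).entropy, Fintype.sum_prod_type]
    exact Finset.sum_congr rfl fun x _ => ((hd x).1.entropy).symm
  rw [mutualInfo, e3, e4, e5]
  simp only [gent, Finset.sum_sub_distrib]
  ring

/-- `gent` via diagonalization. -/
lemma Dg.gent {ι : Type*} [Fintype ι] [DecidableEq ι] {M U : Matrix ι ι ℂ} {d : ι → ℝ}
    (h : Dg M U d) : gent M = ∑ i, d i * (Real.log (∑ j, d j) - Real.log (d i)) := by
  rw [LPD.gent, h.entropy, h.rtr_eq]
  simp only [Real.negMulLog, mul_sub, Finset.sum_sub_distrib, ← Finset.sum_mul]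
  rw [Finset.sum_congr rfl (fun i _ => neg_mul (d i) _), Finset.sum_neg_distrib]
  ring

lemma gent_nonneg {ι : Type*} [Fintype ι] [DecidableEq ι] {M : Matrix ι ι ℂ} (h : M.PosSemidef) :
    0 ≤ gent M := by
  obtain ⟨U, d, hd, hp⟩ := psd_dg h
  rw [hd.gent]
  refine Finset.sum_nonneg fun i _ => ?_
  rcases (hp i).eq_or_lt with h0 | h0
  · simp [← h0]
  · refine mul_nonneg h0.le (sub_nonneg.2 (Real.log_le_log h0 ?_))
    exact Finset.single_le_sum (fun j _ => hp j) (Finset.mem_univ i)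

/-- `gent` of a Kronecker product. -/
lemma gent_kron {ι κ : Type*} [Fintype ι] [DecidableEq ι] [Fintype κ] [DecidableEq κ]
    {M : Matrix ι ι ℂ} {N : Matrix κ κ ℂ} (hM : M.PosSemidef) (hN : N.PosSemidef) :
    gent (M ⊗ₖ N) = rtr N * gent M + rtr M * gent N := by
  obtain ⟨U, d, hd, hp⟩ := psd_dg hM
  obtain ⟨V, e, he, hq⟩ := psd_dg hN
  have hk : Dg (M ⊗ₖ N) (U ⊗ₖ V) (fun p => d p.1 * e p.2) := by
    refine ⟨?_, ?_, ?_⟩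
    · rw [conjTranspose_kronecker, ← mul_kronecker_mul, hd.1, he.1, one_kronecker_one]
    · rw [conjTranspose_kronecker, ← mul_kronecker_mul, hd.2.1, he.2.1, one_kronecker_one]
    · rw [conjTranspose_kronecker]
      conv_lhs => rw [hd.2.2, he.2.2]
      rw [mul_kronecker_mul, mul_kronecker_mul, diagonal_kronecker_diagonal]
      simp
  rw [hk.gent, hd.gent, he.gent, hd.rtr_eq, he.rtr_eq]
  have hs : ∑ p : ι × κ, d p.1 * e p.2 = (∑ i, d i) * ∑ j, e j := by
    rw [Fintype.sum_prod_type, Finset.sum_mul_sum]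
  rw [hs, Fintype.sum_prod_type]
  have key : ∀ i j, d i * e j * (Real.log ((∑ i, d i) * ∑ j, e j) - Real.log (d i * e j)) =
      e j * (d i * (Real.log (∑ i, d i) - Real.log (d i))) +
      d i * (e j * (Real.log (∑ j, e j) - Real.log (e j))) := by
    intro i j
    rcases (hp i).eq_or_lt with h0 | h0
    · simp [← h0]
    rcases (hq j).eq_or_lt with h1 | h1
    · simp [← h1]
    have a1 : 0 < ∑ i, d i := lt_of_lt_of_le h0 (Finset.single_le_sum (fun j _ => hp j) (Finset.mem_univ i))
    have a2 : 0 < ∑ i, e i := lt_of_lt_of_le h1 (Finset.single_le_sum (fun j _ => hq j) (Finset.mem_univ j))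
    rw [Real.log_mul a1.ne' a2.ne', Real.log_mul h0.ne' h1.ne']
    ring
  simp only [key, Finset.sum_add_distrib, ← Finset.sum_mul, ← Finset.mul_sum]

/-- tensor product of bipartite operators, factors collected -/
def tprod {A B A' B' : Type*} (ρ : Matrix (A × B) (A × B) ℂ) (ρ' : Matrix (A' × B') (A' × B') ℂ) :
    Matrix ((A × A') × (B × B')) ((A × A') × (B × B')) ℂ :=
  fun p q => ρ (p.1.1, p.2.1) (q.1.1, q.2.1) * ρ' (p.1.2, p.2.2) (q.1.2, q.2.2)

lemma red_tprod {A B A' B' : Type*} [Fintype A] [Fintype A'] (ρ : Matrix (A × B) (A × B) ℂ)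
    (ρ' : Matrix (A' × B') (A' × B') ℂ) (w : A → ℂ) (w' : A' → ℂ) :
    red (rk (fun a : A × A' => w a.1 * w' a.2)) (tprod ρ ρ') = red (rk w) ρ ⊗ₖ red (rk w') ρ' := by
  ext ⟨b, b'⟩ ⟨c, c'⟩
  simp only [red, rk, tprod, vecMulVec_apply, kroneckerMap_apply, Pi.star_apply,
    Fintype.sum_prod_type, star_mul', Finset.sum_mul_sum]
  refine Finset.sum_congr rfl fun a _ => ?_
  refine Finset.sum_congr rfl fun a' _ => ?_
  refine Finset.sum_congr rfl fun a2 _ => ?_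
  refine Finset.sum_congr rfl fun a3 _ => ?_
  ring

lemma red_reindex {A B A' B' : Type*} [Fintype A] [Fintype A'] (eA : A ≃ A') (eB : B ≃ B')
    (ρ : Matrix (A × B) (A × B) ℂ) (ρ' : Matrix (A' × B') (A' × B') ℂ)
    (h : ∀ a b a' b', ρ (a, b) (a', b') = ρ' (eA a, eB b) (eA a', eB b')) (w : A' → ℂ) :
    red (rk (fun a => w (eA a))) ρ = (red (rk w) ρ').submatrix eB eB := by
  ext b b'
  simp only [red, rk, vecMulVec_apply, Pi.star_apply, submatrix_apply, h]
  rw [← eA.sum_comp]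
  refine Finset.sum_congr rfl fun a _ => ?_
  rw [← eA.sum_comp]

lemma Dg.submatrix {ι κ : Type*} [Fintype ι] [DecidableEq ι] [Fintype κ] [DecidableEq κ]
    {M U : Matrix ι ι ℂ} {d : ι → ℝ} (h : Dg M U d) (e : κ ≃ ι) :
    Dg (M.submatrix e e) (U.submatrix e e) (d ∘ e) := by
  refine ⟨?_, ?_, ?_⟩
  · rw [conjTranspose_submatrix, submatrix_mul_equiv, h.1, submatrix_one_equiv]
  · rw [conjTranspose_submatrix, submatrix_mul_equiv, h.2.1, submatrix_one_equiv]
  · conv_lhs => rw [h.2.2]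
    rw [conjTranspose_submatrix, ← submatrix_mul_equiv _ _ e e e, ← submatrix_mul_equiv _ _ e e e]
    congr 2
    ext i j
    simp [diagonal_apply]

lemma gent_submatrix {ι κ : Type*} [Fintype ι] [DecidableEq ι] [Fintype κ] [DecidableEq κ]
    {M : Matrix ι ι ℂ} (h : M.PosSemidef) (e : κ ≃ ι) : gent (M.submatrix e e) = gent M := by
  obtain ⟨U, d, hd, -⟩ := psd_dg h
  rw [(hd.submatrix e).gent, hd.gent]
  simp only [Function.comp_apply]
  rw [e.sum_comp d, e.sum_comp (fun i => d i * (Real.log (∑ j, d j) - Real.log (d i)))]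

lemma rk_complete_reindex {A A' X : Type*} [DecidableEq A] [DecidableEq A']
    [Fintype X] (eA : A ≃ A') (w : X → A' → ℂ) (h : ∑ x, rk (w x) = 1) :
    ∑ x, rk (fun a => w x (eA a)) = 1 := by
  ext a a'
  have := congrFun (congrFun h (eA a)) (eA a')
  simp only [Matrix.sum_apply, rk, vecMulVec_apply, Pi.star_apply, Matrix.one_apply,
    EmbeddingLike.apply_eq_iff_eq] at this ⊢
  exact this

lemma rk_complete_prod {A A' X X' : Type*} [DecidableEq A] [DecidableEq A']
    [Fintype X] [Fintype X'] (w : X → A → ℂ) (w' : X' → A' → ℂ) (h : ∑ x, rk (w x) = 1)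
    (h' : ∑ x, rk (w' x) = 1) :
    ∑ x : X × X', rk (fun a : A × A' => w x.1 a.1 * w' x.2 a.2) = 1 := by
  ext ⟨a, a'⟩ ⟨c, c'⟩
  have h1 := congrFun (congrFun h a) c
  have h2 := congrFun (congrFun h' a') c'
  simp only [Matrix.sum_apply, rk, vecMulVec_apply, Pi.star_apply] at h1 h2 ⊢
  rw [← one_kronecker_one, kroneckerMap_apply, ← h1, ← h2, Fintype.sum_prod_type,
    Finset.sum_mul_sum]
  refine Finset.sum_congr rfl fun x _ => ?_
  refine Finset.sum_congr rfl fun x' _ => ?_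
  simp only [star_mul']; ring

/-- achievable values of the measured conditional entropy -/
def Val {A B : Type*} [Fintype A] [DecidableEq A] [Fintype B] [DecidableEq B]
    (ρ : Matrix (A × B) (A × B) ℂ) (v : ℝ) : Prop :=
  ∃ (m : ℕ) (w : Fin m → A → ℂ), ∑ x, rk (w x) = 1 ∧ v = ∑ x, gent (red (rk (w x)) ρ)

lemma Val.of {A B X : Type*} [Fintype A] [DecidableEq A] [Fintype B] [DecidableEq B] [Fintype X]
    (ρ : Matrix (A × B) (A × B) ℂ) (w : X → A → ℂ) (h : ∑ x, rk (w x) = 1) :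
    Val ρ (∑ x, gent (red (rk (w x)) ρ)) := by
  refine ⟨Fintype.card X, fun i => w ((Fintype.equivFin X).symm i), ?_, ?_⟩
  · rw [← h]; exact (Fintype.equivFin X).symm.sum_comp (fun x => rk (w x))
  · exact ((Fintype.equivFin X).symm.sum_comp (fun x => gent (red (rk (w x)) ρ))).symm

lemma Val.reindex {A B A' B' : Type*} [Fintype A] [DecidableEq A] [Fintype B] [DecidableEq B]
    [Fintype A'] [DecidableEq A'] [Fintype B'] [DecidableEq B'] (eA : A ≃ A') (eB : B ≃ B')
    (ρ : Matrix (A × B) (A × B) ℂ) (ρ' : Matrix (A' × B') (A' × B') ℂ) (hρ : ρ'.PosSemidef)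
    (h : ∀ a b a' b', ρ (a, b) (a', b') = ρ' (eA a, eB b) (eA a', eB b')) {v : ℝ}
    (hv : Val ρ' v) : Val ρ v := by
  obtain ⟨m, w, hw, rfl⟩ := hv
  refine ⟨m, fun x a => w x (eA a), rk_complete_reindex eA w hw, ?_⟩
  refine Finset.sum_congr rfl fun x _ => ?_
  rw [red_reindex eA eB ρ ρ' h, gent_submatrix (red_rk_psd hρ _)]

lemma sum_rtr_red {A B X : Type*} [Fintype A] [DecidableEq A] [Fintype B] [Fintype X]
    (ρ : Matrix (A × B) (A × B) ℂ) (hρ : ρ.trace = 1) (w : X → A → ℂ) (h : ∑ x, rk (w x) = 1) :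
    ∑ x, rtr (red (rk (w x)) ρ) = 1 := by
  simp only [rtr]
  rw [← Complex.re_sum, ← Matrix.trace_sum, red_sum, h, red_one]
  have : (ptraceLeft ρ).trace = 1 := by
    rw [← hρ]
    simp only [Matrix.trace, Matrix.diag_apply, ptraceLeft, Fintype.sum_prod_type]
    exact Finset.sum_comm
  simp [this]

lemma Val.prod {A B A' B' : Type*} [Fintype A] [DecidableEq A] [Fintype B] [DecidableEq B]
    [Fintype A'] [DecidableEq A'] [Fintype B'] [DecidableEq B']
    (ρ : Matrix (A × B) (A × B) ℂ) (ρ' : Matrix (A' × B') (A' × B') ℂ) (hρ : IsDensity ρ)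
    (hρ' : IsDensity ρ') {v v' : ℝ}
    (hv : Val ρ v) (hv' : Val ρ' v') : Val (tprod ρ ρ') (v + v') := by
  obtain ⟨m, w, hw, rfl⟩ := hv
  obtain ⟨m', w', hw', rfl⟩ := hv'
  convert Val.of (tprod ρ ρ') _ (rk_complete_prod w w' hw hw') using 1
  have : ∀ x : Fin m × Fin m', gent (red (rk (fun a : A × A' => w x.1 a.1 * w' x.2 a.2)) (tprod ρ ρ'))
      = rtr (red (rk (w' x.2)) ρ') * gent (red (rk (w x.1)) ρ) +
        rtr (red (rk (w x.1)) ρ) * gent (red (rk (w' x.2)) ρ') := fun x => by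
    rw [red_tprod, gent_kron (red_rk_psd hρ.1 _) (red_rk_psd hρ'.1 _)]
  simp only [this, Finset.sum_add_distrib, Fintype.sum_prod_type, ← Finset.sum_mul, ← Finset.mul_sum]
  rw [sum_rtr_red ρ hρ.2 w hw, sum_rtr_red ρ' hρ'.2 w' hw']
  simp

/-! tensor powers -/

lemma sum_pi_prod {ι κ : Type*} [Fintype ι] [DecidableEq ι] [Fintype κ]
    {R : Type*} [CommSemiring R] (f : ι → κ → R) :
    ∑ x : ι → κ, ∏ k, f k (x k) = ∏ k, ∑ i, f k i := by
  classical
  rw [Finset.prod_univ_sum, Fintype.piFinset_univ]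

/-- tensor power over a general finite index type -/
def tpG {α β : Type*} (ρ : Matrix (α × β) (α × β) ℂ) (ι : Type*) [Fintype ι] :
    Matrix ((ι → α) × (ι → β)) ((ι → α) × (ι → β)) ℂ :=
  fun p q => ∏ k, ρ (p.1 k, p.2 k) (q.1 k, q.2 k)

lemma tpowAB_eq {α β : Type*} (ρ : Matrix (α × β) (α × β) ℂ) (n : ℕ) :
    tpowAB ρ n = tpG ρ (Fin n) := by
  ext p q
  rfl

lemma tpow_mul {ι : Type*} [Fintype ι] (M N : Matrix ι ι ℂ) (n : ℕ) :
    tpow (M * N) n = tpow M n * tpow N n := by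
  ext x y
  simp only [tpow, Matrix.mul_apply]
  rw [← sum_pi_prod (fun k j => M (x k) j * N j (y k))]
  simp [Finset.prod_mul_distrib]

lemma tpow_conjTranspose {ι : Type*} (M : Matrix ι ι ℂ) (n : ℕ) :
    tpow (Mᴴ) n = (tpow M n)ᴴ := by
  ext x y
  simp [tpow]

lemma tpow_diagonal {ι : Type*} [DecidableEq ι] (d : ι → ℂ) (n : ℕ) :
    tpow (diagonal d) n = diagonal (fun x => ∏ k, d (x k)) := by
  ext x y
  simp only [tpow, diagonal_apply]
  split_ifs with h
  · subst h; simp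
  · obtain ⟨k, hk⟩ := Function.ne_iff.1 h
    exact Finset.prod_eq_zero (Finset.mem_univ k) (by simp [hk])

lemma tpow_one {ι : Type*} [DecidableEq ι] (n : ℕ) :
    tpow (1 : Matrix ι ι ℂ) n = 1 := by
  rw [← diagonal_one, tpow_diagonal]
  simp

lemma Dg.tpow {ι : Type*} [Fintype ι] [DecidableEq ι] {M U : Matrix ι ι ℂ} {d : ι → ℝ}
    (h : Dg M U d) (n : ℕ) : Dg (tpow M n) (tpow U n) (fun x => ∏ k, d (x k)) := by
  refine ⟨?_, ?_, ?_⟩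
  · rw [← tpow_conjTranspose, ← tpow_mul, h.1, tpow_one]
  · rw [← tpow_conjTranspose, ← tpow_mul, h.2.1, tpow_one]
  · conv_lhs => rw [h.2.2]
    rw [tpow_mul, tpow_mul, tpow_diagonal, tpow_conjTranspose]
    simp

lemma Dg.psd {ι : Type*} [Fintype ι] [DecidableEq ι] {M U : Matrix ι ι ℂ} {d : ι → ℝ}
    (h : Dg M U d) (hd : ∀ i, 0 ≤ d i) : M.PosSemidef := by
  rw [h.2.2]
  refine PosSemidef.mul_mul_conjTranspose_same ?_ U
  refine PosSemidef.diagonal fun i => ?_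
  simpa using hd i

lemma tpow_density {ι : Type*} [Fintype ι] [DecidableEq ι] {M : Matrix ι ι ℂ} (h : IsDensity M)
    (n : ℕ) : IsDensity (tpow M n) := by
  obtain ⟨U, d, hd, hp⟩ := psd_dg h.1
  refine ⟨(hd.tpow n).psd fun x => Finset.prod_nonneg fun k _ => hp _, ?_⟩
  simp only [Matrix.trace, Matrix.diag_apply, LPD.tpow]
  rw [sum_pi_prod (fun _ i => M i i)]
  have := h.2
  simp only [Matrix.trace, Matrix.diag_apply] at this
  simp [this]

lemma density_submatrix {ι κ : Type*} [Fintype ι] [Fintype κ] {M : Matrix ι ι ℂ} (h : IsDensity M)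
    (e : κ ≃ ι) : IsDensity (M.submatrix e e) := by
  refine ⟨h.1.submatrix e, ?_⟩
  rw [← h.2]
  simp only [Matrix.trace, Matrix.diag_apply, submatrix_apply]
  exact e.sum_comp (fun i => M i i)

lemma tpowAB_density {α β : Type*} [Fintype α] [DecidableEq α] [Fintype β] [DecidableEq β]
    {ρ : Matrix (α × β) (α × β) ℂ} (h : IsDensity ρ) (n : ℕ) : IsDensity (tpowAB ρ n) := by
  rw [tpowAB, reindex_apply]
  exact density_submatrix (tpow_density h n) _

lemma ptraceRight_tpowAB {α β : Type*} [Fintype β]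
    (ρ : Matrix (α × β) (α × β) ℂ) (n : ℕ) :
    ptraceRight (tpowAB ρ n) = tpow (ptraceRight ρ) n := by
  ext a a'
  rw [tpowAB_eq]
  simp only [ptraceRight, tpG, tpow]
  rw [sum_pi_prod (fun k b => ρ (a k, b) (a' k, b))]

lemma ptraceLeft_tpowAB {α β : Type*} [Fintype α]
    (ρ : Matrix (α × β) (α × β) ℂ) (n : ℕ) :
    ptraceLeft (tpowAB ρ n) = tpow (ptraceLeft ρ) n := by
  ext b b'
  rw [tpowAB_eq]
  simp only [ptraceLeft, tpG, tpow]
  rw [sum_pi_prod (fun k a => ρ (a, b k) (a, b' k))]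

lemma ptraceRight_density {A B : Type*} [Fintype A] [Fintype B]
    {ρ : Matrix (A × B) (A × B) ℂ} (h : IsDensity ρ) : IsDensity (ptraceRight ρ) := by
  refine ⟨?_, ?_⟩
  · have : ptraceRight ρ = ∑ b, ρ.submatrix (fun a => (a, b)) (fun a => (a, b)) := by
      ext a a'; simp [ptraceRight, Matrix.sum_apply]
    rw [this]
    exact posSemidef_sum _ fun b _ => h.1.submatrix _
  · rw [← h.2]
    simp [Matrix.trace, ptraceRight, Fintype.sum_prod_type]

lemma ptraceLeft_density {A B : Type*} [Fintype A] [Fintype B]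
    {ρ : Matrix (A × B) (A × B) ℂ} (h : IsDensity ρ) : IsDensity (ptraceLeft ρ) := by
  refine ⟨?_, ?_⟩
  · have : ptraceLeft ρ = ∑ a, ρ.submatrix (fun b => (a, b)) (fun b => (a, b)) := by
      ext a a'; simp [ptraceLeft, Matrix.sum_apply]
    rw [this]
    exact posSemidef_sum _ fun b _ => h.1.submatrix _
  · rw [← h.2]
    simp only [Matrix.trace, Matrix.diag_apply, ptraceLeft, Fintype.sum_prod_type]
    exact Finset.sum_comm

lemma entropy_tpow {ι : Type*} [Fintype ι] [DecidableEq ι] {M : Matrix ι ι ℂ} (h : IsDensity M)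
    (n : ℕ) : entropy (tpow M n) = n * entropy M := by
  obtain ⟨U, d, hd, hp⟩ := psd_dg h.1
  have hs : ∑ i, d i = 1 := by
    have := hd.trace_eq
    rw [h.2] at this
    exact_mod_cast this.symm
  rw [(hd.tpow n).entropy, hd.entropy]
  induction n with
  | zero => simp
  | succ n ih =>
    rw [← (Fin.consEquiv (fun _ => ι)).sum_comp, Fintype.sum_prod_type]
    simp only [Fin.consEquiv_apply, Fin.prod_univ_succ, Fin.cons_zero, Fin.cons_succ,
      Real.negMulLog_mul, Finset.sum_add_distrib, ← Finset.mul_sum, ← Finset.sum_mul]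
    rw [ih, hs, sum_pi_prod (fun _ i => d i), hs]
    simp; ring

/-- splitting equivalence -/
def splitE {ι κ l : Type*} (e : ι ≃ κ ⊕ l) (α : Type*) : (ι → α) ≃ (κ → α) × (l → α) :=
  (Equiv.arrowCongr e (Equiv.refl α)).trans (Equiv.sumArrowEquivProdArrow κ l α)

lemma tpG_split {ι κ l α β : Type*} [Fintype ι] [Fintype κ] [Fintype l] (e : ι ≃ κ ⊕ l)
    (ρ : Matrix (α × β) (α × β) ℂ) (a : ι → α) (b : ι → β) (a' : ι → α) (b' : ι → β) :
    tpG ρ ι (a, b) (a', b') = tprod (tpG ρ κ) (tpG ρ l) (splitE e α a, splitE e β b)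
      (splitE e α a', splitE e β b') := by
  simp only [tpG, tprod, splitE]
  rw [← e.symm.prod_comp, Fintype.prod_sum_type]
  rfl

lemma tprod_psd {A B A' B' : Type*} [Fintype A] [Fintype B] [Fintype A'] [Fintype B']
    {ρ : Matrix (A × B) (A × B) ℂ} {ρ' : Matrix (A' × B') (A' × B') ℂ}
    (h : ρ.PosSemidef) (h' : ρ'.PosSemidef) : (tprod ρ ρ').PosSemidef := by
  classical
  exact (h.kronecker h').submatrix (fun p : (A × A') × (B × B') => ((p.1.1, p.2.1), (p.1.2, p.2.2)))

lemma Val.tpow_add {α β : Type*} [Fintype α] [DecidableEq α] [Fintype β] [DecidableEq β]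
    {ρ : Matrix (α × β) (α × β) ℂ} (h : IsDensity ρ) {m n : ℕ} {v v' : ℝ}
    (hv : Val (tpowAB ρ m) v) (hv' : Val (tpowAB ρ n) v') : Val (tpowAB ρ (m + n)) (v + v') := by
  have h1 := tpowAB_density h m
  have h2 := tpowAB_density h n
  refine Val.reindex (splitE finSumFinEquiv.symm α) (splitE finSumFinEquiv.symm β) _ _
    (tprod_psd h1.1 h2.1) ?_ (Val.prod _ _ h1 h2 hv hv')
  intro a b a' b'
  simp only [tpowAB_eq]
  exact tpG_split _ _ _ _ _ _

/-- optimal measured conditional entropy for `n` copies -/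
def Cn {α β : Type*} [Fintype α] [DecidableEq α] [Fintype β] [DecidableEq β]
    (ρ : Matrix (α × β) (α × β) ℂ) (n : ℕ) : ℝ := sInf {v | Val (tpowAB ρ n) v}

lemma Val.exists {A B : Type*} [Fintype A] [DecidableEq A] [Fintype B] [DecidableEq B]
    (ρ : Matrix (A × B) (A × B) ℂ) : ∃ v, Val ρ v := by
  refine ⟨_, Val.of ρ (fun a : A => Pi.single a 1) ?_⟩
  ext a a'
  simp only [Matrix.sum_apply, rk, vecMulVec_apply, Pi.star_apply, Pi.single_apply, Matrix.one_apply,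
    apply_ite star, star_one, star_zero, mul_ite, mul_one, mul_zero, Finset.sum_ite_eq,
    Finset.mem_univ, if_true]

lemma Val.nonneg {A B : Type*} [Fintype A] [DecidableEq A] [Fintype B] [DecidableEq B]
    {ρ : Matrix (A × B) (A × B) ℂ} (hρ : ρ.PosSemidef) {v : ℝ} (h : Val ρ v) : 0 ≤ v := by
  obtain ⟨m, w, hw, rfl⟩ := h
  exact Finset.sum_nonneg fun x _ => gent_nonneg (red_rk_psd hρ _)

lemma Cn_bdd {α β : Type*} [Fintype α] [DecidableEq α] [Fintype β] [DecidableEq β]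
    {ρ : Matrix (α × β) (α × β) ℂ} (h : IsDensity ρ) (n : ℕ) : BddBelow {v | Val (tpowAB ρ n) v} :=
  ⟨0, fun _ hv => Val.nonneg (tpowAB_density h n).1 hv⟩

lemma Cn_nonneg {α β : Type*} [Fintype α] [DecidableEq α] [Fintype β] [DecidableEq β]
    {ρ : Matrix (α × β) (α × β) ℂ} (h : IsDensity ρ) (n : ℕ) : 0 ≤ Cn ρ n :=
  Real.sInf_nonneg fun _ hv => Val.nonneg (tpowAB_density h n).1 hv

lemma Cn_le {α β : Type*} [Fintype α] [DecidableEq α] [Fintype β] [DecidableEq β]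
    {ρ : Matrix (α × β) (α × β) ℂ} (h : IsDensity ρ) {n : ℕ} {v : ℝ} (hv : Val (tpowAB ρ n) v) : Cn ρ n ≤ v := csInf_le (Cn_bdd h n) hv

lemma Cn_sub {α β : Type*} [Fintype α] [DecidableEq α] [Fintype β] [DecidableEq β]
    {ρ : Matrix (α × β) (α × β) ℂ} (h : IsDensity ρ) : Subadditive (Cn ρ) := by
  intro m n
  refine le_of_forall_pos_le_add fun ε hε => ?_
  obtain ⟨v, hv, hv2⟩ := exists_lt_of_csInf_lt (Val.exists (tpowAB ρ m))
    (lt_add_of_pos_right (Cn ρ m) (half_pos hε))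
  obtain ⟨v', hv', hv2'⟩ := exists_lt_of_csInf_lt (Val.exists (tpowAB ρ n))
    (lt_add_of_pos_right (Cn ρ n) (half_pos hε))
  have := Cn_le h (Val.tpow_add h hv hv')
  linarith

lemma Cn_tendsto {α β : Type*} [Fintype α] [DecidableEq α] [Fintype β] [DecidableEq β]
    {ρ : Matrix (α × β) (α × β) ℂ} (h : IsDensity ρ) : ∃ C : ℝ, 0 ≤ C ∧ Tendsto (fun n : ℕ => Cn ρ n / n) atTop (nhds C) := by
  have hb : BddBelow (Set.range fun n : ℕ => Cn ρ n / n) := by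
    refine ⟨0, ?_⟩
    rintro _ ⟨n, rfl⟩
    exact div_nonneg (Cn_nonneg h n) (Nat.cast_nonneg n)
  have := (Cn_sub h).tendsto_lim hb
  exact ⟨_, ge_of_tendsto' this fun n => div_nonneg (Cn_nonneg h n) (Nat.cast_nonneg n), this⟩

lemma sSup_eq {α β : Type*} [Fintype α] [DecidableEq α] [Fintype β] [DecidableEq β]
    {ρ : Matrix (α × β) (α × β) ℂ} (h : IsDensity ρ) (n : ℕ) :
    sSup { v : ℝ | ∃ (m : ℕ) (Λ : POVM (Fin n → α) (Fin m)),
            (∀ y, ∃ w : (Fin n → α) → ℂ, Λ.elem y = vecMulVec w (star w)) ∧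
            v = mutualInfo (measureLeft Λ (tpowAB ρ n)) } =
      n * entropy (ptraceLeft ρ) - Cn ρ n := by
  have hd := tpowAB_density h n
  have hE : entropy (ptraceLeft (tpowAB ρ n)) = n * entropy (ptraceLeft ρ) := by
    rw [ptraceLeft_tpowAB, entropy_tpow (ptraceLeft_density h)]
  have : { v : ℝ | ∃ (m : ℕ) (Λ : POVM (Fin n → α) (Fin m)),
            (∀ y, ∃ w : (Fin n → α) → ℂ, Λ.elem y = vecMulVec w (star w)) ∧
            v = mutualInfo (measureLeft Λ (tpowAB ρ n)) } =
      (fun v => n * entropy (ptraceLeft ρ) - v) '' {v | Val (tpowAB ρ n) v} := by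
    ext v
    constructor
    · rintro ⟨m, Λ, hΛ, rfl⟩
      choose w hw using hΛ
      refine ⟨_, ⟨m, w, ?_, rfl⟩, ?_⟩
      · rw [← Λ.sum_eq]; exact Finset.sum_congr rfl fun x _ => (hw x).symm
      · rw [mutualInfo_measure hd.1 Λ w hw, hE]
    · rintro ⟨v, ⟨m, w, hw, rfl⟩, rfl⟩
      refine ⟨m, ⟨fun x => rk (w x), fun x => posSemidef_vecMulVec_self_star _, hw⟩,
        fun x => ⟨w x, rfl⟩, ?_⟩
      rw [mutualInfo_measure hd.1 _ w (fun x => rfl), hE]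
  rw [this]
  refine IsLUB.csSup_eq ⟨?_, ?_⟩ (Set.Nonempty.image _ (Val.exists _))
  · rintro _ ⟨v, hv, rfl⟩
    have := Cn_le h hv
    simp only; linarith
  · intro b hb
    have : n * entropy (ptraceLeft ρ) - b ≤ Cn ρ n := by
      refine le_csInf (Val.exists _) fun v hv => ?_
      have := hb ⟨v, hv, rfl⟩
      simp only at this; linarith
    linarith

lemma chernoff {Ω : Type*} [Fintype Ω] (P f : Ω → ℝ) (hP : ∀ ω, 0 ≤ P ω) (hs : ∑ ω, P ω = 1)
    {δ : ℝ} (hδ : 0 < δ) : ∃ c : ℝ, 0 ≤ c ∧ c < 1 ∧ ∀ k : ℕ,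
      ∑ x : Fin k → Ω, (if (k : ℝ) * (∑ ω, P ω * f ω + δ) < ∑ i, f (x i) then ∏ i, P (x i) else 0)
        ≤ c ^ k := by
  set m := ∑ ω, P ω * f ω with hm
  have hder : HasDerivAt (fun s : ℝ => ∑ ω, P ω * Real.exp (s * (f ω - m - δ)))
      (∑ ω, P ω * (Real.exp (0 * (f ω - m - δ)) * (1 * (f ω - m - δ)))) 0 := by
    refine HasDerivAt.fun_sum fun ω _ => ?_
    exact (((hasDerivAt_id (0:ℝ)).mul_const _).exp).const_mul _
  have hval : ∑ ω, P ω * (Real.exp (0 * (f ω - m - δ)) * (1 * (f ω - m - δ))) = -δ := by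
    have : ∀ ω, P ω * (Real.exp (0 * (f ω - m - δ)) * (1 * (f ω - m - δ))) =
        P ω * f ω - P ω * (m + δ) := fun ω => by simp; ring
    simp only [this, Finset.sum_sub_distrib, ← Finset.sum_mul, hs, ← hm]
    ring
  rw [hval] at hder
  have hslope := hder.tendsto_slope_zero_right
  have hev : ∀ᶠ t in nhdsWithin (0:ℝ) (Set.Ioi 0), t⁻¹ • ((∑ ω, P ω * Real.exp ((0 + t) * (f ω - m - δ))) - ∑ ω, P ω * Real.exp (0 * (f ω - m - δ))) < 0 :=
    hslope.eventually_lt_const (by linarith)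
  obtain ⟨t, ht, ht0⟩ := (hev.and self_mem_nhdsWithin).exists
  have ht0 : 0 < t := ht0
  simp only [zero_add, zero_mul, Real.exp_zero, mul_one, hs, smul_eq_mul] at ht
  refine ⟨∑ ω, P ω * Real.exp (t * (f ω - m - δ)), ?_, ?_, ?_⟩
  · exact Finset.sum_nonneg fun ω _ => mul_nonneg (hP ω) (Real.exp_pos _).le
  · have := neg_of_mul_neg_right ht (inv_pos.2 ht0).le
    linarith
  · intro k
    have : (∑ ω, P ω * Real.exp (t * (f ω - m - δ))) ^ k =
        ∑ x : Fin k → Ω, ∏ i, (P (x i) * Real.exp (t * (f (x i) - m - δ))) := by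
      rw [sum_pi_prod (fun _ ω => P ω * Real.exp (t * (f ω - m - δ)))]
      simp
    rw [this]
    refine Finset.sum_le_sum fun x _ => ?_
    rw [Finset.prod_mul_distrib, ← Real.exp_sum]
    have hp : 0 ≤ ∏ i, P (x i) := Finset.prod_nonneg fun i _ => hP _
    split_ifs with hc
    · refine le_mul_of_one_le_right hp (Real.one_le_exp ?_)
      rw [← Finset.mul_sum]
      refine mul_nonneg ht0.le ?_
      simp only [Finset.sum_sub_distrib, Finset.sum_const, Finset.card_univ, Fintype.card_fin,
        nsmul_eq_mul]
      nlinarith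
    · exact mul_nonneg hp (Real.exp_pos _).le

lemma pureZero_eq (d : ℕ) (hd : 0 < d) (i j : Fin d) :
    pureZero d i j = (if i = ⟨0, hd⟩ then 1 else 0) * (if j = ⟨0, hd⟩ then 1 else 0) := by
  simp only [pureZero, Fin.ext_iff]
  by_cases h1 : i.val = 0 <;> by_cases h2 : j.val = 0 <;> simp [h1, h2]

lemma pureZero_density (d : ℕ) (hd : 0 < d) : IsDensity (pureZero d) := by
  constructor
  · have := posSemidef_vecMulVec_self_star (fun i : Fin d => if i = ⟨0, hd⟩ then (1:ℂ) else 0)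
    convert this using 1
    ext i j
    rw [pureZero_eq d hd, vecMulVec_apply]
    simp [apply_ite star]
  · simp only [Matrix.trace, Matrix.diag_apply, pureZero_eq d hd]
    simp

lemma kron_density {ι κ : Type*} [Fintype ι] [DecidableEq ι] [Fintype κ] [DecidableEq κ]
    {M : Matrix ι ι ℂ} {N : Matrix κ κ ℂ}
    (hM : IsDensity M) (hN : IsDensity N) : IsDensity (M ⊗ₖ N) :=
  ⟨hM.1.kronecker hN.1, by rw [Matrix.trace_kronecker, hM.2, hN.2, mul_one]⟩

lemma conj_density {ι κ : Type*} [Fintype ι] [DecidableEq ι] [Fintype κ] [DecidableEq κ]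
    {M : Matrix ι ι ℂ} {V : Matrix κ ι ℂ} (hM : IsDensity M) (hV : Vᴴ * V = 1) :
    IsDensity (V * M * Vᴴ) :=
  ⟨hM.1.mul_mul_conjTranspose_same V, by
    rw [Matrix.trace_mul_comm, ← Matrix.mul_assoc, hV, Matrix.one_mul, hM.2]⟩

lemma reindex_density {ι κ : Type*} [Fintype ι] [Fintype κ]
    {M : Matrix ι ι ℂ} (hM : IsDensity M) (e : ι ≃ κ) : IsDensity (Matrix.reindex e e M) :=
  density_submatrix hM e.symm

lemma dephase_density {ι κ : Type*} [Fintype ι] [DecidableEq ι] [Fintype κ] [DecidableEq κ]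
    {M : Matrix (ι × κ) (ι × κ) ℂ} (hM : IsDensity M) : IsDensity (dephaseFst M) := by
  constructor
  · have : dephaseFst M = ∑ i : ι, (diagonal fun p : ι × κ => if p.1 = i then (1:ℂ) else 0) * M *
        (diagonal fun p : ι × κ => if p.1 = i then (1:ℂ) else 0)ᴴ := by
      ext p q
      simp only [Matrix.sum_apply, diagonal_conjTranspose, Matrix.mul_diagonal,
        Matrix.diagonal_mul, Pi.star_apply, apply_ite star, star_one, star_zero, dephaseFst]
      simp [eq_comm]
    rw [this]
    exact Matrix.posSemidef_sum _ fun i _ => hM.1.mul_mul_conjTranspose_same _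
  · rw [← hM.2]
    simp [Matrix.trace, dephaseFst]

lemma kron_one_unit {ι κ l : Type*} [Fintype ι] [DecidableEq ι] [Fintype κ] [DecidableEq κ]
    [Fintype l] [DecidableEq l]
    {V : Matrix κ ι ℂ} (hV : Vᴴ * V = 1) :
    (V ⊗ₖ (1 : Matrix l l ℂ))ᴴ * (V ⊗ₖ (1 : Matrix l l ℂ)) = 1 := by
  rw [Matrix.conjTranspose_kronecker, ← Matrix.mul_kronecker_mul, hV]
  simp

lemma output_density {α β : Type*} [Fintype α] [DecidableEq α] [Fintype β] [DecidableEq β]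
    {ρ : Matrix (α × β) (α × β) ℂ} (h : IsDensity ρ) {n : ℕ} (Pr : Protocol α β n) :
    IsDensity (outputReduced ρ Pr) := by
  have h1 : IsDensity (inputState ρ Pr) :=
    reindex_density (kron_density (tpowAB_density h n) (pureZero_density _ Pr.dC_pos)) _
  have h2 : IsDensity (stateAfterUA ρ Pr) := conj_density h1 (kron_one_unit Pr.UA_unitary.1)
  have h3 : IsDensity (stateAfterDephasing ρ Pr) :=
    reindex_density (dephase_density (reindex_density h2 _)) _
  have h4 : IsDensity (stateAfterUB ρ Pr) :=
    conj_density (reindex_density h3 _) (kron_one_unit Pr.UB_unitary.1)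
  exact ptraceRight_density (reindex_density h4 _)

/-- measurement vectors of a protocol -/
def pvec {α β : Type*} [Fintype α] [DecidableEq α] [Fintype β] [DecidableEq β] {n : ℕ}
    (Pr : Protocol α β n) (x : (Fin Pr.dAp × Fin Pr.dY) × Fin Pr.dAg) : (Fin n → α) → ℂ :=
  fun a => star (Pr.UA x (a, ⟨0, Pr.dC_pos⟩))

lemma kron_one_mul {ι κ l m : Type*} [Fintype ι] [Fintype l] [DecidableEq l]
    (V : Matrix κ ι ℂ) (M : Matrix (ι × l) m ℂ) (k : κ) (b : l) (q : m) :
    ((V ⊗ₖ (1 : Matrix l l ℂ)) * M) (k, b) q = ∑ i, V k i * M (i, b) q := by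
  simp [Matrix.mul_apply, Fintype.sum_prod_type, Matrix.one_apply]

lemma mul_kron_one {ι κ l m : Type*} [Fintype ι] [Fintype l] [DecidableEq l]
    (V : Matrix κ ι ℂ) (M : Matrix m (ι × l) ℂ) (k : κ) (b : l) (q : m) :
    (M * (V ⊗ₖ (1 : Matrix l l ℂ))ᴴ) q (k, b) = ∑ i, M q (i, b) * star (V k i) := by
  simp [Matrix.mul_apply, Fintype.sum_prod_type, Matrix.one_apply, apply_ite]

lemma stateAfterUA_apply {α β : Type*} [Fintype α] [DecidableEq α] [Fintype β] [DecidableEq β]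
    (ρ : Matrix (α × β) (α × β) ℂ) {n : ℕ} (Pr : Protocol α β n)
    (x : (Fin Pr.dAp × Fin Pr.dY) × Fin Pr.dAg) (b b' : Fin n → β) :
    stateAfterUA ρ Pr (x, b) (x, b') = red (rk (pvec Pr x)) (tpowAB ρ n) b b' := by
  rw [stateAfterUA, mul_kron_one]
  simp only [kron_one_mul]
  simp only [inputState, Matrix.reindex_apply, Matrix.submatrix_apply, swapE, Equiv.coe_fn_symm_mk,
    Matrix.kroneckerMap_apply, pureZero_eq _ Pr.dC_pos, Fintype.sum_prod_type]
  simp only [mul_ite, mul_one, mul_zero, ite_mul, zero_mul, Finset.sum_ite_eq', Finset.mem_univ,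
    if_true, red, rk, vecMulVec_apply, pvec, Pi.star_apply, star_star]
  refine Finset.sum_congr rfl fun a _ => ?_
  rw [Finset.sum_eq_single (⟨0, Pr.dC_pos⟩ : Fin Pr.dC)]
  · simp only [if_true, Finset.sum_ite_eq', Finset.mem_univ, Finset.sum_mul]
    exact Finset.sum_congr rfl fun _ _ => by ring
  · intro c _ hc
    simp [hc]
  · simp

lemma output_apply {α β : Type*} [Fintype α] [DecidableEq α] [Fintype β] [DecidableEq β]
    (ρ : Matrix (α × β) (α × β) ℂ) {n : ℕ} (Pr : Protocol α β n) (p : Fin Pr.dAp) (q : Fin Pr.dBp) :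
    outputReduced ρ Pr (p, q) (p, q) = ∑ ag, ∑ bg, ∑ y, ∑ b, ∑ b',
      Pr.UB (q, bg) (b, y) * red (rk (pvec Pr ((p, y), ag))) (tpowAB ρ n) b b' *
        star (Pr.UB (q, bg) (b', y)) := by
  simp only [outputReduced, ptraceRight, Fintype.sum_prod_type, Matrix.reindex_apply,
    Matrix.submatrix_apply, sortOut, Equiv.coe_fn_symm_mk]
  refine Finset.sum_congr rfl fun ag _ => Finset.sum_congr rfl fun bg _ => ?_
  rw [stateAfterUB, mul_kron_one]
  simp only [kron_one_mul]
  simp only [Matrix.reindex_apply, Matrix.submatrix_apply, pullBY, stateAfterDephasing, pullY,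
    Equiv.coe_fn_symm_mk, Equiv.symm_symm, Equiv.coe_fn_mk, dephaseFst, Fintype.sum_prod_type]
  simp only [mul_ite, mul_zero, Finset.sum_ite_eq', Finset.sum_ite_eq, Finset.mem_univ, if_true, stateAfterUA_apply]
  simp only [Finset.sum_mul]
  rw [Finset.sum_comm]
  refine Finset.sum_congr rfl fun y _ => ?_
  rw [Finset.sum_comm]

lemma unit_row {ι : Type*} [Fintype ι] [DecidableEq ι] {U : Matrix ι ι ℂ} (h : U * Uᴴ = 1) (i : ι) :
    ∑ k, ‖U i k‖ ^ 2 = 1 := by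
  have := congrFun (congrFun h i) i
  simp only [Matrix.mul_apply, conjTranspose_apply, Matrix.one_apply_eq] at this
  have h2 : ∀ k, U i k * star (U i k) = ((‖U i k‖ ^ 2 : ℝ) : ℂ) := fun k => by
    rw [Complex.star_def, Complex.mul_conj, Complex.normSq_eq_norm_sq]
  simp only [h2] at this
  exact_mod_cast this

lemma abs_le_traceNorm {ι : Type*} [Fintype ι] [DecidableEq ι] {M : Matrix ι ι ℂ}
    (h : M.IsHermitian) (i : ι) : |(M i i).re| ≤ traceNorm M := by
  obtain ⟨U, hU⟩ := dg_exists h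
  rw [hU.traceNorm, hU.apply i i]
  have h2 : ∀ k, U i k * ((h.eigenvalues k : ℝ) : ℂ) * star (U i k) = ((‖U i k‖ ^ 2 * h.eigenvalues k : ℝ) : ℂ) := fun k => by
    rw [mul_right_comm, Complex.star_def, Complex.mul_conj, Complex.normSq_eq_norm_sq]
    push_cast; rfl
  rw [Finset.sum_congr rfl fun k _ => h2 k, ← Complex.ofReal_sum, Complex.ofReal_re]
  refine (Finset.abs_sum_le_sum_abs _ _).trans (Finset.sum_le_sum fun k _ => ?_)
  rw [abs_mul, abs_of_nonneg (by positivity)]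
  refine mul_le_of_le_one_left (abs_nonneg _) ?_
  rw [← unit_row hU.2.1 i]
  exact Finset.single_le_sum (f := fun k => ‖U i k‖ ^ 2) (fun _ _ => by positivity) (Finset.mem_univ k)

lemma psd_diag_re {ι : Type*} [Fintype ι] [DecidableEq ι] {M : Matrix ι ι ℂ} (h : M.PosSemidef) (i : ι) :
    0 ≤ (M i i).re := by
  have := h.diag_nonneg (i := i)
  exact (Complex.le_def.1 this).1

lemma traceNorm_le_of {ι : Type*} [Fintype ι] [DecidableEq ι] {M N : Matrix ι ι ℂ}
    (h : M.IsHermitian) (ht : M.trace = 0) (hN : N.PosSemidef) (hMN : (M + N).PosSemidef) :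
    traceNorm M ≤ 2 * N.trace.re := by
  obtain ⟨U, hU⟩ := dg_exists h
  rw [hU.traceNorm]
  have h1 : ∀ k, |h.eigenvalues k| ≤ h.eigenvalues k + 2 * ((Uᴴ * N * U) k k).re := by
    intro k
    have e1 := psd_diag_re (hN.conjTranspose_mul_mul_same U) k
    have e2 := psd_diag_re (hMN.conjTranspose_mul_mul_same U) k
    rw [Matrix.mul_add, Matrix.add_mul, hU.diag_eq] at e2
    simp only [Matrix.add_apply, Matrix.diagonal_apply_eq, Complex.add_re, Complex.ofReal_re] at e2
    rcases abs_cases (h.eigenvalues k) with ⟨e, _⟩ | ⟨e, _⟩ <;> rw [e] <;> linarith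
  refine (Finset.sum_le_sum fun k _ => h1 k).trans ?_
  rw [Finset.sum_add_distrib, ← Finset.mul_sum]
  have h2 : ∑ k, h.eigenvalues k = 0 := by
    have := hU.trace_eq
    rw [ht] at this
    exact_mod_cast this.symm
  have h3 : ∑ k, ((Uᴴ * N * U) k k).re = N.trace.re := by
    rw [← Complex.re_sum]
    change (Uᴴ * N * U).trace.re = _
    rw [Matrix.trace_mul_comm, ← Matrix.mul_assoc, hU.2.1, Matrix.one_mul]
  rw [h2, h3, zero_add]

lemma gentle {ι : Type*} [Fintype ι] [DecidableEq ι] {σ : Matrix ι ι ℂ} (h : IsDensity σ) (z : ι)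
    {η t : ℝ} (hη : 1 - η ≤ (σ z z).re) (ht : 0 < t) (ht1 : t ≤ 1) :
    traceNorm (σ - Matrix.of fun i j => if i = z ∧ j = z then 1 else 0) ≤ 2 * (η + t + η / t) := by
  set r := (σ z z).re with hr
  have hzz : σ z z = (r : ℂ) := by
    have := h.1.1.apply z z
    rw [Complex.star_def, Complex.conj_eq_iff_re] at this
    exact this.symm
  have hsum : ∑ i ∈ Finset.univ.erase z, (σ i i).re = 1 - r := by
    have := congrArg Complex.re h.2
    rw [Matrix.trace, Complex.re_sum, ← Finset.add_sum_erase _ _ (Finset.mem_univ z)] at this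
    simp only [Matrix.diag_apply, Complex.one_re] at this
    linarith
  have hr1 : r ≤ 1 := by
    have : 0 ≤ ∑ i ∈ Finset.univ.erase z, (σ i i).re := Finset.sum_nonneg fun i _ => psd_diag_re h.1 i
    linarith
  have hr0 : 0 ≤ r := psd_diag_re h.1 z
  set s := Real.sqrt t with hs
  have hs0 : 0 < s := Real.sqrt_pos.2 ht
  have hst : s ^ 2 = t := Real.sq_sqrt ht.le
  set a : ℝ := 1 - (1 - t) * r with ha
  set b : ℝ := t⁻¹ - 1 with hb
  have ha0 : 0 ≤ a := by nlinarith
  have hb0 : 0 ≤ b := sub_nonneg.2 ((one_le_inv₀ ht).2 ht1)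
  set Q : Matrix ι ι ℂ := diagonal fun i => if i = z then 0 else ((Real.sqrt b : ℝ) : ℂ)
  set K : Matrix ι ι ℂ := diagonal fun i => if i = z then (s : ℂ) else ((s⁻¹ : ℝ) : ℂ)
  set P : Matrix ι ι ℂ := diagonal fun i => if i = z then (a : ℂ) else 0
  have hP : P.PosSemidef := by
    refine PosSemidef.diagonal fun i => ?_
    simp only [Pi.zero_apply]
    split_ifs
    · exact_mod_cast ha0
    · exact le_rfl
  have hQ : (Q * σ * Qᴴ).PosSemidef := h.1.mul_mul_conjTranspose_same Q
  have hbb : ((Real.sqrt b : ℝ) : ℂ) * ((Real.sqrt b : ℝ) : ℂ) = b := by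
    rw [← Complex.ofReal_mul, Real.mul_self_sqrt hb0]
  have hcc : ((s⁻¹ : ℝ) : ℂ) * ((s⁻¹ : ℝ) : ℂ) = (t⁻¹ : ℝ) := by
    rw [← Complex.ofReal_mul, ← hst]; congr 1; ring
  have hcd : (s : ℂ) * (s : ℂ) = t := by
    rw [← Complex.ofReal_mul, ← hst]; congr 1; ring
  have hce : (s : ℂ) * ((s⁻¹ : ℝ) : ℂ) = 1 := by
    rw [← Complex.ofReal_mul, mul_inv_cancel₀ hs0.ne']; simp
  have hK : (σ - Matrix.of fun i j => if i = z ∧ j = z then 1 else 0) + (P + Q * σ * Qᴴ) = K * σ * Kᴴ := by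
    ext i j
    simp only [Matrix.add_apply, Matrix.sub_apply, Matrix.of_apply, K, Q, P, diagonal_conjTranspose,
      Matrix.mul_diagonal, Matrix.diagonal_mul, Pi.star_apply, Matrix.diagonal_apply, apply_ite star, star_zero,
      Complex.star_def, Complex.conj_ofReal]
    by_cases hi : i = z <;> by_cases hj : j = z
    · subst hi; subst hj
      simp only [and_self, if_true, hzz]
      have : (a : ℂ) = 1 - (1 - t) * r := by push_cast [ha]; rfl
      linear_combination this - (r : ℂ) * hcd
    · subst hi
      simp only [hj, and_false, if_true, if_false, Ne.symm hj]
      linear_combination (-(σ i j)) * hce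
    · subst hj
      simp only [hi, false_and, if_true, if_false]
      linear_combination (-(σ i j)) * hce
    · have e1 : (if i = j then (0:ℂ) else 0) = 0 := by simp
      simp only [hi, hj, if_false, false_and, e1]
      have : (b : ℂ) = (t⁻¹ : ℝ) - 1 := by push_cast [hb]; rfl
      linear_combination σ i j * hbb - σ i j * hcc + σ i j * this
  have := traceNorm_le_of (M := σ - Matrix.of fun i j => if i = z ∧ j = z then 1 else 0) (N := P + Q * σ * Qᴴ)
    ?_ ?_ (hP.add hQ) ?_
  · refine this.trans ?_
    have e : (P + Q * σ * Qᴴ).trace.re = a + b * (1 - r) := by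
      rw [Matrix.trace_add, Complex.add_re]
      congr 1
      · simp [P, Matrix.trace]
      · rw [Matrix.trace, Complex.re_sum, ← hsum, Finset.mul_sum, ← Finset.add_sum_erase _ _ (Finset.mem_univ z)]
        simp only [Q, Matrix.diag_apply, diagonal_conjTranspose, Matrix.mul_diagonal,
          Matrix.diagonal_mul, Pi.star_apply, if_true, star_zero, mul_zero, Complex.zero_re, zero_add]
        refine Finset.sum_congr rfl fun i hi => ?_
        rw [if_neg (Finset.ne_of_mem_erase hi), Complex.star_def, Complex.conj_ofReal, mul_right_comm, hbb,
          Complex.re_ofReal_mul]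
    rw [e]
    have : b * (1 - r) ≤ η / t := by
      rw [div_eq_inv_mul]
      have : 0 < t⁻¹ := inv_pos.2 ht
      nlinarith
    nlinarith
  · refine h.1.1.sub ?_
    ext i j
    simp only [conjTranspose_apply, Matrix.of_apply, apply_ite star, star_one, star_zero, and_comm]
  · rw [Matrix.trace_sub, h.2]
    simp [Matrix.trace]
  · rw [hK]; exact h.1.mul_mul_conjTranspose_same K

lemma pz_kron {p q : ℕ} (hp : 0 < p) (hq : 0 < q) : pureZero p ⊗ₖ pureZero q =
    Matrix.of fun i j => if i = ((⟨0, hp⟩, ⟨0, hq⟩) : Fin p × Fin q) ∧ j = (⟨0, hp⟩, ⟨0, hq⟩) then 1 else 0 := by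
  ext ⟨i, k⟩ ⟨j, l⟩
  rw [Matrix.kroneckerMap_apply, pureZero_eq p hp, pureZero_eq q hq]
  simp only [Matrix.of_apply, Prod.mk.injEq]
  split_ifs <;> simp_all

/-- success probability -/
def succP {α β : Type*} [Fintype α] [DecidableEq α] [Fintype β] [DecidableEq β]
    (ρ : Matrix (α × β) (α × β) ℂ) {n : ℕ} (Pr : Protocol α β n) : ℝ :=
  (outputReduced ρ Pr (⟨0, Pr.dAp_pos⟩, ⟨0, Pr.dBp_pos⟩) (⟨0, Pr.dAp_pos⟩, ⟨0, Pr.dBp_pos⟩)).re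

lemma succP_ge {α β : Type*} [Fintype α] [DecidableEq α] [Fintype β] [DecidableEq β]
    {ρ : Matrix (α × β) (α × β) ℂ} (h : IsDensity ρ) {n : ℕ} (Pr : Protocol α β n) :
    1 - protocolError ρ Pr ≤ succP ρ Pr := by
  have h1 : (outputReduced ρ Pr - pureZero Pr.dAp ⊗ₖ pureZero Pr.dBp).IsHermitian :=
    (output_density h Pr).1.1.sub
      (kron_density (pureZero_density _ Pr.dAp_pos) (pureZero_density _ Pr.dBp_pos)).1.1
  have := abs_le_traceNorm h1 (⟨0, Pr.dAp_pos⟩, ⟨0, Pr.dBp_pos⟩)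
  rw [← protocolError, Matrix.sub_apply, Complex.sub_re, ← succP, pz_kron Pr.dAp_pos Pr.dBp_pos] at this
  simp only [Matrix.of_apply, and_self, if_true, Complex.one_re] at this
  linarith [(abs_le.1 this).1]

lemma error_le {α β : Type*} [Fintype α] [DecidableEq α] [Fintype β] [DecidableEq β]
    {ρ : Matrix (α × β) (α × β) ℂ} (h : IsDensity ρ) {n : ℕ} (Pr : Protocol α β n)
    {η t : ℝ} (hη : 1 - η ≤ succP ρ Pr) (ht : 0 < t) (ht1 : t ≤ 1) :
    protocolError ρ Pr ≤ 2 * (η + t + η / t) := by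
  rw [protocolError, pz_kron Pr.dAp_pos Pr.dBp_pos]
  exact gentle (output_density h Pr) _ hη ht ht1

/-- real quadratic form -/
def qf {A : Type*} [Fintype A] (M : Matrix A A ℂ) (w : A → ℂ) : ℝ :=
  (∑ a, ∑ a', star (w a) * M a a' * w a').re

lemma nsq (z : ℂ) : ((‖z‖ ^ 2 : ℝ) : ℂ) = z * star z := by
  rw [Complex.star_def, Complex.mul_conj, Complex.normSq_eq_norm_sq]

lemma qf_dgC {A : Type*} [Fintype A] [DecidableEq A] {M W : Matrix A A ℂ} {l : A → ℝ} (h : Dg M W l)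
    (w : A → ℂ) : ∑ a, ∑ a', star (w a) * M a a' * w a' =
      ((∑ j, l j * ‖∑ a, star (W a j) * w a‖ ^ 2 : ℝ) : ℂ) := by
  simp only [Complex.ofReal_sum, Complex.ofReal_mul, nsq]
  simp only [h.apply, star_sum, star_mul', star_star, Finset.mul_sum, Finset.sum_mul]
  rw [Finset.sum_congr rfl fun a _ => Finset.sum_comm, Finset.sum_comm]
  refine Finset.sum_congr rfl fun j _ => Finset.sum_congr rfl fun a _ => Finset.sum_congr rfl fun b _ => ?_
  ring

lemma qf_dg {A : Type*} [Fintype A] [DecidableEq A] {M W : Matrix A A ℂ} {l : A → ℝ} (h : Dg M W l)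
    (w : A → ℂ) : qf M w = ∑ j, l j * ‖∑ a, star (W a j) * w a‖ ^ 2 := by
  rw [qf, qf_dgC h, Complex.ofReal_re]

lemma rtr_red {A B : Type*} [Fintype A] [Fintype B] (ρ : Matrix (A × B) (A × B) ℂ) (w : A → ℂ) :
    rtr (red (rk w) ρ) = qf (ptraceRight ρ) w := by
  rw [rtr, trace_red, qf, Matrix.trace]
  simp only [Matrix.diag_apply, Matrix.mul_apply, rk, vecMulVec_apply, Pi.star_apply]
  rw [Finset.sum_comm]
  congr 1
  refine Finset.sum_congr rfl fun j _ => Finset.sum_congr rfl fun a _ => ?_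
  ring

lemma iso_norm {ι κ : Type*} [Fintype ι] [DecidableEq ι] [Fintype κ]
    {V : Matrix κ ι ℂ} (hV : Vᴴ * V = 1) (u : ι → ℂ) :
    ∑ k, ‖∑ i, V k i * u i‖ ^ 2 = ∑ i, ‖u i‖ ^ 2 := by
  have h : ((∑ k, ‖∑ i, V k i * u i‖ ^ 2 : ℝ) : ℂ) = ((∑ i, ‖u i‖ ^ 2 : ℝ) : ℂ) := by
    simp only [Complex.ofReal_sum, nsq, star_sum, star_mul', Finset.sum_mul_sum]
    rw [Finset.sum_comm]
    have : ∀ i j, ∑ k, V k i * u i * (star (V k j) * star (u j)) = (1 : Matrix ι ι ℂ) j i * (u i * star (u j)) := by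
      intro i j
      rw [← hV, Matrix.mul_apply, Finset.sum_mul]
      refine Finset.sum_congr rfl fun k _ => ?_
      rw [conjTranspose_apply]; ring
    rw [Finset.sum_congr rfl fun i _ => Finset.sum_comm]
    simp only [this, Matrix.one_apply, ite_mul, one_mul, zero_mul]
    simp
  exact_mod_cast h

lemma complete_iso {A X : Type*} [Fintype A] [DecidableEq A] [Fintype X] {w : X → A → ℂ} :
    ∑ x, rk (w x) = 1 ↔
      (Matrix.of fun (x : X) (a : A) => star (w x a))ᴴ * (Matrix.of fun (x : X) (a : A) => star (w x a)) = 1 := by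
  have : ∑ x, rk (w x) = (Matrix.of fun (x : X) (a : A) => star (w x a))ᴴ * (Matrix.of fun (x : X) (a : A) => star (w x a)) := by
    ext a a'
    simp [Matrix.sum_apply, rk, vecMulVec_apply, Matrix.mul_apply]
  rw [this]

lemma complete_norm {A X : Type*} [Fintype A] [DecidableEq A] [Fintype X] {w : X → A → ℂ}
    (h : ∑ x, rk (w x) = 1) (u : A → ℂ) :
    ∑ x, ‖∑ a, star (u a) * w x a‖ ^ 2 = ∑ a, ‖u a‖ ^ 2 := by
  rw [← iso_norm (complete_iso.1 h) u]
  refine Finset.sum_congr rfl fun x _ => ?_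
  rw [← norm_star]
  simp [mul_comm]

lemma core1 {X J : Type*} [Fintype X] [Fintype J] [Nonempty J] (d τ : X → J → ℝ) (hd : ∀ x j, 0 ≤ d x j)
    (hτ0 : ∀ x j, 0 ≤ τ x j) (hτ1 : ∀ x j, τ x j ≤ 1) (hp : ∑ x, ∑ j, d x j = 1) {K : ℝ} (hK : 0 < K)
    (hτK : ∑ x, ∑ j, τ x j ≤ K) :
    (∑ x, ∑ j, d x j * (Real.log (∑ i, d x i) - Real.log (d x j))) +
      ∑ x, (∑ j, d x j * τ x j) * (-Real.log (∑ i, d x i)) ≤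
    (∑ x, ∑ j, d x j * τ x j) * Real.log K + (1 - ∑ x, ∑ j, d x j * τ x j) * Real.log (Fintype.card J) + 2 := by
  set N : ℝ := (Fintype.card J : ℝ) with hN
  have hN0 : 0 < N := by rw [hN]; exact_mod_cast Fintype.card_pos
  have key : ∀ x j, d x j * (Real.log (∑ i, d x i) - Real.log (d x j)) +
      (d x j * τ x j) * (-Real.log (∑ i, d x i)) ≤ d x j * τ x j * Real.log K +
        (d x j - d x j * τ x j) * Real.log N + (τ x j / K + (∑ i, d x i) / N) := by
    intro x j
    have hpx : 0 ≤ ∑ i, d x i := Finset.sum_nonneg fun i _ => hd x i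
    rcases (hd x j).eq_or_lt with h0 | h0
    · rw [← h0]
      have : 0 ≤ τ x j / K := div_nonneg (hτ0 x j) hK.le
      have : 0 ≤ (∑ i, d x i) / N := div_nonneg hpx hN0.le
      simp; linarith
    · have hpx' : 0 < ∑ i, d x i :=
        h0.trans_le (Finset.single_le_sum (f := d x) (fun i _ => hd x i) (Finset.mem_univ j))
      set p := ∑ i, d x i
      have e1 : d x j * (-Real.log (d x j) - Real.log K) ≤ 1 / K := by
        have := Real.log_le_sub_one_of_pos (x := 1 / (d x j * K)) (by positivity)
        rw [Real.log_div one_ne_zero (by positivity), Real.log_one, Real.log_mul h0.ne' hK.ne'] at this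
        have h2 := mul_le_mul_of_nonneg_left this h0.le
        have : d x j * (1 / (d x j * K) - 1) = 1 / K - d x j := by field_simp
        linarith
      have e2 : d x j * (Real.log p - Real.log (d x j) - Real.log N) ≤ p / N := by
        have := Real.log_le_sub_one_of_pos (x := p / (d x j * N)) (by positivity)
        rw [Real.log_div hpx'.ne' (by positivity), Real.log_mul h0.ne' hN0.ne'] at this
        have h2 := mul_le_mul_of_nonneg_left this h0.le
        have : d x j * (p / (d x j * N) - 1) = p / N - d x j := by field_simp
        linarith
      have f1 := mul_le_mul_of_nonneg_left e1 (hτ0 x j)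
      have f2 := mul_le_mul_of_nonneg_left e2 (sub_nonneg.2 (hτ1 x j))
      have f3 : (1 - τ x j) * (p / N) ≤ p / N :=
        mul_le_of_le_one_left (by positivity) (by linarith [hτ0 x j])
      have f4 : τ x j * (1 / K) = τ x j / K := by ring
      linarith
  have := Finset.sum_le_sum fun x (_ : x ∈ Finset.univ) => Finset.sum_le_sum fun j (_ : j ∈ Finset.univ) => key x j
  simp only [Finset.sum_add_distrib, Finset.sum_sub_distrib, ← Finset.sum_mul, ← Finset.sum_div, Finset.sum_const,
    Finset.card_univ, nsmul_eq_mul, ← Finset.mul_sum, hp] at this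
  have h1 : (∑ x, ∑ j, τ x j) / K ≤ 1 := (div_le_one hK).2 hτK
  have h2 : (Fintype.card J : ℝ) * (1 / N) = 1 := by rw [← hN]; field_simp
  rw [← hN] at this
  have h3 : N * 1 / N = 1 := by field_simp
  have h4 : N * (1 / N) = 1 := by field_simp
  linarith

lemma core2 {X : Type*} [Fintype X] (p s u v : X → ℝ) (hp : ∀ x, p x = u x + v x)
    (hs0 : ∀ x, 0 ≤ s x) (hsp : ∀ x, s x ≤ p x) (hp1 : ∀ x, p x ≤ 1) {c ε : ℝ} (hc : 0 < c) (hc1 : 2 * c ≤ 1)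
    (hu : ∀ x, u x ≤ c) (hv0 : ∀ x, 0 ≤ v x) (hv : 2 * c = 1 ∨ ∑ x, v x ≤ ε) :
    ((∑ x, s x) - 2 * ε) * (-Real.log (2 * c)) ≤ ∑ x, s x * (-Real.log (p x)) := by
  have hL : 0 ≤ -Real.log (2 * c) := by
    have := Real.log_nonpos (x := 2 * c) (by linarith) hc1
    linarith
  rcases hv with hv | hv
  · rw [hv, Real.log_one, neg_zero, mul_zero]
    exact Finset.sum_nonneg fun x _ => mul_nonneg (hs0 x)
      (neg_nonneg.2 (Real.log_nonpos ((hs0 x).trans (hsp x)) (hp1 x)))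
  have key : ∀ x, (s x - 2 * v x) * (-Real.log (2 * c)) ≤ s x * (-Real.log (p x)) := by
    intro x
    have hl : Real.log (p x) ≤ 0 := Real.log_nonpos ((hs0 x).trans (hsp x)) (hp1 x)
    rcases le_or_gt (p x) (2 * c) with h | h
    · rcases (hs0 x).eq_or_lt with h0 | h0
      · rw [← h0]
        have := mul_nonneg (hv0 x) hL
        nlinarith
      · have := Real.log_le_log (h0.trans_le (hsp x)) h
        have h5 := mul_nonneg (hv0 x) hL
        nlinarith
    · have h1 : s x - 2 * v x ≤ 0 := by linarith [hp x, hu x, hsp x]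
      have h2 := mul_nonneg (hs0 x) (neg_nonneg.2 hl)
      have h3 := mul_nonneg (neg_nonneg.2 h1) hL
      linarith
  refine le_trans ?_ (Finset.sum_le_sum fun x _ => key x)
  rw [← Finset.sum_mul, Finset.sum_sub_distrib, ← Finset.mul_sum]
  exact mul_le_mul_of_nonneg_right (by linarith) hL

lemma card_unit {ι κ : Type*} [Fintype ι] [DecidableEq ι] [Fintype κ] [DecidableEq κ]
    {V : Matrix κ ι ℂ} (h : Vᴴ * V = 1 ∧ V * Vᴴ = 1) : Fintype.card κ = Fintype.card ι := by
  have := Matrix.trace_mul_comm V Vᴴ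
  rw [h.1, h.2, Matrix.trace_one, Matrix.trace_one] at this
  exact_mod_cast this

lemma log_K {α β : Type*} [Fintype α] [DecidableEq α] [Fintype β] [DecidableEq β] [Nonempty α] [Nonempty β]
    {n : ℕ} (Pr : Protocol α β n) : Real.log (Pr.dAg * Pr.dBg) =
      n * Real.log (Fintype.card α) + n * Real.log (Fintype.card β) -
        (Real.log (Pr.dAp * Pr.dBp) - Real.log Pr.dC) := by
  have h1 := card_unit Pr.UA_unitary
  have h2 := card_unit Pr.UB_unitary
  simp only [Fintype.card_prod, Fintype.card_fin, Fintype.card_fun] at h1 h2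
  have ha : (Fintype.card α : ℝ) ≠ 0 := by exact_mod_cast Fintype.card_ne_zero
  have hb : (Fintype.card β : ℝ) ≠ 0 := by exact_mod_cast Fintype.card_ne_zero
  have c1 : (Pr.dC : ℝ) ≠ 0 := by exact_mod_cast Pr.dC_pos.ne'
  have c2 : (Pr.dAp : ℝ) ≠ 0 := by exact_mod_cast Pr.dAp_pos.ne'
  have c3 : (Pr.dY : ℝ) ≠ 0 := by exact_mod_cast Pr.dY_pos.ne'
  have c4 : (Pr.dAg : ℝ) ≠ 0 := by exact_mod_cast Pr.dAg_pos.ne'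
  have c5 : (Pr.dBp : ℝ) ≠ 0 := by exact_mod_cast Pr.dBp_pos.ne'
  have c6 : (Pr.dBg : ℝ) ≠ 0 := by exact_mod_cast Pr.dBg_pos.ne'
  have h1' := congrArg (fun m : ℕ => Real.log (m : ℝ)) h1
  have h2' := congrArg (fun m : ℕ => Real.log (m : ℝ)) h2
  simp only [Nat.cast_mul, Nat.cast_pow] at h1' h2'
  rw [Real.log_mul (by positivity) c4, Real.log_mul c2 c3, Real.log_mul (by positivity) c1, Real.log_pow] at h1'
  rw [Real.log_mul c5 c6, Real.log_mul (by positivity) c3, Real.log_pow] at h2'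
  rw [Real.log_mul c4 c6, Real.log_mul c2 c5]
  linarith

/-- weights -/
def ptau {α β : Type*} [Fintype α] [DecidableEq α] [Fintype β] [DecidableEq β] {n : ℕ}
    (Pr : Protocol α β n) (U : (Fin Pr.dAp × Fin Pr.dY) × Fin Pr.dAg → Matrix (Fin n → β) (Fin n → β) ℂ)
    (x : (Fin Pr.dAp × Fin Pr.dY) × Fin Pr.dAg) (j : Fin n → β) : ℝ :=
  if x.1.1 = ⟨0, Pr.dAp_pos⟩ then ∑ bg, ‖∑ b, Pr.UB (⟨0, Pr.dBp_pos⟩, bg) (b, x.1.2) * U x b j‖ ^ 2 else 0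

lemma succP_eq {α β : Type*} [Fintype α] [DecidableEq α] [Fintype β] [DecidableEq β]
    (ρ : Matrix (α × β) (α × β) ℂ) {n : ℕ} (Pr : Protocol α β n)
    (U : (Fin Pr.dAp × Fin Pr.dY) × Fin Pr.dAg → Matrix (Fin n → β) (Fin n → β) ℂ)
    (d : (Fin Pr.dAp × Fin Pr.dY) × Fin Pr.dAg → (Fin n → β) → ℝ)
    (h : ∀ x, Dg (red (rk (pvec Pr x)) (tpowAB ρ n)) (U x) (d x)) :
    succP ρ Pr = ∑ x, ∑ j, d x j * ptau Pr U x j := by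
  have e : ∀ ag bg y, ∑ b, ∑ b',
      Pr.UB (⟨0, Pr.dBp_pos⟩, bg) (b, y) * red (rk (pvec Pr ((⟨0, Pr.dAp_pos⟩, y), ag))) (tpowAB ρ n) b b' *
        star (Pr.UB (⟨0, Pr.dBp_pos⟩, bg) (b', y)) = ((∑ j, d ((⟨0, Pr.dAp_pos⟩, y), ag) j *
          ‖∑ b, Pr.UB (⟨0, Pr.dBp_pos⟩, bg) (b, y) * U ((⟨0, Pr.dAp_pos⟩, y), ag) b j‖ ^ 2 : ℝ) : ℂ) := by
    intro ag bg y
    have := qf_dgC (h ((⟨0, Pr.dAp_pos⟩, y), ag)) fun b => star (Pr.UB (⟨0, Pr.dBp_pos⟩, bg) (b, y))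
    simp only [star_star] at this
    rw [this]
    congr 1
    refine Finset.sum_congr rfl fun j _ => ?_
    rw [← norm_star]
    simp only [star_sum, star_mul', star_star, mul_comm]
  rw [succP, output_apply]
  simp only [e, ← Complex.ofReal_sum, Complex.ofReal_re]
  simp only [Fintype.sum_prod_type, ptau, mul_ite, mul_zero]
  rw [Finset.sum_eq_single (⟨0, Pr.dAp_pos⟩ : Fin Pr.dAp)]
  · simp only [if_true, Finset.mul_sum]
    rw [Finset.sum_congr rfl fun ag _ => Finset.sum_comm, Finset.sum_comm]
    refine Finset.sum_congr rfl fun y _ => Finset.sum_congr rfl fun ag _ => Finset.sum_comm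
  · intro b _ hb
    simp [hb]
  · simp

lemma ptau_nonneg {α β : Type*} [Fintype α] [DecidableEq α] [Fintype β] [DecidableEq β] {n : ℕ}
    (Pr : Protocol α β n) (U : (Fin Pr.dAp × Fin Pr.dY) × Fin Pr.dAg → Matrix (Fin n → β) (Fin n → β) ℂ)
    (x : (Fin Pr.dAp × Fin Pr.dY) × Fin Pr.dAg) (j : Fin n → β) : 0 ≤ ptau Pr U x j := by
  rw [ptau]; split_ifs
  · positivity
  · exact le_rfl

lemma ptau_le_one {α β : Type*} [Fintype α] [DecidableEq α] [Fintype β] [DecidableEq β] {n : ℕ}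
    (Pr : Protocol α β n) (U : (Fin Pr.dAp × Fin Pr.dY) × Fin Pr.dAg → Matrix (Fin n → β) (Fin n → β) ℂ)
    (hU : ∀ x, (U x)ᴴ * U x = 1)
    (x : (Fin Pr.dAp × Fin Pr.dY) × Fin Pr.dAg) (j : Fin n → β) : ptau Pr U x j ≤ 1 := by
  rw [ptau]; split_ifs
  · have h1 := iso_norm Pr.UB_unitary.1 (fun q : (Fin n → β) × Fin Pr.dY => if q.2 = x.1.2 then U x q.1 j else 0)
    have h2 : ∑ b, ‖U x b j‖ ^ 2 = 1 := by
      have := unit_row (U := (U x)ᴴ) (by rw [conjTranspose_conjTranspose]; exact hU x) j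
      simpa using this
    have h3 : ∑ i : (Fin n → β) × Fin Pr.dY, ‖(if i.2 = x.1.2 then U x i.1 j else 0)‖ ^ 2 = 1 := by
      rw [← h2, Fintype.sum_prod_type]
      refine Finset.sum_congr rfl fun b _ => ?_
      rw [Finset.sum_eq_single x.1.2] <;> simp +contextual
    rw [h3] at h1
    rw [← h1, Fintype.sum_prod_type]
    refine le_trans (le_of_eq ?_) (Finset.single_le_sum (fun i _ => by positivity) (Finset.mem_univ (⟨0, Pr.dBp_pos⟩ : Fin Pr.dBp)))
    refine Finset.sum_congr rfl fun bg _ => ?_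
    congr 2
    rw [Fintype.sum_prod_type]
    refine Finset.sum_congr rfl fun b _ => ?_
    simp
  · exact zero_le_one

lemma ptau_sum {α β : Type*} [Fintype α] [DecidableEq α] [Fintype β] [DecidableEq β] {n : ℕ}
    (Pr : Protocol α β n) (U : (Fin Pr.dAp × Fin Pr.dY) × Fin Pr.dAg → Matrix (Fin n → β) (Fin n → β) ℂ)
    (hU : ∀ x, U x * (U x)ᴴ = 1) : ∑ x, ∑ j, ptau Pr U x j ≤ Pr.dAg * Pr.dBg := by
  refine le_of_eq ?_
  have e : ∀ x (r : (Fin n → β) → ℂ), ∑ j, ‖∑ b, r b * U x b j‖ ^ 2 = ∑ b, ‖r b‖ ^ 2 := by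
    intro x r
    rw [← iso_norm (V := (U x)ᵀ) ?_ r]
    · simp [mul_comm]
    · rw [← Matrix.transpose_one, ← hU x, Matrix.transpose_mul]
      rfl
  simp only [Fintype.sum_prod_type, ptau]
  rw [Finset.sum_eq_single (⟨0, Pr.dAp_pos⟩ : Fin Pr.dAp)]
  · simp only [if_true]
    rw [Finset.sum_congr rfl fun y _ => Finset.sum_congr rfl fun ag _ => Finset.sum_comm]
    simp only [e]
    rw [Finset.sum_congr rfl fun y _ => Finset.sum_comm]
    rw [Finset.sum_comm]
    have e2 : ∀ bg, ∑ y, ∑ b, ‖Pr.UB (⟨0, Pr.dBp_pos⟩, bg) (b, y)‖ ^ 2 = 1 := by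
      intro bg
      rw [Finset.sum_comm, ← Fintype.sum_prod_type (f := fun q => ‖Pr.UB (⟨0, Pr.dBp_pos⟩, bg) q‖ ^ 2)]
      have := congrFun (congrFun Pr.UB_unitary.2 (⟨0, Pr.dBp_pos⟩, bg)) (⟨0, Pr.dBp_pos⟩, bg)
      simp only [Matrix.mul_apply, conjTranspose_apply, Matrix.one_apply_eq, ← nsq] at this
      exact_mod_cast this
    rw [Finset.sum_congr rfl fun bg _ => Finset.sum_comm]
    simp only [e2]
    simp [mul_comm]
  · intro b _ hb
    simp [hb]
  · simp

lemma pvec_complete {α β : Type*} [Fintype α] [DecidableEq α] [Fintype β] [DecidableEq β] {n : ℕ}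
    (Pr : Protocol α β n) : ∑ x, rk (pvec Pr x) = 1 := by
  ext a a'
  have := congrFun (congrFun Pr.UA_unitary.1 (a, ⟨0, Pr.dC_pos⟩)) (a', ⟨0, Pr.dC_pos⟩)
  simp only [Matrix.mul_apply, conjTranspose_apply, Matrix.one_apply, Prod.mk.injEq, and_true] at this
  rw [Matrix.one_apply, ← this]
  simp [Matrix.sum_apply, rk, vecMulVec_apply, pvec]

lemma pvec_norm {α β : Type*} [Fintype α] [DecidableEq α] [Fintype β] [DecidableEq β] {n : ℕ}
    (Pr : Protocol α β n) (x) : ∑ a, ‖pvec Pr x a‖ ^ 2 ≤ 1 := by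
  have := congrFun (congrFun Pr.UA_unitary.2 x) x
  simp only [Matrix.mul_apply, conjTranspose_apply, Matrix.one_apply_eq, ← nsq] at this
  have : ∑ q, ‖Pr.UA x q‖ ^ 2 = 1 := by exact_mod_cast this
  rw [← this, Fintype.sum_prod_type]
  refine Finset.sum_le_sum fun a _ => ?_
  simp only [pvec, norm_star]
  exact Finset.single_le_sum (f := fun c => ‖Pr.UA x (a, c)‖ ^ 2) (fun i _ => by positivity) (Finset.mem_univ _)

lemma converse_one {α β : Type*} [Fintype α] [DecidableEq α] [Fintype β] [DecidableEq β] [Nonempty α] [Nonempty β]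
    {ρ : Matrix (α × β) (α × β) ℂ} (h : IsDensity ρ) {n : ℕ} (Pr : Protocol α β n) {ε c : ℝ}
    (hε : protocolError ρ Pr ≤ ε) {W : Matrix (Fin n → α) (Fin n → α) ℂ} {l : (Fin n → α) → ℝ}
    (hW : Dg (ptraceRight (tpowAB ρ n)) W l) (hc : 0 < c) (hc1 : 2 * c ≤ 1)
    (hl : 2 * c = 1 ∨ ∑ j, (if c < l j then l j else 0) ≤ ε) :
    Cn ρ n + (1 - 3 * ε) * (-Real.log (2 * c)) ≤
      n * Real.log (Fintype.card α) + n * Real.log (Fintype.card β) -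
        (Real.log (Pr.dAp * Pr.dBp) - Real.log Pr.dC) + ε * (n * Real.log (Fintype.card β)) + 2 := by
  have hd := tpowAB_density h n
  have hl0 : ∀ j, 0 ≤ l j := hW.nonneg (ptraceRight_density hd).1
  choose U d hU hd0 using fun x => psd_dg (red_rk_psd hd.1 (pvec Pr x))
  have hF := succP_eq ρ Pr U d hU
  have hp : ∀ x, ∑ j, d x j = qf (ptraceRight (tpowAB ρ n)) (pvec Pr x) := fun x => by
    rw [← (hU x).rtr_eq, rtr_red]
  have hsum : ∑ x, ∑ j, d x j = 1 := by
    have := sum_rtr_red (ρ := tpowAB ρ n) hd.2 (w := pvec Pr) (pvec_complete Pr)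
    rw [← this]
    exact Finset.sum_congr rfl fun x _ => (hU x).rtr_eq.symm
  have hK : (0:ℝ) < Pr.dAg * Pr.dBg := by
    have := Pr.dAg_pos; have := Pr.dBg_pos; positivity
  have hK1 : (1:ℝ) ≤ Pr.dAg * Pr.dBg := by
    exact_mod_cast Nat.mul_pos Pr.dAg_pos Pr.dBg_pos
  have τ1 := ptau_le_one Pr U fun x => (hU x).1
  have τ0 := ptau_nonneg Pr U
  have c1 := core1 d (ptau Pr U) hd0 τ0 τ1 hsum hK (ptau_sum Pr U fun x => (hU x).2.1)
  have c2 := core2 (fun x => ∑ j, d x j) (fun x => ∑ j, d x j * ptau Pr U x j)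
    (fun x => ∑ j, (if c < l j then 0 else l j * ‖∑ a, star (W a j) * pvec Pr x a‖ ^ 2))
    (fun x => ∑ j, (if c < l j then l j * ‖∑ a, star (W a j) * pvec Pr x a‖ ^ 2 else 0))
    (c := c) (ε := ε) ?_ ?_ ?_ ?_ hc hc1 ?_ ?_ ?_
  · rw [← hF] at c1 c2
    have hCn : Cn ρ n ≤ ∑ x, ∑ j, d x j * (Real.log (∑ i, d x i) - Real.log (d x j)) := by
      refine (Cn_le h (Val.of _ (pvec Pr) (pvec_complete Pr))).trans (le_of_eq ?_)
      exact Finset.sum_congr rfl fun x _ => (hU x).gent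
    have hF1 : 1 - ε ≤ succP ρ Pr := by linarith [succP_ge h Pr]
    have hF2 : succP ρ Pr ≤ 1 := by
      rw [hF, ← hsum]
      exact Finset.sum_le_sum fun x _ => Finset.sum_le_sum fun j _ => mul_le_of_le_one_right (hd0 x j) (τ1 x j)
    have hb : Real.log (Fintype.card (Fin n → β)) = n * Real.log (Fintype.card β) := by
      rw [Fintype.card_fun]; simp
    have hb0 : 0 ≤ n * Real.log (Fintype.card β) := by
      rw [← hb]; exact Real.log_nonneg (by exact_mod_cast Fintype.card_pos)
    have hL : 0 ≤ -Real.log (2 * c) := by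
      have := Real.log_nonpos (x := 2 * c) (by linarith) hc1
      linarith
    have hlK : 0 ≤ Real.log (Pr.dAg * Pr.dBg) := Real.log_nonneg hK1
    rw [hb] at c1
    have e1 : (1 - 3 * ε) * (-Real.log (2 * c)) ≤ (succP ρ Pr - 2 * ε) * (-Real.log (2 * c)) :=
      mul_le_mul_of_nonneg_right (by linarith) hL
    have e2 : succP ρ Pr * Real.log (Pr.dAg * Pr.dBg) ≤ Real.log (Pr.dAg * Pr.dBg) :=
      mul_le_of_le_one_left hlK hF2
    have e3 : (1 - succP ρ Pr) * (n * Real.log (Fintype.card β)) ≤ ε * (n * Real.log (Fintype.card β)) :=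
      mul_le_mul_of_nonneg_right (by linarith) hb0
    rw [← log_K Pr]
    linarith
  · intro x
    simp only [hp, qf_dg hW]
    rw [← Finset.sum_add_distrib]
    refine Finset.sum_congr rfl fun j _ => ?_
    split_ifs <;> simp
  · exact fun x => Finset.sum_nonneg fun j _ => mul_nonneg (hd0 x j) (τ0 x j)
  · exact fun x => Finset.sum_le_sum fun j _ => mul_le_of_le_one_right (hd0 x j) (τ1 x j)
  · intro x
    rw [← hsum]
    exact Finset.single_le_sum (f := fun x => ∑ j, d x j) (fun x _ => Finset.sum_nonneg fun j _ => hd0 x j) (Finset.mem_univ x)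
  · intro x
    have h1 : ∑ j, ‖∑ a, star (W a j) * pvec Pr x a‖ ^ 2 ≤ 1 := by
      have := iso_norm (V := Wᴴ) (by rw [conjTranspose_conjTranspose]; exact hW.2.1) (pvec Pr x)
      simp only [conjTranspose_apply] at this
      rw [this]; exact pvec_norm Pr x
    calc _ ≤ ∑ j, c * ‖∑ a, star (W a j) * pvec Pr x a‖ ^ 2 := by
          refine Finset.sum_le_sum fun j _ => ?_
          split_ifs with hh
          · positivity
          · exact mul_le_mul_of_nonneg_right (not_lt.1 hh) (by positivity)
      _ = c * ∑ j, ‖∑ a, star (W a j) * pvec Pr x a‖ ^ 2 := by rw [Finset.mul_sum]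
      _ ≤ c := mul_le_of_le_one_right hc.le h1
  · intro x
    refine Finset.sum_nonneg fun j _ => ?_
    split_ifs
    · exact mul_nonneg (hl0 j) (by positivity)
    · exact le_rfl
  · refine hl.imp id fun hl => ?_
    rw [Finset.sum_comm]
    refine le_trans (le_of_eq ?_) hl
    refine Finset.sum_congr rfl fun j _ => ?_
    split_ifs with hh
    · rw [← Finset.mul_sum, complete_norm (pvec_complete Pr) (fun a => W a j)]
      have := unit_row (U := Wᴴ) (by rw [conjTranspose_conjTranspose]; exact hW.1) j
      simp only [conjTranspose_apply, norm_star] at this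
      rw [this, mul_one]
    · simp

lemma typ_hi {Ω : Type*} [Fintype Ω] (P : Ω → ℝ) (hP : ∀ ω, 0 ≤ P ω) (hs : ∑ ω, P ω = 1)
    {δ : ℝ} (hδ : 0 < δ) : ∃ c : ℝ, 0 ≤ c ∧ c < 1 ∧ ∀ k : ℕ,
      ∑ x : Fin k → Ω, (if Real.exp (-(k * ((∑ ω, Real.negMulLog (P ω)) - δ))) < ∏ i, P (x i)
        then ∏ i, P (x i) else 0) ≤ c ^ k := by
  obtain ⟨c, h0, h1, h⟩ := chernoff P (fun ω => Real.log (P ω)) hP hs hδ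
  refine ⟨c, h0, h1, fun k => le_trans (Finset.sum_le_sum fun x _ => ?_) (h k)⟩
  have hp : 0 ≤ ∏ i, P (x i) := Finset.prod_nonneg fun i _ => hP _
  split_ifs with a b b
  · exact le_rfl
  · exfalso
    apply b
    have hpos := (Real.exp_pos _).trans a
    have := Real.log_lt_log (Real.exp_pos _) a
    rw [Real.log_exp, Real.log_prod fun i hi => (Finset.prod_ne_zero_iff.1 hpos.ne' i hi)] at this
    refine lt_of_eq_of_lt ?_ this
    simp only [Real.negMulLog, neg_mul, Finset.sum_neg_distrib]
    ring
  · exact hp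
  · exact le_rfl

lemma typ_lo {Ω : Type*} [Fintype Ω] (P : Ω → ℝ) (hP : ∀ ω, 0 ≤ P ω) (hs : ∑ ω, P ω = 1)
    {δ : ℝ} (hδ : 0 < δ) : ∃ c : ℝ, 0 ≤ c ∧ c < 1 ∧ ∀ k : ℕ,
      ∑ x : Fin k → Ω, (if ∏ i, P (x i) < Real.exp (-(k * ((∑ ω, Real.negMulLog (P ω)) + δ)))
        then ∏ i, P (x i) else 0) ≤ c ^ k := by
  obtain ⟨c, h0, h1, h⟩ := chernoff P (fun ω => -Real.log (P ω)) hP hs hδ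
  refine ⟨c, h0, h1, fun k => le_trans (Finset.sum_le_sum fun x _ => ?_) (h k)⟩
  have hp : 0 ≤ ∏ i, P (x i) := Finset.prod_nonneg fun i _ => hP _
  rcases hp.eq_or_lt with h0 | hpos
  · rw [← h0]; simp
  split_ifs with a b b
  · exact le_rfl
  · exfalso
    apply b
    have := Real.log_lt_log hpos a
    rw [Real.log_exp, Real.log_prod fun i hi => (Finset.prod_ne_zero_iff.1 hpos.ne' i hi)] at this
    rw [Finset.sum_neg_distrib]
    refine lt_of_eq_of_lt ?_ (neg_lt_neg this)
    simp only [Real.negMulLog, neg_mul, mul_neg]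
    ring
  · exact hp
  · exact le_rfl

lemma density_nonempty {α β : Type*} [Fintype α] [Fintype β]
    {ρ : Matrix (α × β) (α × β) ℂ} (h : IsDensity ρ) : Nonempty α ∧ Nonempty β := by
  by_contra hh
  have : IsEmpty (α × β) := by
    rw [isEmpty_prod]
    by_contra h3
    rw [not_or, not_isEmpty_iff, not_isEmpty_iff] at h3
    exact hh h3
  have h2 := h.2
  rw [Matrix.trace, Finset.univ_eq_empty, Finset.sum_empty] at h2
  exact zero_ne_one h2

lemma Dg.sum_one {ι : Type*} [Fintype ι] [DecidableEq ι] {M U : Matrix ι ι ℂ} {d : ι → ℝ}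
    (h : Dg M U d) (hM : M.trace = 1) : ∑ i, d i = 1 := by
  rw [← h.rtr_eq, rtr, hM, Complex.one_re]

lemma entropy_nonneg {ι : Type*} [Fintype ι] [DecidableEq ι] {M : Matrix ι ι ℂ} (h : IsDensity M) :
    0 ≤ entropy M := by
  obtain ⟨W, l, hW, hl⟩ := psd_dg h.1
  rw [hW.entropy]
  refine Finset.sum_nonneg fun i _ => Real.negMulLog_nonneg (hl i) ?_
  rw [← hW.sum_one h.2]
  exact Finset.single_le_sum (fun i _ => hl i) (Finset.mem_univ i)

lemma converse {α β : Type*} [Fintype α] [DecidableEq α] [Fintype β] [DecidableEq β]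
    {ρ : Matrix (α × β) (α × β) ℂ} (h : IsDensity ρ) {C P R : ℝ}
    (hC : Tendsto (fun n : ℕ => Cn ρ n / n) atTop (nhds C)) (hA : Achievable ρ P R) :
    P ≤ Real.log (Fintype.card α) + Real.log (Fintype.card β) - entropy (ptraceRight ρ) - C := by
  obtain ⟨_, _⟩ := density_nonempty h
  have hdA := ptraceRight_density h
  set H := entropy (ptraceRight ρ) with hH
  have hH0 : 0 ≤ H := entropy_nonneg hdA
  obtain ⟨W, l, hW, hl⟩ := psd_dg hdA.1
  have hl1 := hW.sum_one hdA.2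
  -- it suffices to prove an approximate version
  have main : ∀ ε : ℝ, 0 < ε → 3 * ε < 1 → P - ε ≤ Real.log (Fintype.card α) + Real.log (Fintype.card β)
      + ε * Real.log (Fintype.card β) - C - (1 - 3 * ε) * (H - ε) := by
    intro ε hε hε1
    obtain ⟨c, hc0, hc1, hc⟩ := typ_hi l hl hl1 hε
    obtain ⟨N, hN⟩ := hA ε hε ε hε
    have hlim : Tendsto (fun n : ℕ => Real.log (Fintype.card α) + Real.log (Fintype.card β)
      + ε * Real.log (Fintype.card β) - Cn ρ n / n - (1 - 3 * ε) * (H - ε) + (2 + Real.log 2) / (n : ℝ)) atTop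
        (nhds (Real.log (Fintype.card α) + Real.log (Fintype.card β)
      + ε * Real.log (Fintype.card β) - C - (1 - 3 * ε) * (H - ε) + 0)) :=
      ((tendsto_const_nhds.sub hC).sub tendsto_const_nhds).add (tendsto_const_div_atTop_nhds_zero_nat _)
    rw [add_zero] at hlim
    refine ge_of_tendsto hlim ?_
    have ev1 : ∀ᶠ n : ℕ in atTop, c ^ n ≤ ε :=
      ((tendsto_pow_atTop_nhds_zero_of_lt_one hc0 hc1).eventually_lt_const hε).mono fun _ h => h.le
    filter_upwards [ev1, eventually_ge_atTop N, eventually_gt_atTop 0] with n h1 h2 h3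
    obtain ⟨Pr, _, hP, hE⟩ := hN n h2
    have hn : (0:ℝ) < n := by exact_mod_cast h3
    rw [purityRate, le_div_iff₀ hn] at hP
    have hWn : Dg (ptraceRight (tpowAB ρ n)) (tpow W n) (fun x : Fin n → α => ∏ i, l (x i)) := by
      rw [ptraceRight_tpowAB]; exact hW.tpow n
    have hHe : ∑ ω, Real.negMulLog (l ω) = H := hW.entropy.symm
    rw [hHe] at hc
    set c' := Real.exp (-(n * (H - ε)))
    have hc' : Real.log (2 * c') = Real.log 2 - n * (H - ε) := by
      rw [Real.log_mul two_ne_zero (Real.exp_pos _).ne', Real.log_exp]; ring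
    have hlogs : ∀ x : ℕ, 0 ≤ Real.log x := fun x => Real.log_natCast_nonneg x
    have hcn : 0 ≤ Cn ρ n := Cn_nonneg h n
    have hfin : Cn ρ n + (1 - 3 * ε) * (n * (H - ε) - Real.log 2) ≤
      n * Real.log (Fintype.card α) + n * Real.log (Fintype.card β) -
        (Real.log (Pr.dAp * Pr.dBp) - Real.log Pr.dC) + ε * (n * Real.log (Fintype.card β)) + 2 := by
      rcases le_or_gt (2 * c') 1 with hcc | hcc
      · have := converse_one h Pr hE hWn (Real.exp_pos _) hcc (Or.inr ((hc n).trans h1))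
        rw [hc'] at this
        rw [← neg_sub (Real.log 2)]
        exact this
      · have := converse_one h Pr hE hWn (c := 2⁻¹) (by norm_num) (by norm_num) (Or.inl (by norm_num))
        rw [mul_inv_cancel₀ two_ne_zero, Real.log_one, neg_zero, mul_zero] at this
        have h6 := Real.log_pos hcc
        rw [hc'] at h6
        have : (1 - 3 * ε) * (n * (H - ε) - Real.log 2) ≤ 0 :=
          mul_nonpos_of_nonneg_of_nonpos (by linarith) (by linarith)
        linarith
    have e1 : 3 * ε * Real.log 2 ≥ 0 := by have := Real.log_nonneg (x := 2) (by norm_num); positivity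
    have key : n * (P - ε) ≤ n * (Real.log (Fintype.card α) + Real.log (Fintype.card β)
      + ε * Real.log (Fintype.card β) - Cn ρ n / n - (1 - 3 * ε) * (H - ε) + (2 + Real.log 2) / (n : ℝ)) := by
      have : (n : ℝ) * (Cn ρ n / n) = Cn ρ n := by field_simp
      have h5 : (n : ℝ) * ((2 + Real.log 2) / n) = 2 + Real.log 2 := by field_simp
      linarith
    exact le_of_mul_le_mul_left key hn
  have hlim : Tendsto (fun ε : ℝ => Real.log (Fintype.card α) + Real.log (Fintype.card β)
      + ε * Real.log (Fintype.card β) - C - (1 - 3 * ε) * (H - ε) + ε) (nhdsWithin 0 (Set.Ioi 0)) (nhds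
      (Real.log (Fintype.card α) + Real.log (Fintype.card β)
      + 0 * Real.log (Fintype.card β) - C - (1 - 3 * 0) * (H - 0) + 0)) := by
    refine Tendsto.mono_left (Continuous.tendsto ?_ 0) nhdsWithin_le_nhds
    fun_prop
  have : P ≤ Real.log (Fintype.card α) + Real.log (Fintype.card β)
      + 0 * Real.log (Fintype.card β) - C - (1 - 3 * 0) * (H - 0) + 0 := by
    refine ge_of_tendsto hlim ?_
    filter_upwards [Ioo_mem_nhdsGT (show (0:ℝ) < 1/3 by norm_num)] with ε hε
    have := main ε hε.1 (by linarith [hε.2])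
    linarith
  linarith

lemma qf_tr {A : Type*} [Fintype A] (M : Matrix A A ℂ) (w : A → ℂ) :
    qf M w = (rk w * M).trace.re := by
  rw [qf, Matrix.trace]
  simp only [Matrix.diag_apply, Matrix.mul_apply, rk, vecMulVec_apply, Pi.star_apply]
  rw [Finset.sum_comm]
  congr 1
  refine Finset.sum_congr rfl fun j _ => Finset.sum_congr rfl fun a _ => ?_
  ring

lemma rk_mulVec {A : Type*} [Fintype A] (T : Matrix A A ℂ) (w : A → ℂ) :
    rk (T *ᵥ w) = T * rk w * Tᴴ := by
  rw [rk, rk, Matrix.mul_vecMulVec, Matrix.vecMulVec_mul, Matrix.star_mulVec]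

lemma rk_smul {A : Type*} (c : ℝ) (w : A → ℂ) : rk ((c : ℂ) • w) = ((c ^ 2 : ℝ) : ℂ) • rk w := by
  ext a b
  simp [rk, vecMulVec_apply]; ring

lemma qf_smul {A : Type*} [Fintype A] (M : Matrix A A ℂ) (c : ℝ) (w : A → ℂ) :
    qf M ((c : ℂ) • w) = c ^ 2 * qf M w := by
  rw [qf_tr, qf_tr, rk_smul, Matrix.smul_mul, Matrix.trace_smul, smul_eq_mul, Complex.re_ofReal_mul]

lemma qf_nonneg {A : Type*} [Fintype A] [DecidableEq A] {M : Matrix A A ℂ} (h : M.PosSemidef) (w : A → ℂ) :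
    0 ≤ qf M w := by
  obtain ⟨U, d, hU, hd⟩ := psd_dg h
  rw [qf_dg hU]
  exact Finset.sum_nonneg fun j _ => mul_nonneg (hd j) (by positivity)

lemma qf_add_le {A : Type*} [Fintype A] [DecidableEq A] {M : Matrix A A ℂ} (h : M.PosSemidef) (u v : A → ℂ) :
    qf M (u + v) ≤ 2 * qf M u + 2 * qf M v := by
  obtain ⟨U, d, hU, hd⟩ := psd_dg h
  rw [qf_dg hU, qf_dg hU, qf_dg hU, Finset.mul_sum, Finset.mul_sum, ← Finset.sum_add_distrib]
  refine Finset.sum_le_sum fun j _ => ?_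
  have : ∑ a, star (U a j) * (u + v) a = (∑ a, star (U a j) * u a) + ∑ a, star (U a j) * v a := by
    rw [← Finset.sum_add_distrib]; exact Finset.sum_congr rfl fun a _ => by rw [Pi.add_apply]; ring
  rw [this]
  have h1 := norm_add_le (∑ a, star (U a j) * u a) (∑ a, star (U a j) * v a)
  have h2 : ‖(∑ a, star (U a j) * u a) + ∑ a, star (U a j) * v a‖ ^ 2 ≤
      2 * ‖∑ a, star (U a j) * u a‖ ^ 2 + 2 * ‖∑ a, star (U a j) * v a‖ ^ 2 := by
    have := norm_nonneg ((∑ a, star (U a j) * u a) + ∑ a, star (U a j) * v a)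
    nlinarith [sq_nonneg (‖∑ a, star (U a j) * u a‖ - ‖∑ a, star (U a j) * v a‖)]
  nlinarith [hd j]

lemma sum_qf {A Y : Type*} [Fintype A] [Fintype Y] (M : Matrix A A ℂ) (u : Y → A → ℂ) :
    ∑ y, qf M (u y) = ((∑ y, rk (u y)) * M).trace.re := by
  simp only [qf_tr]
  rw [← Complex.re_sum, ← Matrix.trace_sum, Finset.sum_mul]

lemma qt_diag {A : Type*} [Fintype A] [DecidableEq A] (M O : Matrix A A ℂ) (k : A → ℝ) :
    ((O * diagonal (fun i => (k i : ℂ)) * Oᴴ) * M).trace.re = ∑ j, k j * qf M (fun a => O a j) := by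
  have : O * diagonal (fun i => (k i : ℂ)) * Oᴴ = ∑ j, ((k j : ℝ) : ℂ) • rk (fun a => O a j) := by
    ext a b
    rw [Matrix.mul_apply]
    simp only [Matrix.mul_diagonal, Matrix.sum_apply, Matrix.smul_apply, rk, vecMulVec_apply, conjTranspose_apply,
      Pi.star_apply, smul_eq_mul]
    exact Finset.sum_congr rfl fun j _ => by ring
  rw [this, Finset.sum_mul, Matrix.trace_sum, Complex.re_sum]
  refine Finset.sum_congr rfl fun j _ => ?_
  rw [qf_tr, Matrix.smul_mul, Matrix.trace_smul, smul_eq_mul, Complex.re_ofReal_mul]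

/-- derandomized sampling -/
lemma greedy {E X : Type*} [NormedAddCommGroup E] [InnerProductSpace ℂ E] [Fintype X]
    (q f : X → ℝ) (z : X → E) (hq : ∀ x, 0 ≤ q x) (hq1 : ∑ x, q x = 1) (hz : ∑ x, (q x : ℂ) • z x = 0)
    (N : ℕ) : ∃ t : Fin N → X, ‖∑ i, z (t i)‖ ^ 2 + ∑ i, f (t i) ≤
      N * (∑ x, q x * (‖z x‖ ^ 2 + f x)) := by
  induction N with
  | zero => exact ⟨Fin.elim0, by simp⟩
  | succ N ih =>
    obtain ⟨t, ht⟩ := ih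
    set s := ∑ i, z (t i)
    have hmean : ∑ x, q x * (‖s + z x‖ ^ 2 + f x) = ‖s‖ ^ 2 + ∑ x, q x * (‖z x‖ ^ 2 + f x) := by
      have h1 : ∀ x, q x * (‖s + z x‖ ^ 2 + f x) = q x * ‖s‖ ^ 2 + 2 * (inner ℂ s ((q x : ℂ) • z x)).re
          + q x * (‖z x‖ ^ 2 + f x) := by
        intro x
        rw [norm_add_sq (𝕜 := ℂ), inner_smul_right, Complex.re_ofReal_mul]
        simp only [RCLike.re_to_complex]
        ring
      simp only [h1, Finset.sum_add_distrib, ← Finset.sum_mul, hq1, ← Finset.mul_sum, ← Complex.re_sum,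
        ← inner_sum, hz, inner_zero_right]
      simp
    obtain ⟨x, hx⟩ : ∃ x, ‖s + z x‖ ^ 2 + f x ≤ ‖s‖ ^ 2 + ∑ x, q x * (‖z x‖ ^ 2 + f x) := by
      by_contra hcon
      push Not at hcon
      have : ∑ x, q x * (‖s‖ ^ 2 + ∑ x, q x * (‖z x‖ ^ 2 + f x)) < ∑ x, q x * (‖s + z x‖ ^ 2 + f x) := by
        refine Finset.sum_lt_sum (fun x _ => mul_le_mul_of_nonneg_left (hcon x).le (hq x)) ?_
        by_contra h0
        push Not at h0
        have : ∀ x, q x = 0 := fun x => by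
          by_contra hne
          have := h0 x (Finset.mem_univ x)
          have := le_of_mul_le_mul_left this (lt_of_le_of_ne (hq x) (Ne.symm hne))
          exact absurd this (not_le.2 (hcon x))
        simp [this] at hq1
      rw [hmean, ← Finset.sum_mul, hq1, one_mul] at this
      exact lt_irrefl _ this
    refine ⟨Fin.snoc t x, ?_⟩
    simp only [Fin.sum_univ_castSucc, Fin.snoc_castSucc, Fin.snoc_last]
    push_cast
    linarith

def od {A : Type*} [Fintype A] [DecidableEq A] (O : Matrix A A ℂ) (k : A → ℝ) : Matrix A A ℂ :=
  O * diagonal (fun i => (k i : ℂ)) * Oᴴ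

lemma od_mul {A : Type*} [Fintype A] [DecidableEq A] {O : Matrix A A ℂ} (h : Oᴴ * O = 1) (k l : A → ℝ) :
    od O k * od O l = od O (fun i => k i * l i) := by
  have : od O k * od O l = O * diagonal (fun i => (k i : ℂ)) * (Oᴴ * O) * diagonal (fun i => (l i : ℂ)) * Oᴴ := by
    simp only [od, Matrix.mul_assoc]
  rw [this, h, Matrix.mul_one, Matrix.mul_assoc O, Matrix.diagonal_mul_diagonal]
  simp [od]

lemma od_sub {A : Type*} [Fintype A] [DecidableEq A] {O : Matrix A A ℂ} (k l : A → ℝ) :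
    od O k - od O l = od O (fun i => k i - l i) := by
  simp only [od, ← Matrix.sub_mul, ← Matrix.mul_sub, Matrix.diagonal_sub, Complex.ofReal_sub]

lemma od_add {A : Type*} [Fintype A] [DecidableEq A] {O : Matrix A A ℂ} (k l : A → ℝ) :
    od O k + od O l = od O (fun i => k i + l i) := by
  simp only [od, ← Matrix.add_mul, ← Matrix.mul_add, Matrix.diagonal_add, Complex.ofReal_add]

lemma od_one {A : Type*} [Fintype A] [DecidableEq A] {O : Matrix A A ℂ} (h : O * Oᴴ = 1) :
    od O (fun _ => 1) = 1 := by
  simp [od, h]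

lemma od_ct {A : Type*} [Fintype A] [DecidableEq A] {O : Matrix A A ℂ} (k : A → ℝ) :
    (od O k)ᴴ = od O k := by
  rw [od, conjTranspose_mul, conjTranspose_mul, conjTranspose_conjTranspose, diagonal_conjTranspose, Matrix.mul_assoc]
  congr 3
  ext i; simp

lemma od_sum {A : Type*} [Fintype A] [DecidableEq A] (O : Matrix A A ℂ) (k : A → ℝ) :
    ∑ j, rk (((k j : ℝ) : ℂ) • fun a => O a j) = od O (fun j => k j ^ 2) := by
  ext a b
  rw [od, Matrix.mul_apply]
  simp only [Matrix.mul_diagonal, Matrix.sum_apply, rk, vecMulVec_apply, conjTranspose_apply,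
      Pi.star_apply, smul_eq_mul, Pi.smul_apply, star_mul']
  exact Finset.sum_congr rfl fun j _ => by simp; ring

/-- weighted Hilbert–Schmidt embedding -/
def zE {A : Type*} [Fintype A] (R : Matrix A A ℂ) : Matrix A A ℂ →ₗ[ℂ] EuclideanSpace ℂ (A × A) where
  toFun Z := WithLp.toLp 2 (fun p => (Z * R) p.1 p.2)
  map_add' := by intro Z Z'; ext p; simp [Matrix.add_mul]
  map_smul' := by intro c Z; ext p; simp

lemma zE_norm {A : Type*} [Fintype A] (R Z : Matrix A A ℂ) :
    ‖zE R Z‖ ^ 2 = ((Zᴴ * Z) * (R * Rᴴ)).trace.re := by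
  rw [EuclideanSpace.norm_sq_eq]
  have h1 : ((Zᴴ * Z) * (R * Rᴴ)).trace = ((Z * R) * (Z * R)ᴴ).trace := by
    rw [conjTranspose_mul, Matrix.mul_assoc Zᴴ, Matrix.trace_mul_comm]
    simp only [Matrix.mul_assoc]
  rw [h1, Matrix.trace]
  simp only [Matrix.diag_apply]
  rw [Fintype.sum_prod_type, Complex.re_sum]
  refine Finset.sum_congr rfl fun a _ => ?_
  rw [Matrix.mul_apply, Complex.re_sum]
  refine Finset.sum_congr rfl fun b _ => ?_
  rw [conjTranspose_apply, ← nsq, Complex.ofReal_re]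
  rfl

lemma rk_ct {A : Type*} (w : A → ℂ) : (rk w)ᴴ = rk w := by
  ext a b; simp [rk, vecMulVec_apply, mul_comm]

lemma rk_sq {A : Type*} [Fintype A] (w : A → ℂ) :
    rk w * rk w = ((∑ a, ‖w a‖ ^ 2 : ℝ) : ℂ) • rk w := by
  ext a b
  simp only [Matrix.mul_apply, rk, vecMulVec_apply, Matrix.smul_apply, Pi.star_apply, smul_eq_mul,
    Complex.ofReal_sum, nsq, Finset.sum_mul]
  exact Finset.sum_congr rfl fun j _ => by ring

lemma rk_trace {A : Type*} [Fintype A] (w : A → ℂ) : (rk w).trace = ((∑ a, ‖w a‖ ^ 2 : ℝ) : ℂ) := by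
  simp only [Matrix.trace, Matrix.diag_apply, rk, vecMulVec_apply, Pi.star_apply, Complex.ofReal_sum, nsq]

lemma qf_zero {A : Type*} [Fintype A] (M : Matrix A A ℂ) : qf M 0 = 0 := by simp [qf]

lemma sc1 {x : ℝ} (h : 0 < x) : ((√x)⁻¹ - 1) * x * ((√x)⁻¹ - 1) = (1 - √x) ^ 2 := by
  have h2 := Real.sqrt_pos.2 h
  have h3 : x = √x ^ 2 := (Real.sq_sqrt h.le).symm
  generalize √x = s at *
  subst h3
  field_simp

lemma sc2 {x : ℝ} (h : 0 ≤ x) : (1 - √x) ^ 2 ≤ (1 - x) ^ 2 := by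
  have h2 := Real.sqrt_nonneg x
  have h3 : x = √x ^ 2 := (Real.sq_sqrt h).symm
  generalize √x = s at *
  subst h3
  have : (1 - s ^ 2) ^ 2 = (1 - s) ^ 2 * (1 + s) ^ 2 := by ring
  rw [this]
  have : 1 ≤ (1 + s) ^ 2 := by nlinarith
  nlinarith [sq_nonneg (1 - s)]

set_option maxHeartbeats 1000000 in
lemma oneshot {A X : Type*} [Fintype A] [DecidableEq A] [Fintype X] {ρA Pj : Matrix A A ℂ}
    (hρ : ρA.PosSemidef) (htr : ρA.trace = 1) {w : X → A → ℂ} (hw : ∑ x, rk (w x) = 1)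
    {M : X → Matrix A A ℂ} (hM : ∀ x, (M x).PosSemidef) (hMρ : ∀ x u, qf (M x) u ≤ qf ρA u)
    {ε1 ε2 d : ℝ} (hε1 : ∑ x, qf (M x) (w x) ≤ ε1) (hP1 : Pjᴴ = Pj) (hP2 : Pj * Pj = Pj)
    (hd : 1 ≤ d) (hPd : Pj.trace = (d : ℂ)) (hε2 : ((1 - Pj) * ρA).trace.re ≤ ε2) (N : ℕ) (hN : 0 < N) :
    ∃ (t : Fin N → X) (v : Fin N ⊕ A → A → ℂ), ∑ y, rk (v y) = 1 ∧
      ∑ y, qf (M (t y)) (v (Sum.inl y)) + ∑ a, qf ρA (v (Sum.inr a)) ≤ 16 * d / N + 8 * ε1 + 12 * ε2 := by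
  have hd0 : 0 < d := by linarith
  have hN0 : (0 : ℝ) < N := by exact_mod_cast hN
  set w' : X → A → ℂ := fun x => Pj *ᵥ w x with hw'
  have hsum' : ∑ x, rk (w' x) = Pj := by
    simp only [hw', rk_mulVec, ← Finset.mul_sum, ← Finset.sum_mul, hw, Matrix.mul_one, hP1, hP2]
  have h1P : (1 - Pj) * (1 - Pj)ᴴ = 1 - Pj := by
    rw [conjTranspose_sub, conjTranspose_one, hP1, Matrix.sub_mul, Matrix.mul_sub, Matrix.mul_sub, hP2]
    simp
  have hout : ∑ x, qf ρA ((1 - Pj) *ᵥ w x) = ((1 - Pj) * ρA).trace.re := by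
    rw [sum_qf]
    simp only [rk_mulVec, ← Finset.mul_sum, ← Finset.sum_mul, hw, Matrix.mul_one, h1P]
  have hout0 : 0 ≤ ((1 - Pj) * ρA).trace.re := by
    rw [← hout]; exact Finset.sum_nonneg fun x _ => qf_nonneg hρ _
  have hPt : (Pj * ρA).trace.re ≤ 1 := by
    have : (Pj * ρA).trace.re = 1 - ((1 - Pj) * ρA).trace.re := by
      rw [Matrix.sub_mul, Matrix.trace_sub, Matrix.one_mul, htr]; simp
    linarith
  have hbad' : ∑ x, qf (M x) (w' x) ≤ 2 * ε1 + 2 * ε2 := by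
    have : ∀ x, qf (M x) (w' x) ≤ 2 * qf (M x) (w x) + 2 * qf ρA ((1 - Pj) *ᵥ w x) := by
      intro x
      have e : w' x = w x + (((-1 : ℝ)) : ℂ) • ((1 - Pj) *ᵥ w x) := by
        simp [hw', Matrix.sub_mulVec]
      rw [e]
      refine (qf_add_le (hM x) _ _).trans ?_
      rw [qf_smul]
      have := hMρ x ((1 - Pj) *ᵥ w x)
      linarith
    refine (Finset.sum_le_sum fun x _ => this x).trans ?_
    rw [Finset.sum_add_distrib, ← Finset.mul_sum, ← Finset.mul_sum, hout]
    linarith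
  set nn : X → ℝ := fun x => ∑ a, ‖w' x a‖ ^ 2 with hnn
  have hnn0 : ∀ x, 0 ≤ nn x := fun x => by positivity
  have hnz : ∀ x, nn x = 0 → w' x = 0 := by
    intro x hx
    funext a
    have := (Finset.sum_eq_zero_iff_of_nonneg (fun a _ => by positivity)).1 hx a (Finset.mem_univ a)
    simpa using this
  set q : X → ℝ := fun x => nn x / d with hq
  have hq0 : ∀ x, 0 ≤ q x := fun x => div_nonneg (hnn0 x) hd0.le
  have hqz : ∀ x, q x = 0 → w' x = 0 := fun x hx => hnz x (by
    simpa [hq, hd0.ne'] using hx)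
  have hq1 : ∑ x, q x = 1 := by
    have : ((∑ x, nn x : ℝ) : ℂ) = (d : ℂ) := by
      rw [← hPd, ← hsum', Matrix.trace_sum, Complex.ofReal_sum]
      exact Finset.sum_congr rfl fun x _ => (rk_trace _).symm
    have : ∑ x, nn x = d := by exact_mod_cast this
    rw [hq, ← Finset.sum_div, this, div_self hd0.ne']
  obtain ⟨W, l, hW, hl⟩ := psd_dg hρ
  set R : Matrix A A ℂ := od W (fun i => √(l i)) with hR
  have hRR : R * Rᴴ = ρA := by
    rw [hR, od_ct, od_mul hW.1, hW.2.2, od]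
    simp only [Real.mul_self_sqrt (hl _)]
  set Xx : X → Matrix A A ℂ := fun x => (((q x)⁻¹ : ℝ) : ℂ) • rk (w' x) with hXx
  have hXq : ∀ x, (q x : ℂ) • Xx x = rk (w' x) := by
    intro x
    by_cases h : q x = 0
    · simp [hXx, hqz x h, rk]
    · simp [hXx, smul_smul, h]
  have hz : ∑ x, (q x : ℂ) • zE R (Xx x - Pj) = 0 := by
    rw [← map_zero (zE R)]
    simp only [← map_smul, ← map_sum]
    congr 1
    simp only [smul_sub, Finset.sum_sub_distrib, hXq, hsum', ← Finset.sum_smul, ← Complex.ofReal_sum, hq1]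
    simp
  obtain ⟨t, ht⟩ := greedy q (fun x => N * (qf (M x) (w' x) / q x)) (fun x => zE R (Xx x - Pj)) hq0 hq1 hz N
  have hvar : ∀ x, q x * (‖zE R (Xx x - Pj)‖ ^ 2 + N * (qf (M x) (w' x) / q x)) ≤
      2 * d * qf ρA (w' x) + 2 * q x + N * qf (M x) (w' x) := by
    intro x
    have a1 : ‖zE R (Xx x - Pj)‖ ^ 2 ≤ 2 * ‖zE R (Xx x)‖ ^ 2 + 2 * ‖zE R Pj‖ ^ 2 := by
      rw [map_sub]
      have := norm_sub_le (zE R (Xx x)) (zE R Pj)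
      have := norm_nonneg (zE R (Xx x) - zE R Pj)
      nlinarith [sq_nonneg (‖zE R (Xx x)‖ - ‖zE R Pj‖)]
    have a2 : ‖zE R Pj‖ ^ 2 ≤ 1 := by rw [zE_norm, hRR, hP1, hP2]; exact hPt
    have a3 : q x * ‖zE R (Xx x)‖ ^ 2 ≤ d * qf ρA (w' x) := by
      by_cases h : q x = 0
      · rw [h, hqz x h, qf_zero]; simp
      · refine le_of_eq ?_
        rw [zE_norm, hRR, hXx]
        simp only [conjTranspose_smul, rk_ct, Matrix.smul_mul, Matrix.mul_smul, rk_sq, Matrix.trace_smul, qf_tr, smul_eq_mul]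
        rw [Complex.star_def, Complex.conj_ofReal, Complex.re_ofReal_mul, Complex.re_ofReal_mul, Complex.re_ofReal_mul]
        have : nn x = q x * d := by rw [hq]; field_simp
        change q x * ((q x)⁻¹ * ((q x)⁻¹ * (nn x * _))) = _
        rw [this]; field_simp
    have a4 : q x * (qf (M x) (w' x) / q x) ≤ qf (M x) (w' x) := by
      by_cases h : q x = 0
      · rw [h]; simpa using qf_nonneg (hM x) (w' x)
      · rw [mul_div_cancel₀ _ h]
    have b1 := mul_le_mul_of_nonneg_left a1 (hq0 x)
    have b2 := mul_le_mul_of_nonneg_left a2 (hq0 x)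
    have b4 := mul_le_mul_of_nonneg_left a4 hN0.le
    nlinarith
  have hvs : ∑ x, q x * (‖zE R (Xx x - Pj)‖ ^ 2 + N * (qf (M x) (w' x) / q x)) ≤ 4 * d + N * (2 * ε1 + 2 * ε2) := by
    refine (Finset.sum_le_sum fun x _ => hvar x).trans ?_
    rw [Finset.sum_add_distrib, Finset.sum_add_distrib, ← Finset.mul_sum, ← Finset.mul_sum, ← Finset.mul_sum, hq1,
      sum_qf, hsum']
    have := mul_le_mul_of_nonneg_left hbad' hN0.le
    nlinarith
  have ht' := ht.trans (mul_le_mul_of_nonneg_left hvs hN0.le)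
  -- compressed vectors
  set w2 : Fin N → A → ℂ := fun y => (((√(N * q (t y)))⁻¹ : ℝ) : ℂ) • w' (t y) with hw2
  have hsq : ∀ y, ((√(N * q (t y)))⁻¹) ^ 2 = (N : ℝ)⁻¹ * (q (t y))⁻¹ := fun y => by
    rw [inv_pow, Real.sq_sqrt (mul_nonneg hN0.le (hq0 _)), mul_inv]
  set S := ∑ y, rk (w2 y) with hS
  have hS1 : S = (((N : ℝ)⁻¹ : ℝ) : ℂ) • ∑ y, Xx (t y) := by
    rw [hS, Finset.smul_sum]
    refine Finset.sum_congr rfl fun y _ => ?_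
    rw [hw2, rk_smul, hsq, hXx, smul_smul, Complex.ofReal_mul]
  have hSP : ‖zE R (S - Pj)‖ ^ 2 = (N : ℝ)⁻¹ ^ 2 * ‖∑ i, zE R (Xx (t i) - Pj)‖ ^ 2 := by
    have : S - Pj = (((N : ℝ)⁻¹ : ℝ) : ℂ) • ∑ i, (Xx (t i) - Pj) := by
      rw [hS1, Finset.sum_sub_distrib, smul_sub]
      congr 1
      rw [Finset.sum_const, Finset.card_univ, Fintype.card_fin, ← Nat.cast_smul_eq_nsmul ℂ, smul_smul]
      have : (N : ℂ) ≠ 0 := by exact_mod_cast hN.ne'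
      simp [this]
    rw [this, map_smul, norm_smul, mul_pow, map_sum]
    simp
  have hbad2 : ∑ y, qf (M (t y)) (w2 y) = (N : ℝ)⁻¹ ^ 2 * ∑ y, (N * (qf (M (t y)) (w' (t y)) / q (t y))) := by
    rw [Finset.mul_sum]
    refine Finset.sum_congr rfl fun y _ => ?_
    rw [hw2, qf_smul, hsq]
    field_simp
  have hmain : ‖zE R (S - Pj)‖ ^ 2 + ∑ y, qf (M (t y)) (w2 y) ≤ 4 * d / N + (2 * ε1 + 2 * ε2) := by
    rw [hSP, hbad2, ← mul_add]
    refine (mul_le_mul_of_nonneg_left ht' (by positivity)).trans (le_of_eq ?_)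
    field_simp
  have hSpsd : S.PosSemidef := by
    rw [hS]
    exact Matrix.posSemidef_sum _ fun y _ => Matrix.posSemidef_vecMulVec_self_star _
  obtain ⟨O, D, hO, hD⟩ := psd_dg hSpsd
  have hSO : S = od O D := hO.2.2
  set T := od O (fun i => (√(D i))⁻¹) with hT
  set v : Fin N ⊕ A → A → ℂ := Sum.elim (fun y => T *ᵥ w2 y)
    (fun a => (((if D a = 0 then 1 else 0 : ℝ)) : ℂ) • fun b => O b a) with hv
  have hTST : ∑ y, rk (T *ᵥ w2 y) = od O (fun i => if D i = 0 then 0 else 1) := by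
    simp only [rk_mulVec, ← Finset.mul_sum, ← Finset.sum_mul]
    rw [← hS, hSO, hT, od_ct, od_mul hO.1, od_mul hO.1]
    congr 1; funext i
    split_ifs with h
    · simp [h]
    · have : 0 < D i := lt_of_le_of_ne (hD i) (Ne.symm h)
      have h2 := Real.sqrt_pos.2 this
      have h3 := Real.mul_self_sqrt this.le
      field_simp
      nlinarith
  have hextra : ∑ a, rk (v (Sum.inr a)) = od O (fun i => (if D i = 0 then 1 else 0) ^ 2) := by
    simp only [hv, Sum.elim_inr]; exact od_sum O _
  have hcomp : ∑ y, rk (v y) = 1 := by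
    rw [Fintype.sum_sum_type, hextra]
    simp only [hv, Sum.elim_inl]
    rw [hTST, od_add, ← od_one hO.2.1]
    congr 1; funext i; split_ifs <;> simp
  have hpert : ∑ y, qf ρA (T *ᵥ w2 y - w2 y) + ∑ a, qf ρA (v (Sum.inr a)) =
      ∑ j, (1 - √(D j)) ^ 2 * qf ρA (fun a => O a j) := by
    have e1 : ∀ y, T *ᵥ w2 y - w2 y = (T - 1) *ᵥ w2 y := fun y => by rw [Matrix.sub_mulVec, Matrix.one_mulVec]
    simp only [e1]
    rw [sum_qf, sum_qf, hextra]
    simp only [rk_mulVec, ← Finset.mul_sum, ← Finset.sum_mul]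
    rw [← hS, hSO, hT, ← od_one hO.2.1, od_sub, od_ct, od_mul hO.1, od_mul hO.1, ← Complex.add_re, ← Matrix.trace_add,
      ← Matrix.add_mul, od_add, od, qt_diag]
    refine Finset.sum_congr rfl fun j _ => ?_
    congr 1
    split_ifs with h
    · simp [h]
    · have : 0 < D j := lt_of_le_of_ne (hD j) (Ne.symm h)
      have := sc1 this
      simpa using this
  have hpert2 : ∑ j, (1 - √(D j)) ^ 2 * qf ρA (fun a => O a j) ≤ ‖zE R (1 - S)‖ ^ 2 := by
    have : ‖zE R (1 - S)‖ ^ 2 = ∑ j, (1 - D j) ^ 2 * qf ρA (fun a => O a j) := by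
      rw [zE_norm, hRR, hSO, ← od_one hO.2.1, od_sub, od_ct, od_mul hO.1, od, qt_diag]
      simp only [sq]
    rw [this]
    refine Finset.sum_le_sum fun j _ => mul_le_mul_of_nonneg_right ?_ (qf_nonneg hρ _)
    exact sc2 (hD j)
  have hpert3 : ‖zE R (1 - S)‖ ^ 2 ≤ 2 * ‖zE R (S - Pj)‖ ^ 2 + 2 * ε2 := by
    have e : zE R (1 - S) = zE R (1 - Pj) - zE R (S - Pj) := by rw [← map_sub]; congr 1; abel
    have a2 : ‖zE R (1 - Pj)‖ ^ 2 ≤ ε2 := by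
      rw [zE_norm, hRR]
      have : (1 - Pj)ᴴ * (1 - Pj) = 1 - Pj := by
        have h5 : (1 - Pj)ᴴ = 1 - Pj := by simp [hP1]
        rw [h5] at h1P ⊢; exact h1P
      rw [this]; exact hε2
    rw [e]
    have := norm_sub_le (zE R (1 - Pj)) (zE R (S - Pj))
    have := norm_nonneg (zE R (1 - Pj) - zE R (S - Pj))
    nlinarith [sq_nonneg (‖zE R (1 - Pj)‖ - ‖zE R (S - Pj)‖)]
  refine ⟨t, v, hcomp, ?_⟩
  have hfin : ∀ y, qf (M (t y)) (v (Sum.inl y)) ≤ 2 * qf (M (t y)) (w2 y) + 2 * qf ρA (T *ᵥ w2 y - w2 y) := by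
    intro y
    have e : v (Sum.inl y) = w2 y + (T *ᵥ w2 y - w2 y) := by simp [hv]
    rw [e]
    refine (qf_add_le (hM _) _ _).trans ?_
    have := hMρ (t y) (T *ᵥ w2 y - w2 y)
    linarith
  have hfs := Finset.sum_le_sum fun y (_ : y ∈ Finset.univ) => hfin y
  rw [Finset.sum_add_distrib, ← Finset.mul_sum, ← Finset.mul_sum] at hfs
  have hx0 : 0 ≤ ∑ a, qf ρA (v (Sum.inr a)) := Finset.sum_nonneg fun a _ => qf_nonneg hρ _
  have hb0 : 0 ≤ ∑ y, qf (M (t y)) (w2 y) := Finset.sum_nonneg fun a _ => qf_nonneg (hM _) _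
  have : 16 * d / N = 4 * (4 * d / N) := by ring
  rw [this]
  linarith

lemma unitary_ext {G ι κ : Type*} [Fintype ι] [DecidableEq ι] [Fintype κ] [DecidableEq κ] [DecidableEq G]
    (hc : Fintype.card ι = Fintype.card κ) (φ : G → ι) (hφ : Function.Injective φ) (u : G → κ → ℂ)
    (hu : ∀ s s', ∑ k, star (u s k) * u s' k = if s = s' then 1 else 0) :
    ∃ U : Matrix ι κ ℂ, Uᴴ * U = 1 ∧ U * Uᴴ = 1 ∧ ∀ s k, U (φ s) k = u s k := by
  let uE : G → EuclideanSpace ℂ κ := fun s => WithLp.toLp 2 (u s)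
  have hin : ∀ x y : EuclideanSpace ℂ κ, inner ℂ x y = ∑ k, star (x k) * y k := by
    intro x y
    rw [PiLp.inner_apply]
    exact Finset.sum_congr rfl fun k _ => by rw [RCLike.inner_apply, mul_comm]; rfl
  have ho : Orthonormal ℂ uE := by
    rw [orthonormal_iff_ite]
    intro s s'
    rw [hin, ← hu s s']
  have ho' : Orthonormal ℂ ((Set.range φ).domRestrict (Function.extend φ uE 0)) := by
    have : (Set.range φ).domRestrict (Function.extend φ uE 0) = uE ∘ (Equiv.ofInjective φ hφ).symm := by
      funext ⟨i, s, hs⟩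
      subst hs
      simp [Set.domRestrict, hφ.extend_apply]
    rw [this]
    exact ho.comp _ (Equiv.injective _)
  obtain ⟨b, hb⟩ := ho'.exists_orthonormalBasis_extension_of_card_eq (ι := ι) (by simp [hc])
  have h2 : (Matrix.of fun i k => b i k) * (Matrix.of fun i k => b i k)ᴴ = (1 : Matrix ι ι ℂ) := by
    ext i i'
    have := orthonormal_iff_ite.1 b.orthonormal i' i
    rw [hin] at this
    rw [Matrix.mul_apply, Matrix.one_apply, ← if_congr eq_comm rfl rfl, ← this]
    exact Finset.sum_congr rfl fun k _ => by simp [mul_comm]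
  refine ⟨Matrix.of fun i k => b i k, ?_, h2, ?_⟩
  · exact (Matrix.mul_eq_one_comm_of_card_eq _ _ _ hc).1 h2
  · intro s k
    have := hb (φ s) ⟨s, rfl⟩
    rw [hφ.extend_apply] at this
    simp [this, uE]

def bad {A B : Type*} [Fintype A] [Fintype B] [DecidableEq B] (σ : Matrix (A × B) (A × B) ℂ) (V : Matrix B B ℂ)
    (J : Finset B) (w : A → ℂ) : ℝ := ∑ j ∈ Jᶜ, qf (red (rk w) σ) (fun b => V b j)

lemma sum_qf_col {B : Type*} [Fintype B] [DecidableEq B] (M V : Matrix B B ℂ) (hV : V * Vᴴ = 1) :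
    ∑ j, qf M (fun b => V b j) = rtr M := by
  have := qt_diag M V (fun _ => 1)
  simp only [one_mul] at this
  rw [← this, rtr]
  simp [hV]

def bop {A B : Type*} [Fintype A] [Fintype B] [DecidableEq B] (σ : Matrix (A × B) (A × B) ℂ) (V : Matrix B B ℂ)
    (J : Finset B) : Matrix A A ℂ :=
  fun a a' => ∑ j ∈ Jᶜ, ∑ b, ∑ b', star (V b j) * σ (a, b) (a', b') * V b' j

lemma qf_bop {A B : Type*} [Fintype A] [Fintype B] [DecidableEq B] (σ : Matrix (A × B) (A × B) ℂ) (V : Matrix B B ℂ)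
    (J : Finset B) (w : A → ℂ) : qf (bop σ V J) w = bad σ V J w := by
  simp only [qf, bad, bop, ← Complex.re_sum]
  congr 1
  simp only [red, rk, vecMulVec_apply, Pi.star_apply, Finset.mul_sum, Finset.sum_mul]
  rw [Finset.sum_congr rfl fun a _ => Finset.sum_comm, Finset.sum_comm]
  refine Finset.sum_congr rfl fun j _ => ?_
  rw [Finset.sum_congr rfl fun a _ => Finset.sum_comm, Finset.sum_comm]
  refine Finset.sum_congr rfl fun b _ => ?_
  rw [Finset.sum_congr rfl fun a _ => Finset.sum_comm, Finset.sum_comm]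
  refine Finset.sum_congr rfl fun b' _ => ?_
  rw [Finset.sum_comm]
  refine Finset.sum_congr rfl fun a _ => Finset.sum_congr rfl fun a' _ => ?_
  ring

lemma bop_psd {A B : Type*} [Fintype A] [DecidableEq A] [Fintype B] [DecidableEq B] {σ : Matrix (A × B) (A × B) ℂ}
    (hσ : σ.PosSemidef) (V : Matrix B B ℂ) (J : Finset B) : (bop σ V J).PosSemidef := by
  have : bop σ V J = ∑ j ∈ Jᶜ, (Matrix.of fun (p : A × B) (a : A) => if p.1 = a then V p.2 j else 0)ᴴ * σ *
      (Matrix.of fun (p : A × B) (a : A) => if p.1 = a then V p.2 j else 0) := by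
    ext a a'
    rw [Matrix.sum_apply, bop]
    refine Finset.sum_congr rfl fun j _ => ?_
    simp only [Matrix.mul_apply, conjTranspose_apply, Matrix.of_apply, Fintype.sum_prod_type_right, apply_ite star, star_zero,
      ite_mul, zero_mul, mul_ite, mul_zero, Finset.sum_ite_eq', Finset.mem_univ, if_true, Finset.sum_mul]
    rw [Finset.sum_comm]
  rw [this]
  exact Matrix.posSemidef_sum _ fun j _ => hσ.conjTranspose_mul_mul_same _

lemma bad_empty {A B : Type*} [Fintype A] [Fintype B] [DecidableEq B] {σ : Matrix (A × B) (A × B) ℂ}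
    (V : Matrix B B ℂ) (hV : V * Vᴴ = 1) (w : A → ℂ) : bad σ V ∅ w = qf (ptraceRight σ) w := by
  rw [bad, Finset.compl_empty, sum_qf_col _ _ hV, rtr_red]

lemma bad_le {A B : Type*} [Fintype A] [Fintype B] [DecidableEq A] [DecidableEq B] {σ : Matrix (A × B) (A × B) ℂ}
    (hσ : σ.PosSemidef) (V : Matrix B B ℂ) (hV : V * Vᴴ = 1) (J : Finset B) (w : A → ℂ) :
    bad σ V J w ≤ qf (ptraceRight σ) w := by
  rw [← bad_empty V hV, bad, bad]
  exact Finset.sum_le_sum_of_subset_of_nonneg (Finset.compl_subset_compl.2 (Finset.empty_subset _))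
    fun j _ _ => qf_nonneg (red_rk_psd hσ w) _

lemma sum_emb_le {G D : Type*} [Fintype G] [Fintype D] (g : G ↪ D) (f : D → ℝ) (hf : ∀ d, 0 ≤ f d) :
    ∑ s, f (g s) ≤ ∑ d, f d := by
  rw [← Finset.sum_map Finset.univ g f]
  exact Finset.sum_le_sum_of_subset_of_nonneg (Finset.subset_univ _) fun bg _ _ => hf bg

lemma mkProtocol {α β : Type*} [Fintype α] [DecidableEq α] [Fintype β] [DecidableEq β]
    {ρ : Matrix (α × β) (α × β) ℂ} (h : IsDensity ρ) (n dC dY : ℕ) (hdC : 0 < dC)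
    (hdY : dY = Fintype.card (Fin n → α) * dC)
    (v : Fin dY → (Fin n → α) → ℂ) (hv : ∑ y, rk (v y) = 1)
    (V : Fin dY → Matrix (Fin n → β) (Fin n → β) ℂ)
    (hV1 : ∀ y, (V y)ᴴ * V y = 1) (hV2 : ∀ y, V y * (V y)ᴴ = 1)
    (J : Fin dY → Finset (Fin n → β)) (hJ : ∑ y, (J y).card ≤ dC) :
    ∃ Pr : Protocol α β n, Pr.dC = dC ∧ Pr.dAp = 1 ∧
      Pr.dBp = Fintype.card (Fin n → α) * Fintype.card (Fin n → β) ∧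
      Pr.dY = dY ∧
      1 - ∑ y, bad (tpowAB ρ n) (V y) (J y) (v y) ≤ succP ρ Pr := by
  obtain ⟨hα, hβ⟩ := density_nonempty h
  have hA : 0 < Fintype.card (Fin n → α) := Fintype.card_pos
  have hB : 0 < Fintype.card (Fin n → β) := Fintype.card_pos
  -- Alice
  obtain ⟨UAt, a1, a2, a3⟩ := unitary_ext (G := Fin n → α) (ι := (Fin n → α) × Fin dC)
    (κ := (Fin 1 × Fin dY) × Fin 1) (by simp [hdY]) (fun a => (a, ⟨0, hdC⟩)) (fun a a' e => (Prod.ext_iff.1 e).1)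
    (fun a k => star (v k.1.2 a)) (by
      intro a a'
      have := congrFun (congrFun hv a) a'
      simp only [Matrix.sum_apply, rk, vecMulVec_apply, Matrix.one_apply, Pi.star_apply] at this
      rw [← this]
      simp [Fintype.sum_prod_type])
  -- Bob
  let G := {s : Σ _ : Fin dY, (Fin n → β) // s ∈ Finset.univ.sigma J}
  have hcard : Fintype.card G ≤ Fintype.card (Fin dC) := by
    rw [Fintype.card_fin, Fintype.card_coe, Finset.card_sigma]; exact hJ
  obtain ⟨g⟩ := Function.Embedding.nonempty_of_card_le hcard
  have hBp : 0 < Fintype.card (Fin n → α) * Fintype.card (Fin n → β) := Nat.mul_pos hA hB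
  obtain ⟨UB, b1, b2, b3⟩ := unitary_ext (G := G)
    (ι := Fin (Fintype.card (Fin n → α) * Fintype.card (Fin n → β)) × Fin dC)
    (κ := (Fin n → β) × Fin dY) (by simp [hdY]; ring) (fun s => (⟨0, hBp⟩, g s))
    (fun s s' e => g.injective (Prod.ext_iff.1 e).2)
    (fun s k => if k.2 = s.1.1 then star (V s.1.1 k.1 s.1.2) else 0) (by
      rintro ⟨⟨y, j⟩, hs⟩ ⟨⟨y', j'⟩, hs'⟩
      simp only [Fintype.sum_prod_type, apply_ite star, star_star, star_zero, ite_mul, zero_mul, mul_ite, mul_zero,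
        Finset.sum_ite_eq', Finset.mem_univ, if_true]
      by_cases hy : y = y'
      · subst hy
        simp only [if_true]
        have := congrFun (congrFun (hV1 y) j') j
        simp only [Matrix.mul_apply, conjTranspose_apply, Matrix.one_apply] at this
        rw [Finset.sum_congr rfl fun b _ => mul_comm _ _, this]
        exact if_congr (by rw [Subtype.mk_eq_mk, Sigma.mk.injEq]; simp [eq_comm]) rfl rfl
      · rw [if_neg (fun e => hy (by injection e with e; injection e))]
        exact Finset.sum_eq_zero fun x _ => if_neg (Ne.symm hy))
  refine ⟨{ dC := dC, dAp := 1, dY := dY, dAg := 1, dBp := _, dBg := dC, dC_pos := hdC, dAp_pos := one_pos,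
            dY_pos := hdY ▸ Nat.mul_pos hA hdC, dAg_pos := one_pos, dBp_pos := hBp, dBg_pos := hdC,
            UA := UAtᵀ, UA_unitary := ⟨?_, ?_⟩, UB := UB, UB_unitary := ⟨b1, b2⟩ }, rfl, rfl, rfl, rfl, ?_⟩
  · rw [← Matrix.transpose_one, ← a2, Matrix.transpose_mul]; rfl
  · rw [← Matrix.transpose_one, ← a1, Matrix.transpose_mul]; rfl
  rw [succP, output_apply]
  have hpv : ∀ (Pr : Protocol α β n) x, pvec Pr x = fun a => star (Pr.UA x (a, ⟨0, Pr.dC_pos⟩)) := fun Pr x => by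
    funext a; rfl
  simp only [hpv, Matrix.transpose_apply]
  have a3' : ∀ a k, UAt (a, ⟨0, hdC⟩) k = star (v k.1.2 a) := a3
  have hpsd := fun y => red_rk_psd (tpowAB_density h n).1 (v y)
  have hsum1 : ∑ y, rtr (red (rk (v y)) (tpowAB ρ n)) = 1 := sum_rtr_red _ (tpowAB_density h n).2 v hv
  simp only [a3', star_star, Complex.re_sum]
  have key : ∀ (bg : Fin dC) (y : Fin dY), ∑ b, ∑ b', (UB (⟨0, hBp⟩, bg) (b, y) * red (rk (v y)) (tpowAB ρ n) b b' *
      star (UB (⟨0, hBp⟩, bg) (b', y))).re = qf (red (rk (v y)) (tpowAB ρ n)) (fun b => star (UB (⟨0, hBp⟩, bg) (b, y))) := by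
    intro bg y
    simp only [qf, Complex.re_sum, star_star]
  have key2 : ∑ y, ∑ j ∈ J y, qf (red (rk (v y)) (tpowAB ρ n)) (fun b => V y b j) ≤
      ∑ bg : Fin dC, ∑ y, qf (red (rk (v y)) (tpowAB ρ n)) (fun b => star (UB (⟨0, hBp⟩, bg) (b, y))) := by
    calc _ = ∑ s : G, qf (red (rk (v s.1.1)) (tpowAB ρ n)) (fun b => V s.1.1 b s.1.2) := by
          rw [Finset.sum_sigma', ← Finset.sum_coe_sort]; refine Finset.sum_congr ?_ fun _ _ => rfl
          ext; simp
      _ ≤ ∑ s : G, ∑ y, qf (red (rk (v y)) (tpowAB ρ n)) (fun b => star (UB (⟨0, hBp⟩, g s) (b, y))) := by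
          refine Finset.sum_le_sum fun s _ => ?_
          refine le_trans (le_of_eq ?_) (Finset.single_le_sum (fun y _ => qf_nonneg (hpsd y) _) (Finset.mem_univ s.1.1))
          congr 1
          funext b
          have := b3 s (b, s.1.1)
          simp only [if_true] at this
          rw [this, star_star]
      _ ≤ _ := by
          convert sum_emb_le g (fun bg => ∑ y, qf (red (rk (v y)) (tpowAB ρ n)) (fun b => star (UB (⟨0, hBp⟩, bg) (b, y))))
            fun bg => Finset.sum_nonneg fun y _ => qf_nonneg (hpsd y) _
  have key3 : 1 - ∑ y, bad (tpowAB ρ n) (V y) (J y) (v y) =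
      ∑ y, ∑ j ∈ J y, qf (red (rk (v y)) (tpowAB ρ n)) (fun b => V y b j) := by
    rw [← hsum1, ← Finset.sum_sub_distrib]
    refine Finset.sum_congr rfl fun y _ => ?_
    rw [← sum_qf_col _ _ (hV2 y), bad, ← Finset.sum_add_sum_compl (J y)]
    ring
  rw [key3]
  refine key2.trans (le_of_eq ?_)
  simp only [← key]
  simp

/-- block codes -/
def Code {A B : Type*} [Fintype A] [DecidableEq A] [Fintype B] [DecidableEq B]
    (σ : Matrix (A × B) (A × B) ℂ) (L ε : ℝ) : Prop :=
  ∃ (m : ℕ) (w : Fin m → A → ℂ) (V : Fin m → Matrix B B ℂ) (J : Fin m → Finset B),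
    ∑ x, rk (w x) = 1 ∧ (∀ x, (V x)ᴴ * V x = 1 ∧ V x * (V x)ᴴ = 1) ∧ (∀ x, ((J x).card : ℝ) ≤ L) ∧
      ∑ x, bad σ (V x) (J x) (w x) ≤ ε

lemma Code.of {A B X : Type*} [Fintype A] [DecidableEq A] [Fintype B] [DecidableEq B] [Fintype X]
    {σ : Matrix (A × B) (A × B) ℂ} {L ε : ℝ} (w : X → A → ℂ) (V : X → Matrix B B ℂ) (J : X → Finset B)
    (h1 : ∑ x, rk (w x) = 1) (h2 : ∀ x, (V x)ᴴ * V x = 1 ∧ V x * (V x)ᴴ = 1)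
    (h3 : ∀ x, ((J x).card : ℝ) ≤ L) (h4 : ∑ x, bad σ (V x) (J x) (w x) ≤ ε) : Code σ L ε := by
  let e := (Fintype.equivFin X).symm
  refine ⟨Fintype.card X, fun i => w (e i), fun i => V (e i), fun i => J (e i), ?_, fun x => h2 _,
    fun x => h3 _, ?_⟩
  · rw [← h1]; exact e.sum_comp (fun x => rk (w x))
  · rw [e.sum_comp (fun x => bad σ (V x) (J x) (w x))]; exact h4

lemma qf_submatrix {B B' : Type*} [Fintype B] [Fintype B'] (eB : B ≃ B') (M : Matrix B' B' ℂ) (u : B' → ℂ) :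
    qf (M.submatrix eB eB) (fun b => u (eB b)) = qf M u := by
  simp only [qf, submatrix_apply]
  rw [← eB.sum_comp]
  congr 1
  refine Finset.sum_congr rfl fun b _ => ?_
  rw [← eB.sum_comp]

lemma Code.reindex {A B A' B' : Type*} [Fintype A] [DecidableEq A] [Fintype B] [DecidableEq B]
    [Fintype A'] [DecidableEq A'] [Fintype B'] [DecidableEq B'] (eA : A ≃ A') (eB : B ≃ B')
    (ρ : Matrix (A × B) (A × B) ℂ) (ρ' : Matrix (A' × B') (A' × B') ℂ)
    (h : ∀ a b a' b', ρ (a, b) (a', b') = ρ' (eA a, eB b) (eA a', eB b')) {L ε : ℝ}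
    (hv : Code ρ' L ε) : Code ρ L ε := by
  obtain ⟨m, w, V, J, h1, h2, h3, h4⟩ := hv
  refine ⟨m, fun x a => w x (eA a), fun x => (V x).submatrix eB eB,
    fun x => (J x).map eB.symm.toEmbedding, rk_complete_reindex eA w h1, ?_, ?_, ?_⟩
  · intro x
    constructor
    · rw [conjTranspose_submatrix, submatrix_mul_equiv, (h2 x).1, submatrix_one_equiv]
    · rw [conjTranspose_submatrix, submatrix_mul_equiv, (h2 x).2, submatrix_one_equiv]
  · intro x
    rw [Finset.card_map]; exact h3 x
  · refine le_of_eq_of_le (Finset.sum_congr rfl fun x _ => ?_) h4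
    rw [bad, red_reindex eA eB ρ ρ' h, bad]
    refine Finset.sum_equiv eB ?_ ?_
    · intro j
      simp [Finset.mem_map_equiv]
    · intro j _
      exact qf_submatrix eB _ (fun b => V x b (eB j))

lemma qf_kron {B B' : Type*} [Fintype B] [DecidableEq B] [Fintype B'] [DecidableEq B'] {M : Matrix B B ℂ}
    {M' : Matrix B' B' ℂ} (h : M.PosSemidef) (h' : M'.PosSemidef) (u : B → ℂ) (u' : B' → ℂ) :
    qf (M ⊗ₖ M') (fun b => u b.1 * u' b.2) = qf M u * qf M' u' := by
  obtain ⟨U, d, hd, -⟩ := psd_dg h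
  obtain ⟨U', d', hd', -⟩ := psd_dg h'
  have e : ∑ a, ∑ a', star (u a.1 * u' a.2) * (M ⊗ₖ M') a a' * (u a'.1 * u' a'.2) =
      (∑ a, ∑ a', star (u a) * M a a' * u a') * (∑ a, ∑ a', star (u' a) * M' a a' * u' a') := by
    rw [Finset.sum_mul_sum, Fintype.sum_prod_type]
    refine Finset.sum_congr rfl fun a _ => Finset.sum_congr rfl fun b _ => ?_
    rw [Finset.sum_mul_sum, Fintype.sum_prod_type]
    refine Finset.sum_congr rfl fun a' _ => Finset.sum_congr rfl fun b' _ => ?_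
    simp only [kroneckerMap_apply, star_mul']
    ring
  rw [qf, e, qf_dg hd, qf_dg hd', qf_dgC hd, qf_dgC hd', ← Complex.ofReal_mul, Complex.ofReal_re]

lemma bad_tprod {A B A' B' : Type*} [Fintype A] [DecidableEq A] [Fintype B] [DecidableEq B]
    [Fintype A'] [DecidableEq A'] [Fintype B'] [DecidableEq B']
    (ρ : Matrix (A × B) (A × B) ℂ) (ρ' : Matrix (A' × B') (A' × B') ℂ) (hρ : IsDensity ρ)
    (hρ' : IsDensity ρ') (V : Matrix B B ℂ) (J : Finset B) (w : A → ℂ) (w' : A' → ℂ) :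
    bad (tprod ρ ρ') (V ⊗ₖ (1 : Matrix B' B' ℂ)) (J ×ˢ Finset.univ)
        (fun a : A × A' => w a.1 * w' a.2) = bad ρ V J w * rtr (red (rk w') ρ') := by
  have hc : (J ×ˢ (Finset.univ : Finset B'))ᶜ = Jᶜ ×ˢ Finset.univ := by
    ext ⟨b, b'⟩; simp
  rw [bad, hc, Finset.sum_product, red_tprod, bad, ← sum_qf_col _ (1 : Matrix B' B' ℂ) (by simp), Finset.sum_mul_sum]
  refine Finset.sum_congr rfl fun j _ => Finset.sum_congr rfl fun j' _ => ?_
  rw [← qf_kron (red_rk_psd hρ.1 _) (red_rk_psd hρ'.1 _)]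
  rfl

lemma Code.extend {A B A' B' : Type*} [Fintype A] [DecidableEq A] [Fintype B] [DecidableEq B]
    [Fintype A'] [DecidableEq A'] [Fintype B'] [DecidableEq B']
    (ρ : Matrix (A × B) (A × B) ℂ) (ρ' : Matrix (A' × B') (A' × B') ℂ) (hρ : IsDensity ρ)
    (hρ' : IsDensity ρ') {L ε : ℝ}
    (hv : Code ρ L ε) : Code (tprod ρ ρ') (L * Fintype.card B') ε := by
  obtain ⟨m, w, V, J, h1, h2, h3, h4⟩ := hv
  obtain ⟨_, m', w', hw', -⟩ := Val.exists ρ'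
  refine Code.of (X := Fin m × Fin m') (fun x a => w x.1 a.1 * w' x.2 a.2)
    (fun x => V x.1 ⊗ₖ (1 : Matrix B' B' ℂ)) (fun x => J x.1 ×ˢ Finset.univ)
    (rk_complete_prod w w' h1 hw') ?_ ?_ ?_
  · intro x
    rw [conjTranspose_kronecker, ← mul_kronecker_mul, ← mul_kronecker_mul, (h2 _).1, (h2 _).2]
    simp
  · intro x
    rw [Finset.card_product, Finset.card_univ, Nat.cast_mul]
    exact mul_le_mul_of_nonneg_right (h3 _) (Nat.cast_nonneg _)
  · refine le_of_eq_of_le ?_ h4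
    simp only [bad_tprod ρ ρ' hρ hρ']
    rw [Fintype.sum_prod_type]
    simp only [← Finset.mul_sum]
    rw [sum_rtr_red ρ' hρ'.2 _ hw']
    simp

lemma Code.tpow_add {α β : Type*} [Fintype α] [DecidableEq α] [Fintype β] [DecidableEq β]
    {ρ : Matrix (α × β) (α × β) ℂ} (h : IsDensity ρ) {m : ℕ} (n : ℕ) {L ε : ℝ}
    (hv : Code (tpowAB ρ m) L ε) : Code (tpowAB ρ (m + n)) (L * Fintype.card (Fin n → β)) ε := by
  have h1 := tpowAB_density h m
  have h2 := tpowAB_density h n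
  refine Code.reindex (splitE finSumFinEquiv.symm α) (splitE finSumFinEquiv.symm β) _ _
    ?_ (Code.extend _ _ h1 h2 hv)
  intro a b a' b'
  simp only [tpowAB_eq]
  exact tpG_split _ _ _ _ _ _

/-- currying -/
def curE (l k : ℕ) (α : Type*) : (Fin (k * l) → α) ≃ (Fin k → Fin l → α) :=
  (Equiv.arrowCongr finProdFinEquiv.symm (Equiv.refl α)).trans (Equiv.curry _ _ _)

lemma Code.tpow_mul {α β : Type*} [Fintype α] [DecidableEq α] [Fintype β] [DecidableEq β]
    {ρ : Matrix (α × β) (α × β) ℂ} (k l : ℕ) {L ε : ℝ}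
    (hv : Code (tpowAB (tpowAB ρ l) k) L ε) : Code (tpowAB ρ (k * l)) L ε := by
  refine Code.reindex (curE l k α) (curE l k β) _ _ ?_ hv
  intro a b a' b'
  simp only [tpowAB_eq, tpG]
  rw [← finProdFinEquiv.prod_comp, Fintype.prod_prod_type]
  rfl

lemma prod_one_entries {A : Type*} [DecidableEq A] {k : ℕ} (a a' : Fin k → A) :
    ∏ i, (1 : Matrix A A ℂ) (a i) (a' i) = (1 : Matrix (Fin k → A) (Fin k → A) ℂ) a a' := by
  rw [← tpow_one k]; rfl

lemma rk_complete_pow {A X : Type*} [DecidableEq A] [Fintype X] (w : X → A → ℂ)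
    (h : ∑ x, rk (w x) = 1) (k : ℕ) :
    ∑ x : Fin k → X, rk (fun a : Fin k → A => ∏ i, w (x i) (a i)) = 1 := by
  ext a a'
  rw [← prod_one_entries, ← h]
  simp only [Matrix.sum_apply, rk, vecMulVec_apply, Pi.star_apply]
  rw [← sum_pi_prod (fun i x => w x (a i) * star (w x (a' i)))]
  refine Finset.sum_congr rfl fun x _ => ?_
  rw [star_prod, Finset.prod_mul_distrib]

lemma red_pow {A B : Type*} [Fintype A] (ρ : Matrix (A × B) (A × B) ℂ) {k : ℕ} (w : Fin k → A → ℂ)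
    (b b' : Fin k → B) :
    red (rk (fun a : Fin k → A => ∏ i, w i (a i))) (tpowAB ρ k) b b' = ∏ i, red (rk (w i)) ρ (b i) (b' i) := by
  simp only [red, rk, vecMulVec_apply, Pi.star_apply, tpowAB_eq, tpG]
  rw [← sum_pi_prod (fun i a => ∑ a', w i a * star (w i a') * ρ (a', b i) (a, b' i))]
  refine Finset.sum_congr rfl fun a _ => ?_
  rw [← sum_pi_prod (fun i a' => w i (a i) * star (w i a') * ρ (a', b i) (a i, b' i))]
  refine Finset.sum_congr rfl fun a' _ => ?_
  rw [star_prod, ← Finset.prod_mul_distrib, ← Finset.prod_mul_distrib]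

lemma unit_pow {B : Type*} [Fintype B] [DecidableEq B] {k : ℕ} (U : Fin k → Matrix B B ℂ)
    (h1 : ∀ i, (U i)ᴴ * U i = 1) (h2 : ∀ i, U i * (U i)ᴴ = 1) :
    (Matrix.of fun b j : Fin k → B => ∏ i, U i (b i) (j i))ᴴ * (Matrix.of fun b j : Fin k → B => ∏ i, U i (b i) (j i)) = 1 ∧
    (Matrix.of fun b j : Fin k → B => ∏ i, U i (b i) (j i)) * (Matrix.of fun b j : Fin k → B => ∏ i, U i (b i) (j i))ᴴ = 1 := by
  constructor
  · ext b b'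
    rw [← prod_one_entries]
    have : ∀ i, (1 : Matrix B B ℂ) (b i) (b' i) = ∑ j, star (U i j (b i)) * U i j (b' i) := fun i => by
      rw [← h1 i, Matrix.mul_apply]; rfl
    simp only [this]
    rw [← sum_pi_prod (fun i j => star (U i j (b i)) * U i j (b' i)), Matrix.mul_apply]
    refine Finset.sum_congr rfl fun j _ => ?_
    simp only [conjTranspose_apply, Matrix.of_apply, star_prod, Finset.prod_mul_distrib]
  · ext b b'
    rw [← prod_one_entries]
    have : ∀ i, (1 : Matrix B B ℂ) (b i) (b' i) = ∑ j, U i (b i) j * star (U i (b' i) j) := fun i => by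
      rw [← h2 i, Matrix.mul_apply]; rfl
    simp only [this]
    rw [← sum_pi_prod (fun i j => U i (b i) j * star (U i (b' i) j)), Matrix.mul_apply]
    refine Finset.sum_congr rfl fun j _ => ?_
    simp only [conjTranspose_apply, Matrix.of_apply, star_prod, Finset.prod_mul_distrib]

lemma qf_pow {B : Type*} [Fintype B] [DecidableEq B] {k : ℕ} {M U : Fin k → Matrix B B ℂ} {μ : Fin k → B → ℝ}
    (h : ∀ i, Dg (M i) (U i) (μ i)) (N : Matrix (Fin k → B) (Fin k → B) ℂ)
    (hN : ∀ b b', N b b' = ∏ i, M i (b i) (b' i)) (j : Fin k → B) :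
    qf N (fun b => ∏ i, U i (b i) (j i)) = ∏ i, μ i (j i) := by
  have h1 : ∀ i, ((μ i (j i) : ℝ) : ℂ) = ∑ a, ∑ a', star (U i a (j i)) * M i a a' * U i a' (j i) := by
    intro i
    have := congrFun (congrFun (h i).diag_eq (j i)) (j i)
    rw [diagonal_apply_eq] at this
    rw [← this, Matrix.mul_apply, Finset.sum_comm]
    refine Finset.sum_congr rfl fun a _ => ?_
    rw [Matrix.mul_apply, Finset.sum_mul]
    rfl
  have h2 : ((∏ i, μ i (j i) : ℝ) : ℂ) = ∑ a : Fin k → B, ∑ a' : Fin k → B,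
      star (∏ i, U i (a i) (j i)) * N a a' * ∏ i, U i (a' i) (j i) := by
    rw [Complex.ofReal_prod]
    simp only [h1]
    rw [← sum_pi_prod (fun i a => ∑ a', star (U i a (j i)) * M i a a' * U i a' (j i))]
    refine Finset.sum_congr rfl fun a _ => ?_
    rw [← sum_pi_prod (fun i a' => star (U i (a i) (j i)) * M i (a i) a' * U i a' (j i))]
    refine Finset.sum_congr rfl fun a' _ => ?_
    rw [star_prod, hN, ← Finset.prod_mul_distrib, ← Finset.prod_mul_distrib]
  rw [qf, ← h2, Complex.ofReal_re]

lemma Code.pow {A B : Type*} [Fintype A] [DecidableEq A] [Fintype B] [DecidableEq B]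
    {ρ : Matrix (A × B) (A × B) ℂ} (h : IsDensity ρ) {G : ℝ} (hG : Val ρ G) {δ : ℝ} (hδ : 0 < δ) :
    ∃ c : ℝ, 0 ≤ c ∧ c < 1 ∧ ∀ k : ℕ, Code (tpowAB ρ k) (Real.exp (k * (G + δ))) (c ^ k) := by
  classical
  obtain ⟨m, w, hw, rfl⟩ := hG
  choose U μ hD hμ using fun x => psd_dg (red_rk_psd h.1 (w x))
  set f : Fin m × B → ℝ := fun ω => Real.log (∑ j, μ ω.1 j) - Real.log (μ ω.1 ω.2) with hf
  have hs : ∑ ω : Fin m × B, μ ω.1 ω.2 = 1 := by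
    rw [Fintype.sum_prod_type, ← sum_rtr_red ρ h.2 w hw]
    exact Finset.sum_congr rfl fun x _ => (hD x).rtr_eq.symm
  have hm : ∑ x, gent (red (rk (w x)) ρ) = ∑ ω : Fin m × B, μ ω.1 ω.2 * f ω := by
    rw [Fintype.sum_prod_type]
    exact Finset.sum_congr rfl fun x _ => (hD x).gent
  obtain ⟨c, h0, h1, hc⟩ := chernoff (fun ω : Fin m × B => μ ω.1 ω.2) f (fun ω => hμ _ _) hs hδ
  rw [← hm] at hc
  refine ⟨c, h0, h1, fun k => ?_⟩
  set K : ℝ := k * (∑ x, gent (red (rk (w x)) ρ) + δ) with hK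
  refine Code.of (X := Fin k → Fin m) (fun x a => ∏ i, w (x i) (a i))
    (fun x => Matrix.of fun b j => ∏ i, U (x i) (b i) (j i))
    (fun x => Finset.univ.filter fun j => (∀ i, 0 < μ (x i) (j i)) ∧ ∑ i, f (x i, j i) ≤ K)
    (rk_complete_pow w hw k) ?_ ?_ ?_
  · intro x
    exact unit_pow (fun i => U (x i)) (fun i => (hD _).1) (fun i => (hD _).2.1)
  · intro x
    have hle : ∑ j : Fin k → B, ∏ i, (μ (x i) (j i) / ∑ b, μ (x i) b) ≤ 1 := by
      rw [sum_pi_prod (fun i j => μ (x i) j / ∑ b, μ (x i) b)]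
      refine Finset.prod_le_one (fun i _ => Finset.sum_nonneg fun j _ => div_nonneg (hμ _ _) (Finset.sum_nonneg fun j _ => hμ _ _)) fun i _ => ?_
      rw [← Finset.sum_div]
      exact div_self_le_one _
    have hcard : ((Finset.univ.filter fun j : Fin k → B => (∀ i, 0 < μ (x i) (j i)) ∧ ∑ i, f (x i, j i) ≤ K).card : ℝ) * Real.exp (-K) ≤ 1 := by
      refine le_trans ?_ hle
      rw [← nsmul_eq_mul, ← Finset.sum_const]
      refine le_trans (Finset.sum_le_sum fun j hj => ?_) (Finset.sum_le_sum_of_subset_of_nonneg (Finset.subset_univ _)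
        fun j _ _ => Finset.prod_nonneg fun i _ => div_nonneg (hμ _ _) (Finset.sum_nonneg fun j _ => hμ _ _))
      obtain ⟨-, hp, hle⟩ := Finset.mem_filter.1 hj
      have e : ∏ i, (μ (x i) (j i) / ∑ b, μ (x i) b) = Real.exp (- ∑ i, f (x i, j i)) := by
        rw [← Finset.sum_neg_distrib, Real.exp_sum]
        refine Finset.prod_congr rfl fun i _ => ?_
        have hpp : 0 < ∑ b, μ (x i) b := lt_of_lt_of_le (hp i) (Finset.single_le_sum (fun b _ => hμ (x i) b) (Finset.mem_univ (j i)))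
        simp only [hf, neg_sub]
        rw [Real.exp_sub, Real.exp_log (hp i), Real.exp_log hpp]
      rw [e]
      exact Real.exp_le_exp.2 (by linarith)
    rw [Real.exp_neg, ← div_eq_mul_inv, div_le_one (Real.exp_pos _)] at hcard
    exact hcard
  · refine le_trans ?_ (hc k)
    rw [← (Equiv.arrowProdEquivProdArrow (Fin k) (fun _ => Fin m) (fun _ => B)).symm.sum_comp, Fintype.sum_prod_type]
    refine Finset.sum_le_sum fun x _ => ?_
    rw [bad]
    refine le_trans (Finset.sum_le_sum (g := fun j : Fin k → B => if K < ∑ i, f (x i, j i) then ∏ i, μ (x i) (j i) else 0) fun j hj => ?_)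
      (Finset.sum_le_sum_of_subset_of_nonneg (Finset.subset_univ _) fun j _ _ => ?_)
    · rw [show (fun b => (Matrix.of fun b j : Fin k → B => ∏ i, U (x i) (b i) (j i)) b j) = fun b : Fin k → B => ∏ i, U (x i) (b i) (j i) from rfl,
        qf_pow (fun i => hD (x i)) _ (red_pow ρ fun i => w (x i)) j]
      split_ifs with hlt
      · exact le_rfl
      · rw [Finset.mem_compl, Finset.mem_filter] at hj
        simp only [Finset.mem_univ, true_and, not_and_or, not_le, not_forall, not_lt] at hj
        rcases hj with ⟨i, hi⟩ | hj
        · rw [Finset.prod_eq_zero (Finset.mem_univ i) (le_antisymm hi (hμ _ _))]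
        · exact absurd hj hlt
    · split_ifs
      · exact Finset.prod_nonneg fun i _ => hμ _ _
      · exact le_rfl

lemma code_protocol {α β : Type*} [Fintype α] [DecidableEq α] [Fintype β] [DecidableEq β]
    {ρ : Matrix (α × β) (α × β) ℂ} (h : IsDensity ρ) (n : ℕ) {L ε1 : ℝ} (hc : Code (tpowAB ρ n) L ε1)
    {Pj : Matrix (Fin n → α) (Fin n → α) ℂ} {d ε2 : ℝ} (hP1 : Pjᴴ = Pj) (hP2 : Pj * Pj = Pj)
    (hd : 1 ≤ d) (hPd : Pj.trace = (d : ℂ)) (hε2 : ((1 - Pj) * tpow (ptraceRight ρ) n).trace.re ≤ ε2)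
    (N dC : ℕ) (hN : 0 < N) (hdC : N * L ≤ dC)
    (hN2 : N + Fintype.card (Fin n → α) ≤ Fintype.card (Fin n → α) * dC) :
    ∃ Pr : Protocol α β n, Pr.dC = dC ∧ Pr.dAp = 1 ∧
      Pr.dBp = Fintype.card (Fin n → α) * Fintype.card (Fin n → β) ∧
      Pr.dY = Fintype.card (Fin n → α) * dC ∧
      1 - (16 * d / N + 8 * ε1 + 12 * ε2) ≤ succP ρ Pr := by
  classical
  obtain ⟨m, w, V, J, h1, h2, h3, h4⟩ := hc
  have hσ := tpowAB_density h n
  have hσA := ptraceRight_density hσ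
  rw [← ptraceRight_tpowAB] at hε2
  obtain ⟨t, v, hv, hsum⟩ := oneshot hσA.1 hσA.2 h1
    (M := fun x => bop (tpowAB ρ n) (V x) (J x)) (fun x => bop_psd hσ.1 _ _)
    (fun x u => by rw [qf_bop]; exact bad_le hσ.1 _ (h2 x).2 _ _) (ε1 := ε1)
    (by simpa only [qf_bop] using h4) hP1 hP2 hd hPd hε2 N hN
  have hdC0 : 0 < dC := by
    rcases Nat.eq_zero_or_pos dC with h0 | h0
    · subst h0; omega
    · exact h0
  obtain ⟨e⟩ := Function.Embedding.nonempty_of_card_le (α := Fin N ⊕ (Fin n → α))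
    (β := Fin (Fintype.card (Fin n → α) * dC)) (by simpa using hN2)
  set v' := Function.extend e v 0 with hv'
  set V' := Function.extend e (Sum.elim (fun y => V (t y)) (fun _ => 1)) (fun _ => (1 : Matrix (Fin n → β) (Fin n → β) ℂ)) with hV'
  set J' := Function.extend e (Sum.elim (fun y => J (t y)) (fun _ => ∅)) (fun _ => (∅ : Finset (Fin n → β))) with hJ'
  have ev : ∀ s, v' (e s) = v s := fun s => e.injective.extend_apply _ _ _
  have eV : ∀ s, V' (e s) = Sum.elim (fun y => V (t y)) (fun _ => 1) s := fun s => e.injective.extend_apply _ _ _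
  have eJ : ∀ s, J' (e s) = Sum.elim (fun y => J (t y)) (fun _ => ∅) s := fun s => e.injective.extend_apply _ _ _
  have nv : ∀ y, y ∉ Set.range e → v' y = 0 := fun y hy => Function.extend_apply' _ _ _ hy
  have nV : ∀ y, y ∉ Set.range e → V' y = 1 := fun y hy => Function.extend_apply' _ _ _ hy
  have nJ : ∀ y, y ∉ Set.range e → J' y = ∅ := fun y hy => Function.extend_apply' _ _ _ hy
  have hVV : ∀ y, (V' y)ᴴ * V' y = 1 ∧ V' y * (V' y)ᴴ = 1 := by
    intro y
    by_cases hy : y ∈ Set.range e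
    · obtain ⟨s, rfl⟩ := hy
      rw [eV]
      rcases s with s | s
      · exact h2 _
      · simp
    · rw [nV y hy]; simp
  obtain ⟨Pr, p1, p2, p3, p4, p5⟩ := mkProtocol h n dC _ hdC0 rfl v' (by
      rw [← hv]
      exact (Fintype.sum_of_injective e e.injective _ _ (fun y hy => by
        rw [nv y hy]; ext a b; simp [rk, vecMulVec_apply]) (fun s => by rw [ev])).symm)
    V' (fun y => (hVV y).1) (fun y => (hVV y).2) J' (by
      rw [← Fintype.sum_of_injective e e.injective (fun s => (Sum.elim (fun y => J (t y)) (fun _ => ∅) s).card) _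
        (fun y hy => by rw [nJ y hy]; rfl) (fun s => by rw [eJ]), Fintype.sum_sum_type]
      simp only [Sum.elim_inl, Sum.elim_inr, Finset.card_empty, Finset.sum_const_zero, add_zero]
      have : ((∑ y, (J (t y)).card : ℕ) : ℝ) ≤ dC := by
        push_cast
        refine le_trans (Finset.sum_le_sum fun y _ => h3 (t y)) ?_
        simpa using hdC
      exact_mod_cast this)
  refine ⟨Pr, p1, p2, p3, p4, le_trans ?_ p5⟩
  have hb : ∑ y, bad (tpowAB ρ n) (V' y) (J' y) (v' y) = ∑ y, qf (bop (tpowAB ρ n) (V (t y)) (J (t y))) (v (Sum.inl y))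
      + ∑ a, qf (ptraceRight (tpowAB ρ n)) (v (Sum.inr a)) := by
    rw [← Fintype.sum_of_injective e e.injective (fun s => bad (tpowAB ρ n) (Sum.elim (fun y => V (t y)) (fun _ => 1) s)
      (Sum.elim (fun y => J (t y)) (fun _ => ∅) s) (v s)) _
        (fun y hy => by rw [nv y hy, ← qf_bop, qf]; simp) (fun s => by rw [eJ, eV, ev]), Fintype.sum_sum_type]
    simp only [Sum.elim_inl, Sum.elim_inr, qf_bop]
    congr 1
    refine Finset.sum_congr rfl fun a _ => ?_
    rw [bad_empty _ (by simp)]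
  rw [hb]
  linarith

lemma typ_proj {A : Type*} [Fintype A] [DecidableEq A] {M : Matrix A A ℂ} (h : IsDensity M) {δ : ℝ} (hδ : 0 < δ) :
    ∃ c : ℝ, 0 ≤ c ∧ c < 1 ∧ ∀ n : ℕ, 0 < n → ∃ (Pj : Matrix (Fin n → A) (Fin n → A) ℂ) (d : ℝ),
      Pjᴴ = Pj ∧ Pj * Pj = Pj ∧ 1 ≤ d ∧ d ≤ Real.exp (n * (entropy M + δ)) ∧ Pj.trace = (d : ℂ) ∧
      ((1 - Pj) * tpow M n).trace.re ≤ c ^ n := by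
  classical
  obtain ⟨W, l, hD, hl⟩ := psd_dg h.1
  have hs : ∑ i, l i = 1 := hD.sum_one h.2
  obtain ⟨c, h0, h1, hc⟩ := typ_lo l hl hs hδ
  rw [← hD.entropy] at hc
  refine ⟨c, h0, h1, fun n hn => ?_⟩
  set K := Real.exp (-(n * (entropy M + δ))) with hK
  have hn' := hD.tpow n
  set O := tpow W n
  set q : (Fin n → A) → ℝ := fun x => if ∏ i, l (x i) < K then 0 else 1 with hq
  have hall : ∑ x : Fin n → A, ∏ i, l (x i) = 1 := by
    rw [sum_pi_prod (fun _ i => l i), hs]; simp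
  have hlow : ∑ x : Fin n → A, q x * ∏ i, l (x i) ≥ 1 - c ^ n := by
    have := hc n
    have e : ∑ x : Fin n → A, q x * ∏ i, l (x i) + ∑ x : Fin n → A, (if ∏ i, l (x i) < K then ∏ i, l (x i) else 0) = 1 := by
      rw [← Finset.sum_add_distrib, ← hall]
      refine Finset.sum_congr rfl fun x _ => ?_
      simp only [hq]; split_ifs <;> simp
    linarith
  refine ⟨od O q, ∑ x, q x, od_ct _, ?_, ?_, ?_, ?_, ?_⟩
  · rw [od_mul hn'.1]
    congr 1
    funext x
    simp only [hq]; split_ifs <;> simp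
  · by_contra hlt
    have hz : ∀ x, q x = 0 := by
      intro x
      by_contra hx
      apply hlt
      have : q x = 1 := by
        simp only [hq] at hx ⊢; split_ifs at hx ⊢ with hh <;> simp_all
      rw [← this]
      exact Finset.single_le_sum (f := q) (fun y _ => by simp only [hq]; split_ifs <;> norm_num) (Finset.mem_univ x)
    simp only [hz, zero_mul, Finset.sum_const_zero] at hlow
    have : c ^ n < 1 := pow_lt_one₀ h0 h1 hn.ne'
    linarith
  · have : (∑ x, q x) * K ≤ 1 := by
      rw [← hall, Finset.sum_mul]
      refine Finset.sum_le_sum fun x _ => ?_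
      simp only [hq]; split_ifs with hh
      · simp only [zero_mul]; exact Finset.prod_nonneg fun i _ => hl _
      · rw [one_mul]; exact not_lt.1 hh
    rw [hK, Real.exp_neg, ← div_eq_mul_inv, div_le_one (Real.exp_pos _)] at this
    exact this
  · rw [od, Matrix.trace_mul_comm, ← Matrix.mul_assoc, hn'.1, Matrix.one_mul, Matrix.trace_diagonal]
    push_cast; rfl
  · have e : ((1 - od O q) * tpow M n).trace.re = 1 - (od O q * tpow M n).trace.re := by
      rw [sub_mul, Matrix.one_mul, Matrix.trace_sub, (tpow_density h n).2]; simp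
    rw [e, od, qt_diag]
    have : ∀ x, qf (tpow M n) (fun a => O a x) = ∏ i, l (x i) := by
      intro x
      exact qf_pow (fun _ => hD) _ (fun b b' => rfl) x
    simp only [this]
    linarith

lemma seq_code {α β : Type*} [Fintype α] [DecidableEq α] [Fintype β] [DecidableEq β]
    {ρ : Matrix (α × β) (α × β) ℂ} (h : IsDensity ρ) {C : ℝ}
    (hC : Tendsto (fun n : ℕ => Cn ρ n / n) atTop (nhds C)) {η : ℝ} (hη : 0 < η) :
    ∃ (l : ℕ) (c : ℝ), 0 < l ∧ 0 ≤ c ∧ c < 1 ∧ ∀ n : ℕ, ∃ L : ℝ, 1 ≤ L ∧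
      Real.log L ≤ n * (C + 3 * η) + l * Real.log (Fintype.card β) ∧ Code (tpowAB ρ n) L (c ^ (n / l)) := by
  obtain ⟨l, hl1, hl0⟩ := ((hC.eventually (gt_mem_nhds (lt_add_of_pos_right C hη))).and (eventually_gt_atTop 0)).exists
  have hl0' : (0 : ℝ) < l := by exact_mod_cast hl0
  have hl1' : (1 : ℝ) ≤ l := by exact_mod_cast hl0
  obtain ⟨G, hG, hG2⟩ := exists_lt_of_csInf_lt (Val.exists (tpowAB ρ l))
    (lt_add_of_pos_right (Cn ρ l) hη)
  have hG0 : 0 ≤ G := Val.nonneg (tpowAB_density h l).1 hG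
  have hGl : G + η ≤ l * (C + 3 * η) := by
    rw [div_lt_iff₀ hl0'] at hl1
    have : η ≤ l * η := by nlinarith
    nlinarith
  obtain ⟨c, h0, h1, hc⟩ := Code.pow (tpowAB_density h l) hG hη
  obtain ⟨hα, hβ⟩ := density_nonempty h
  have hb : (1 : ℝ) ≤ Fintype.card β := by exact_mod_cast Fintype.card_pos
  have hlb : 0 ≤ Real.log (Fintype.card β) := Real.log_nonneg hb
  refine ⟨l, c, hl0, h0, h1, fun n => ?_⟩
  have hk := Code.tpow_add h (n % l) (Code.tpow_mul (n / l) l (hc (n / l)))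
  have hnn : n / l * l + n % l = n := by rw [mul_comm]; exact Nat.div_add_mod n l
  rw [hnn] at hk
  refine ⟨_, ?_, ?_, hk⟩
  · refine one_le_mul_of_one_le_of_one_le (Real.one_le_exp (by positivity)) ?_
    simp only [Fintype.card_fun, Fintype.card_fin, Nat.cast_pow]
    exact one_le_pow₀ hb
  · simp only [Fintype.card_fun, Fintype.card_fin, Nat.cast_pow]
    rw [Real.log_mul (Real.exp_pos _).ne' (pow_pos (by linarith) _).ne', Real.log_exp, Real.log_pow]
    have hr : ((n % l : ℕ) : ℝ) ≤ l := by exact_mod_cast (Nat.mod_lt n hl0).le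
    have hkl : ((n / l : ℕ) : ℝ) * l ≤ n := by exact_mod_cast Nat.div_mul_le_self n l
    have hpos : 0 ≤ C + 3 * η := by
      have : 0 ≤ l * (C + 3 * η) := by linarith
      exact nonneg_of_mul_nonneg_right this hl0'
    have a1 : ((n / l : ℕ) : ℝ) * (G + η) ≤ ((n / l : ℕ) : ℝ) * (l * (C + 3 * η)) :=
      mul_le_mul_of_nonneg_left hGl (Nat.cast_nonneg _)
    have a2 : ((n / l : ℕ) : ℝ) * l * (C + 3 * η) ≤ n * (C + 3 * η) := mul_le_mul_of_nonneg_right hkl hpos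
    have a3 := mul_le_mul_of_nonneg_right hr hlb
    nlinarith

lemma achiev {α β : Type*} [Fintype α] [DecidableEq α] [Fintype β] [DecidableEq β]
    {ρ : Matrix (α × β) (α × β) ℂ} (h : IsDensity ρ) {C : ℝ}
    (hC : Tendsto (fun n : ℕ => Cn ρ n / n) atTop (nhds C)) :
    Achievable ρ (Real.log (Fintype.card α) + Real.log (Fintype.card β) - entropy (ptraceRight ρ) - C)
      (Real.log (Fintype.card α) + entropy (ptraceRight ρ) + C) := by
  intro ε hε δ hδ
  set H := entropy (ptraceRight ρ) with hH
  set η := δ / 6 with hη'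
  have hη : 0 < η := by positivity
  obtain ⟨l, c1, hl, h10, h11, hcode⟩ := seq_code h hC hη
  obtain ⟨c2, h20, h21, htyp⟩ := typ_proj (ptraceRight_density h) hη
  obtain ⟨hα, hβ⟩ := density_nonempty h
  have ha : (1 : ℝ) ≤ Fintype.card α := by exact_mod_cast Fintype.card_pos
  have hb : (1 : ℝ) ≤ Fintype.card β := by exact_mod_cast Fintype.card_pos
  have hlb : 0 ≤ Real.log (Fintype.card β) := Real.log_nonneg hb
  have hH0 : 0 ≤ H := entropy_nonneg (ptraceRight_density h)
  set t := min 1 (ε / 8) with ht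
  have ht0 : 0 < t := lt_min one_pos (by positivity)
  set er : ℕ → ℝ := fun n => 16 * Real.exp (-η) ^ n + 8 * c1 ^ (n / l) + 12 * c2 ^ n with her
  have her0 : Tendsto er atTop (nhds 0) := by
    have e1 : Tendsto (fun n : ℕ => Real.exp (-η) ^ n) atTop (nhds 0) :=
      tendsto_pow_atTop_nhds_zero_of_lt_one (Real.exp_pos _).le (by rw [Real.exp_lt_one_iff]; linarith)
    have e2 : Tendsto (fun n : ℕ => c1 ^ (n / l)) atTop (nhds 0) :=
      (tendsto_pow_atTop_nhds_zero_of_lt_one h10 h11).comp (Nat.tendsto_div_const_atTop hl.ne')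
    have e3 := tendsto_pow_atTop_nhds_zero_of_lt_one h20 h21
    simpa using ((e1.const_mul 16).add (e2.const_mul 8)).add (e3.const_mul 12)
  have her1 : ∀ᶠ n in atTop, 2 * (er n + t + er n / t) < ε := by
    have : Tendsto (fun n => 2 * (er n + t + er n / t)) atTop (nhds (2 * (0 + t + 0 / t))) :=
      ((her0.add_const t).add (her0.div_const t)).const_mul 2
    refine this.eventually (gt_mem_nhds ?_)
    have : t ≤ ε / 8 := min_le_right _ _
    simp only [zero_div]; linarith
  have hcst : ∀ᶠ n : ℕ in atTop, (Real.log 8 + l * Real.log (Fintype.card β)) / n < η :=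
    (tendsto_const_div_atTop_nhds_zero_nat _).eventually (gt_mem_nhds hη)
  obtain ⟨N0, hN0⟩ := eventually_atTop.1 (her1.and (hcst.and (eventually_gt_atTop 0)))
  refine ⟨N0, fun n hn => ?_⟩
  obtain ⟨b1, b2, b3⟩ := hN0 n hn
  have hn0 : (0 : ℝ) < n := by exact_mod_cast b3
  obtain ⟨L, hL1, hL2, hcd⟩ := hcode n
  obtain ⟨Pj, d, hP1, hP2, hd1, hd2, hPd, htr⟩ := htyp n b3
  set X := Real.exp (n * (H + 2 * η)) with hX
  have hX1 : 1 ≤ X := Real.one_le_exp (by positivity)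
  set N := ⌈X⌉₊ with hNdef
  have hNX : X ≤ N := Nat.le_ceil _
  have hNX2 : (N : ℝ) ≤ 2 * X := by
    have := (Nat.ceil_lt_add_one (by linarith : 0 ≤ X)).le
    linarith
  have hNpos : 0 < N := Nat.ceil_pos.2 (by linarith)
  set dC := ⌈(N : ℝ) * L⌉₊ + N + 1 with hdC
  have hNL : 0 ≤ (N : ℝ) * L := by positivity
  have hcA : 0 < Fintype.card (Fin n → α) := Fintype.card_pos
  obtain ⟨Pr, p1, p2, p3, p4, p5⟩ := code_protocol h n hcd hP1 hP2 hd1 hPd htr N dC hNpos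
    (by rw [hdC]; push_cast; have := Nat.le_ceil ((N : ℝ) * L); have : (0:ℝ) ≤ N := Nat.cast_nonneg _; linarith)
    (by rw [hdC]; nlinarith)
  have hdC8 : (dC : ℝ) ≤ 8 * X * L := by
    have h1 := (Nat.ceil_lt_add_one hNL).le
    have h2 : (N : ℝ) ≤ N * L := le_mul_of_one_le_right (Nat.cast_nonneg _) hL1
    have h3 : (1 : ℝ) ≤ N := by exact_mod_cast hNpos
    have h4 : (N : ℝ) * L ≤ 2 * X * L := mul_le_mul_of_nonneg_right hNX2 (by linarith)
    rw [hdC]; push_cast; linarith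
  have hdC0 : (0 : ℝ) < dC := by rw [hdC]; positivity
  have hlog : Real.log dC ≤ n * (H + C + 6 * η) := by
    refine (Real.log_le_log hdC0 hdC8).trans ?_
    rw [Real.log_mul (by positivity) (by positivity), Real.log_mul (by norm_num) (by positivity), hX, Real.log_exp]
    rw [div_lt_iff₀ hn0] at b2
    nlinarith
  have hlogn : Real.log dC / n ≤ H + C + δ := by
    rw [div_le_iff₀ hn0]
    refine hlog.trans (le_of_eq ?_)
    rw [hη']; ring
  refine ⟨Pr, ?_, ?_, ?_⟩
  · rw [commRate, p4]
    simp only [Fintype.card_fun, Fintype.card_fin, Nat.cast_mul, Nat.cast_pow]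
    rw [Real.log_mul (by positivity) hdC0.ne', Real.log_pow, add_div, mul_div_cancel_left₀ _ hn0.ne']
    linarith
  · rw [purityRate, p1, p2, p3]
    simp only [Fintype.card_fun, Fintype.card_fin, Nat.cast_mul, Nat.cast_pow, Nat.cast_one, one_mul]
    rw [Real.log_mul (by positivity) (by positivity), Real.log_pow, Real.log_pow, sub_div, add_div,
      mul_div_cancel_left₀ _ hn0.ne', mul_div_cancel_left₀ _ hn0.ne']
    linarith
  · refine (error_le h Pr (η := er n) (le_trans ?_ p5) ht0 (min_le_left _ _)).trans b1.le
    have : d / N ≤ Real.exp (-η) ^ n := by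
      rw [div_le_iff₀ (by positivity)]
      refine hd2.trans ?_
      have : Real.exp (n * (H + η)) = Real.exp (-η) ^ n * X := by
        rw [← Real.exp_nat_mul, hX, ← Real.exp_add]; congr 1; ring
      rw [← hH, this]
      exact mul_le_mul_of_nonneg_left hNX (by positivity)
    simp only [her]
    rw [mul_div_assoc]
    linarith

theorem final_thm {α β : Type*} [Fintype α] [DecidableEq α]
    [Fintype β] [DecidableEq β] (ρ : Matrix (α × β) (α × β) ℂ) (hρ : IsDensity ρ) :
    ∃ D : ℝ,
      Filter.Tendsto (fun n : ℕ =>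
          sSup { v : ℝ | ∃ (m : ℕ) (Λ : POVM (Fin n → α) (Fin m)),
            (∀ y, ∃ w : (Fin n → α) → ℂ, Λ.elem y = vecMulVec w (star w)) ∧
            v = mutualInfo (measureLeft Λ (tpowAB ρ n)) } / n)
        Filter.atTop (nhds D) ∧
      sSup { P : ℝ | ∃ R : ℝ, 0 ≤ R ∧ Achievable ρ P R } =
        kappa (ptraceRight ρ) + kappa (ptraceLeft ρ) + D := by
  obtain ⟨C, hC0, hC⟩ := Cn_tendsto hρ
  refine ⟨entropy (ptraceLeft ρ) - C, ?_, ?_⟩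
  · have : Tendsto (fun n : ℕ => entropy (ptraceLeft ρ) - Cn ρ n / n) atTop (nhds (entropy (ptraceLeft ρ) - C)) :=
      hC.const_sub _
    refine this.congr' ?_
    filter_upwards [eventually_gt_atTop 0] with n hn
    have hn0 : (n : ℝ) ≠ 0 := by exact_mod_cast hn.ne'
    rw [sSup_eq hρ n]
    field_simp
  · obtain ⟨hα, hβ⟩ := density_nonempty hρ
    have hg : IsGreatest { P : ℝ | ∃ R : ℝ, 0 ≤ R ∧ Achievable ρ P R }
        (Real.log (Fintype.card α) + Real.log (Fintype.card β) - entropy (ptraceRight ρ) - C) := by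
      constructor
      · refine ⟨_, ?_, achiev hρ hC⟩
        have h1 : 0 ≤ Real.log (Fintype.card α) := Real.log_nonneg (by exact_mod_cast Fintype.card_pos)
        have h2 := entropy_nonneg (ptraceRight_density hρ)
        linarith
      · rintro P ⟨R, -, hA⟩
        exact converse hρ hC hA
    rw [hg.csSup_eq, kappa, kappa]
    ring

end

/-- **Unlimited-communication limit.** In the limit `R → ∞` the 1-way distillable local
purity reduces to
`κ_→(ρ^{AB},∞) = κ(ρ^A) + κ(ρ^B) + lim_{n→∞} (1/n) max_Λ I(X;B^n)_{(Λ⊗1)ρ^{⊗n}}`,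
the maximum over rank-1 POVMs on `A^n`; i.e. `P_→(ρ^{AB},∞)` equals the one-way
distillable common randomness `D_→(ρ^{AB})`. -/
theorem unlimited_communication_limit {α β : Type*} [Fintype α] [DecidableEq α]
    [Fintype β] [DecidableEq β] (ρ : Matrix (α × β) (α × β) ℂ) (hρ : IsDensity ρ) :
    ∃ D : ℝ,
      Filter.Tendsto (fun n : ℕ =>
          sSup { v : ℝ | ∃ (m : ℕ) (Λ : POVM (Fin n → α) (Fin m)),
            (∀ y, ∃ w : (Fin n → α) → ℂ, Λ.elem y = vecMulVec w (star w)) ∧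
            v = mutualInfo (measureLeft Λ (tpowAB ρ n)) } / n)
        Filter.atTop (nhds D) ∧
      sSup { P : ℝ | ∃ R : ℝ, 0 ≤ R ∧ Achievable ρ P R } =
        kappa (ptraceRight ρ) + kappa (ptraceLeft ρ) + D := by
  exact final_thm ρ hρ

end LPD
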